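/- arXiv:cs/0411064 — 2 statements merged into one kernel-verified Lean document; each statement's English description precedes it below -/
import Mathlib

section
/- There is a universal constant C such that for every weighted connected graph G = (V,E,w) with n = |V| ≥ 4 vertices and every vertex x0 ∈ V, there exists a spanning tree T of G that is a subgraph of G satisfying radius(T, x0) ≤ 2√e · radius(G, x0) and avestretch(T, E) ≤ C · (log n)^2 · log log n. -/
open scoped Classical

structure WGraph (V : Type) (E : Type) where
  ends : E → V × V
  w : E → ℝ
  w_pos : ∀ e, 0 < w e

namespace WGraph

variable {V E : Type}

/-- The length of an edge is the reciprocal of its weight. -/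
noncomputable def len (G : WGraph V E) (e : E) : ℝ := 1 / G.w e

/-- A walk in a multigraph, recorded as a sequence of edge traversals. -/
inductive Walk (G : WGraph V E) : V → V → Type
  | nil (v : V) : Walk G v v
  | cons (u v x : V) (e : E)
      (h : G.ends e = (u, v) ∨ G.ends e = (v, u))
      (p : Walk G v x) : Walk G u x

/-- The length of a walk: the sum of the lengths of its edges. -/
noncomputable def Walk.length {G : WGraph V E} : ∀ {u v : V}, G.Walk u v → ℝ
  | _, _, .nil _ => 0
  | _, _, .cons _ _ _ e _ p => G.len e + Walk.length p

/-- The list of vertices visited by a walk. -/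
def Walk.support {G : WGraph V E} : ∀ {u v : V}, G.Walk u v → List V
  | _, _, .nil v => [v]
  | _, _, .cons u _ _ _ _ p => u :: Walk.support p

def Connected (G : WGraph V E) : Prop := ∀ u v : V, Nonempty (G.Walk u v)

/-- Shortest-path distance. -/
noncomputable def dist (G : WGraph V E) (u v : V) : ℝ :=
  sInf {l | ∃ p : G.Walk u v, p.length = l}

/-- Shortest-path distance inside the subgraph induced on `A`. -/
noncomputable def distOn (G : WGraph V E) (A : Set V) (u v : V) : ℝ :=
  sInf {l | ∃ p : G.Walk u v, (∀ z ∈ p.support, z ∈ A) ∧ p.length = l}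

/-- The distance from a vertex to a set of vertices. -/
noncomputable def distToSet (G : WGraph V E) (u : V) (S : Set V) : ℝ :=
  sInf {l | ∃ s ∈ S, G.dist u s = l}

/-- The distance from a vertex to a set, within the subgraph induced on `A`. -/
noncomputable def distToSetOn (G : WGraph V E) (A : Set V) (u : V) (S : Set V) : ℝ :=
  sInf {l | ∃ s ∈ S, G.distOn A u s = l}

/-- radius(G,x): the smallest `r` such that every vertex is within distance `r` of `x`. -/
noncomputable def radius (G : WGraph V E) (x : V) : ℝ :=
  sInf {r | ∀ v : V, G.dist x v ≤ r}

/-- The radius of the subgraph induced on `A`, about `x`. -/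
noncomputable def radiusOn (G : WGraph V E) (A : Set V) (x : V) : ℝ :=
  sInf {r | ∀ v ∈ A, G.distOn A x v ≤ r}

/-- The subgraph induced on `A` is connected. -/
def ConnectedOn (G : WGraph V E) (A : Set V) : Prop :=
  ∀ u ∈ A, ∀ v ∈ A, ∃ p : G.Walk u v, ∀ z ∈ p.support, z ∈ A

/-- The spanning subgraph with edge set `T`. -/
def restrictE (G : WGraph V E) (T : Set E) : WGraph V T where
  ends e := G.ends e.1
  w e := G.w e.1
  w_pos e := G.w_pos e.1

/-- `T` is the edge set of a spanning tree of `G` (a subgraph of `G`). -/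
def IsSpanningTree [Fintype V] (G : WGraph V E) (T : Finset E) : Prop :=
  (G.restrictE (T : Set E)).Connected ∧ T.card + 1 = Fintype.card V

/-- stretch_T(u,v) = dist_T(u,v)/d(u,v) for the edge e = (u,v). -/
noncomputable def stretch (G : WGraph V E) (T : Finset E) (e : E) : ℝ :=
  (G.restrictE (T : Set E)).dist (G.ends e).1 (G.ends e).2 / G.len e

/-- The average stretch over all edges. -/
noncomputable def avestretch [Fintype E] (G : WGraph V E) (T : Finset E) : ℝ :=
  (∑ e : E, G.stretch T e) / (Fintype.card E : ℝ)

/-- The Alon–Karp–Peleg–West stretch: dist_T(u,v)/dist_G(u,v). -/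
noncomputable def stretchAKPW (G : WGraph V E) (T : Finset E) (e : E) : ℝ :=
  (G.restrictE (T : Set E)).dist (G.ends e).1 (G.ends e).2 /
    G.dist (G.ends e).1 (G.ends e).2

/-- The average AKPW stretch over all edges. -/
noncomputable def avestretchAKPW [Fintype E] (G : WGraph V E) (T : Finset E) : ℝ :=
  (∑ e : E, G.stretchAKPW T e) / (Fintype.card E : ℝ)

/-- The ball of radius `r` around `x`. -/
def ball (G : WGraph V E) (r : ℝ) (x : V) : Set V := {v | G.dist x v ≤ r}

/-- The ball shell of radius `r` around `x`. -/
def ballShell (G : WGraph V E) (r : ℝ) (x : V) : Set V :=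
  {u | u ∉ G.ball r x ∧ ∃ e : E, ∃ z ∈ G.ball r x,
    (G.ends e = (u, z) ∨ G.ends e = (z, u)) ∧ G.dist x u = G.dist x z + G.len e}

/-- The set of edges with exactly one endpoint in `S`. -/
def bdry (G : WGraph V E) (S : Set V) : Set E :=
  {e | ((G.ends e).1 ∈ S ∧ (G.ends e).2 ∉ S) ∨ ((G.ends e).1 ∉ S ∧ (G.ends e).2 ∈ S)}

/-- The set of edges with both endpoints in `S`. -/
def edgesIn (G : WGraph V E) (S : Set V) : Set E :=
  {e | (G.ends e).1 ∈ S ∧ (G.ends e).2 ∈ S}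

/-- The set of edges with one endpoint in `S` and the other in `T`. -/
def edgesBetween (G : WGraph V E) (S T : Set V) : Set E :=
  {e | ((G.ends e).1 ∈ S ∧ (G.ends e).2 ∈ T) ∨ ((G.ends e).1 ∈ T ∧ (G.ends e).2 ∈ S)}

/-- vol(S): the number of edges with at least one endpoint in `S`. -/
noncomputable def volV (G : WGraph V E) (S : Set V) : ℕ :=
  {e : E | (G.ends e).1 ∈ S ∨ (G.ends e).2 ∈ S}.ncard

/-- cost(F): the sum of the weights of the edges in `F`. -/
noncomputable def cost [Fintype E] (G : WGraph V E) (F : Set E) : ℝ :=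
  ∑ e : E, F.indicator G.w e

/-- A star-decomposition of `G` with center `x0`, parts `P i`, anchors `x i`,
`y i ∈ P 0`, and bridge edges `b i` for `i ≠ 0`. -/
structure IsStarDecomp (G : WGraph V E) (x0 : V) (k : ℕ)
    (P : Fin (k + 1) → Set V) (x y : Fin (k + 1) → V)
    (b : Fin (k + 1) → E) : Prop where
  disj : ∀ i j, i ≠ j → Disjoint (P i) (P j)
  cover : ⋃ i, P i = Set.univ
  center : x0 ∈ P 0
  conn : ∀ i, G.ConnectedOn (P i)
  anchor : ∀ i, x i ∈ P i
  x0eq : x 0 = x0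
  bridge : ∀ i, i ≠ 0 → y i ∈ P 0 ∧
    (G.ends (b i) = (x i, y i) ∨ G.ends (b i) = (y i, x i))

/-- A (δ,ε)-star-decomposition. -/
def IsStarDecompDE (G : WGraph V E) (x0 : V) (δ ε : ℝ) (k : ℕ)
    (P : Fin (k + 1) → Set V) (x y : Fin (k + 1) → V)
    (b : Fin (k + 1) → E) : Prop :=
  G.IsStarDecomp x0 k P x y b ∧
  δ * G.radius x0 ≤ G.radiusOn (P 0) x0 ∧
  G.radiusOn (P 0) x0 ≤ (1 - δ) * G.radius x0 ∧
  ∀ i, i ≠ 0 →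
    G.radiusOn (P 0) x0 + G.len (b i) + G.radiusOn (P i) (x i) ≤
      (1 + ε) * G.radius x0

/-- A concentric system in `G` (indexed by nonnegative radii). -/
structure IsConcentric (G : WGraph V E) (L : ℝ → Set V) : Prop where
  nonempty : (L 0).Nonempty
  mono : ∀ r r' : ℝ, 0 ≤ r → r < r' → L r ⊆ L r'
  closed : ∀ r : ℝ, 0 ≤ r → ∀ e : E,
    ((G.ends e).1 ∈ L r → (G.ends e).2 ∈ L (r + G.len e)) ∧
    ((G.ends e).2 ∈ L r → (G.ends e).1 ∈ L (r + G.len e))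

/-- The total length of the traversals of a walk that are not forward
(with respect to `S`). -/
noncomputable def Walk.coneCost {G : WGraph V E} (S : Set V) :
    ∀ {u v : V}, G.Walk u v → ℝ
  | _, _, .nil _ => 0
  | _, _, .cons a c _ e _ p =>
      (if G.distToSet a S + G.len e = G.distToSet c S then 0 else G.len e) +
        Walk.coneCost S p

/-- The cone of width `l` around `v` induced by `S`. -/
def cone (G : WGraph V E) (S : Set V) (l : ℝ) (v : V) : Set V :=
  {u | ∃ p : G.Walk v u, Walk.coneCost S p ≤ l}

/-- `coneCost` computed within the subgraph induced on `A`. -/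
noncomputable def Walk.coneCostOn {G : WGraph V E} (A S : Set V) :
    ∀ {u v : V}, G.Walk u v → ℝ
  | _, _, .nil _ => 0
  | _, _, .cons a c _ e _ p =>
      (if G.distToSetOn A a S + G.len e = G.distToSetOn A c S then 0 else G.len e) +
        Walk.coneCostOn A S p

/-- The cone of width `l` around `v` induced by `S`, computed in the subgraph
induced on `A`. -/
def coneOn (G : WGraph V E) (A S : Set V) (l : ℝ) (v : V) : Set V :=
  {u | ∃ p : G.Walk v u, (∀ z ∈ p.support, z ∈ A) ∧ Walk.coneCostOn A S p ≤ l}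

end WGraph

namespace LowStretch

/-- Splitting an interval into pieces so that a monotone function grows by a bounded factor on one
piece, whose length is controlled by the value of the function there. -/
theorem exists_scale (g : ℝ → ℝ) (hg : Monotone g) {M Δ : ℝ} (hpos : ∀ r, 0 < g r)
    (hM : ∀ r, g r ≤ M) (hΔ : 0 < Δ) {t Nm : ℕ} (hNm : 1 + Real.log (M / g 0) ≤ Nm)
    (ht : Nm < 2 ^ t) :
    ∃ a b : ℝ, ∃ N : ℕ, 0 ≤ a ∧ a < b ∧ b ≤ Δ ∧ g b ≤ Real.exp 1 * g a ∧ 1 ≤ N ∧ N ≤ Nm ∧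
      b - a = Δ / (t * N) ∧ (N : ℝ) ≤ 3 * (1 + Real.log (M / g b)) := by
  set u : ℝ → ℝ := fun r => 1 + Real.log (M / g r) with hu
  have hMpos : 0 < M := (hpos 0).trans_le (hM 0)
  have hu1 : ∀ r, 1 ≤ u r := fun r => by
    have : 0 ≤ Real.log (M / g r) := Real.log_nonneg ((one_le_div (hpos r)).2 (hM r))
    simp only [hu]; linarith
  have hanti : Antitone u := fun r s hrs => by
    have : Real.log (M / g s) ≤ Real.log (M / g r) :=
      Real.log_le_log (div_pos hMpos (hpos s))
        (div_le_div_of_nonneg_left hMpos.le (hpos r) (hg hrs))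
    simp only [hu]; linarith
  have ht0 : 0 < t := by
    rcases Nat.eq_zero_or_pos t with h | h
    · subst h
      have : Nm = 0 := by simpa using ht
      have h1 := hu1 0
      simp only [hu] at h1
      rw [this] at hNm
      norm_num at hNm
      linarith
    · exact h
  have htR : (0 : ℝ) < t := by exact_mod_cast ht0
  obtain ⟨i, hit, hi⟩ : ∃ i < t, u (i * (Δ / t)) / 2 ≤ u ((i + 1 : ℕ) * (Δ / t)) := by
    by_contra! hcon
    have key : ∀ i ≤ t, u (i * (Δ / t)) ≤ Nm / 2 ^ i := by
      intro i
      induction i with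
      | zero => intro _; simpa [hu] using hNm
      | succ i ih =>
        intro hi
        have h1 := hcon i (by omega)
        have h2 := ih (by omega)
        rw [pow_succ, ← div_div]
        linarith
    have h1 := key t le_rfl
    have h2 := hu1 (t * (Δ / t))
    have h3 : (Nm : ℝ) < 2 ^ t := by exact_mod_cast ht
    have h4 : (Nm : ℝ) / 2 ^ t < 1 := (div_lt_one (by positivity)).2 h3
    linarith
  set s : ℝ := i * (Δ / t) with hs
  have hs0 : 0 ≤ s := by positivity
  set N : ℕ := ⌈u s⌉₊ with hN
  have hN1 : 1 ≤ N := Nat.one_le_ceil_iff.2 (by linarith [hu1 s])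
  have hNR : (1 : ℝ) ≤ N := by exact_mod_cast hN1
  have hNle : N ≤ Nm := by
    refine Nat.ceil_le.2 ((hanti hs0).trans ?_)
    simpa [hu] using hNm
  have huN : u s ≤ N := Nat.le_ceil _
  have hNu : (N : ℝ) < u s + 1 := Nat.ceil_lt_add_one (by linarith [hu1 s])
  set δ : ℝ := Δ / (t * N) with hδ
  have hδ0 : 0 < δ := by positivity
  have hNδ : N * δ = Δ / t := by rw [hδ]; field_simp
  obtain ⟨j, hjN, hj⟩ : ∃ j < N, g (s + (j + 1 : ℕ) * δ) ≤ Real.exp 1 * g (s + j * δ) := by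
    by_contra! hcon
    have key : ∀ j ≤ N, Real.exp j * g s ≤ g (s + j * δ) := by
      intro j
      induction j with
      | zero => intro _; simp
      | succ j ih =>
        intro hj
        have h1 := hcon j (by omega)
        have h2 := ih (by omega)
        have h3 : Real.exp ((j + 1 : ℕ) : ℝ) = Real.exp 1 * Real.exp j := by
          rw [← Real.exp_add]; push_cast; ring_nf
        rw [h3, mul_assoc]
        exact (mul_le_mul_of_nonneg_left h2 (Real.exp_pos 1).le).trans h1.le
    have h1 := key N le_rfl
    have h2 : Real.exp (u s) ≤ Real.exp N := Real.exp_le_exp.2 huN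
    have h3 : Real.exp (u s) * g s = Real.exp 1 * M := by
      have := (hpos s).ne'
      simp only [hu]
      rw [Real.exp_add, Real.exp_log (div_pos hMpos (hpos s))]
      field_simp
    have h4 := hM (s + N * δ)
    have h5 : Real.exp (u s) * g s ≤ Real.exp N * g s :=
      mul_le_mul_of_nonneg_right h2 (hpos s).le
    have h6 : (1 : ℝ) < Real.exp 1 := by
      have := Real.add_one_lt_exp (x := 1) one_ne_zero
      linarith
    nlinarith
  have hjR : ((j + 1 : ℕ) : ℝ) ≤ N := by exact_mod_cast hjN
  have hend : s + (j + 1 : ℕ) * δ ≤ (i + 1 : ℕ) * (Δ / t) := by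
    have : ((j + 1 : ℕ) : ℝ) * δ ≤ N * δ := mul_le_mul_of_nonneg_right hjR hδ0.le
    rw [hNδ] at this
    push_cast at this ⊢
    rw [hs]; linarith
  refine ⟨s + j * δ, s + (j + 1 : ℕ) * δ, N, by positivity, ?_, ?_, hj, hN1, hNle, ?_, ?_⟩
  · push_cast; linarith
  · refine hend.trans ?_
    have h1 : ((i + 1 : ℕ) : ℝ) ≤ t := by exact_mod_cast hit
    calc ((i + 1 : ℕ) : ℝ) * (Δ / t) ≤ t * (Δ / t) :=
          mul_le_mul_of_nonneg_right h1 (by positivity)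
      _ = Δ := by field_simp
  · push_cast; ring
  · have h1 := hanti hend
    have h2 := hu1 (s + (j + 1 : ℕ) * δ)
    simp only [hu] at h1 h2 hi hNu ⊢
    linarith

open MeasureTheory in
/-- Averaging over a threshold: some threshold in `[a, b)` cuts pairs of total weight below `1`. -/
theorem exists_threshold {ι : Type*} (s : Finset ι) (p q κ : ι → ℝ) {a b : ℝ} (hab : a < b)
    (hκ : ∀ i ∈ s, 0 ≤ κ i)
    (hsum : ∑ i ∈ s, (if p i ≤ b then κ i * max 0 (q i - p i) else 0) < b - a) :
    ∃ r, a ≤ r ∧ r < b ∧ ∑ i ∈ s, (if p i ≤ r ∧ r < q i then κ i else 0) < 1 := by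
  by_contra! hcon
  have hint : ∀ i ∈ s, Integrable ((Set.Ico (p i) (q i)).indicator fun _ => κ i)
      (volume.restrict (Set.Ico a b)) := fun i _ =>
    (integrable_const (κ i)).indicator measurableSet_Ico
  have h1 : ∫ r in Set.Ico a b, (1 : ℝ) ≤
      ∫ r in Set.Ico a b, ∑ i ∈ s, (Set.Ico (p i) (q i)).indicator (fun _ => κ i) r := by
    refine setIntegral_mono_on (integrable_const _) (integrable_finsetSum s hint)
      measurableSet_Ico fun r hr => ?_
    simpa [Set.indicator_apply, Set.mem_Ico] using hcon r hr.1 hr.2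
  rw [integral_finsetSum s hint] at h1
  have h2 : ∫ r in Set.Ico a b, (1 : ℝ) = b - a := by
    simp [hab.le]
  have h3 : ∑ i ∈ s, ∫ r in Set.Ico a b, (Set.Ico (p i) (q i)).indicator (fun _ => κ i) r ≤
      ∑ i ∈ s, (if p i ≤ b then κ i * max 0 (q i - p i) else 0) := by
    refine Finset.sum_le_sum fun i hi => ?_
    rw [integral_indicator_const _ measurableSet_Ico]
    simp only [Measure.real, Measure.restrict_apply measurableSet_Ico, smul_eq_mul]
    split_ifs with h
    · rw [mul_comm]
      refine mul_le_mul_of_nonneg_left ?_ (hκ i hi)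
      have : volume (Set.Ico (p i) (q i) ∩ Set.Ico a b) ≤ ENNReal.ofReal (q i - p i) := by
        refine (measure_mono Set.inter_subset_left).trans ?_
        simp
      refine (ENNReal.toReal_mono ENNReal.ofReal_ne_top this).trans ?_
      rw [ENNReal.toReal_ofReal', max_comm]
    · have : Set.Ico (p i) (q i) ∩ Set.Ico a b = ∅ := by
        ext r
        simp only [Set.mem_inter_iff, Set.mem_Ico, Set.mem_empty_iff_false, iff_false]
        rintro ⟨⟨h1, -⟩, -, h2⟩
        exact h (h1.trans h2.le)
      simp [this]
  linarith


/-- Walks along a relation, indexed by their total length. -/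
inductive Path {V : Type} (A : V → V → Prop) (d : V → V → ℝ) (x : V) : V → ℝ → Prop
  | nil : Path A d x x 0
  | snoc {u v : V} {l : ℝ} : Path A d x u l → A u v → Path A d x v (l + d u v)

namespace Path

variable {V : Type} {A B : V → V → Prop} {d : V → V → ℝ}

theorem mono {x y : V} {l : ℝ} (h : Path A d x y l) (hAB : ∀ u v, A u v → B u v) :
    Path B d x y l := by
  induction h with
  | nil => exact .nil
  | snoc _ hA ih => exact ih.snoc (hAB _ _ hA)

theorem trans {x y z : V} {l m : ℝ} (h : Path A d x y l) (h' : Path A d y z m) :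
    Path A d x z (l + m) := by
  induction h' with
  | nil => simpa using h
  | snoc _ hA ih => rw [← add_assoc]; exact ih.snoc hA

theorem reverse {x y : V} {l : ℝ} (h : Path A d x y l) (hA : ∀ u v, A u v → A v u)
    (hd : ∀ u v, d u v = d v u) : Path A d y x l := by
  induction h with
  | nil => exact .nil
  | snoc _ huv ih =>
    have := (Path.nil.snoc (hA _ _ huv)).trans ih
    rwa [zero_add, hd, add_comm] at this

theorem length_nonneg {x y : V} {l : ℝ} (h : Path A d x y l) (hd : ∀ u v, 0 < d u v) :
    0 ≤ l := by
  induction h with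
  | nil => exact le_rfl
  | snoc _ _ ih => exact add_nonneg ih (hd _ _).le

end Path

/-- A finite network: symmetric multiplicities `c`, vanishing on non-adjacent pairs and at least
`1` on adjacent ones, and symmetric lengths `d`. -/
structure Net (V : Type) where
  c : V → V → ℝ
  d : V → V → ℝ
  c_symm : ∀ u v, c u v = c v u
  d_symm : ∀ u v, d u v = d v u
  d_pos : ∀ u v, 0 < d u v
  c_cases : ∀ u v, c u v = 0 ∨ 1 ≤ c u v

namespace Net

variable {V : Type} (N : Net V)

theorem c_nonneg (u v : V) : 0 ≤ N.c u v := by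
  rcases N.c_cases u v with h | h <;> linarith

/-- `D` is the distance from `x` inside the connected cluster `S`, characterized by the
Lipschitz condition and the existence of tight predecessors. -/
structure IsDist (S : Finset V) (x : V) (D : V → ℝ) : Prop where
  mem : x ∈ S
  root : D x = 0
  lip : ∀ u ∈ S, ∀ v ∈ S, N.c u v ≠ 0 → D v ≤ D u + N.d u v
  pred : ∀ v ∈ S, v ≠ x → ∃ u ∈ S, N.c u v ≠ 0 ∧ D v = D u + N.d u v

variable {N}

theorem IsDist.induction {S : Finset V} {x : V} {D : V → ℝ} (h : N.IsDist S x D) {P : V → Prop}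
    (hx : P x)
    (hstep : ∀ u ∈ S, ∀ v ∈ S, P u → N.c u v ≠ 0 → D v = D u + N.d u v → P v) :
    ∀ v ∈ S, P v := by
  by_contra! hcon
  obtain ⟨v₀, hv₀, hPv₀⟩ := hcon
  obtain ⟨v, hv, hmin⟩ := (S.filter fun v => ¬ P v).exists_min_image D ⟨v₀, by simp [hv₀, hPv₀]⟩
  rw [Finset.mem_filter] at hv
  have hvx : v ≠ x := fun e => hv.2 (e ▸ hx)
  obtain ⟨u, hu, hc, hD⟩ := h.pred v hv.1 hvx
  have hPu : P u := by
    by_contra hPu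
    have := hmin u (by simp [hu, hPu])
    linarith [N.d_pos u v]
  exact hv.2 (hstep u hu v hv.1 hPu hc hD)

theorem IsDist.nonneg {S : Finset V} {x : V} {D : V → ℝ} (h : N.IsDist S x D) :
    ∀ v ∈ S, 0 ≤ D v :=
  h.induction h.root.ge fun u _ v _ hu _ hD => by linarith [N.d_pos u v]

theorem IsDist.pos {S : Finset V} {x : V} {D : V → ℝ} (h : N.IsDist S x D) {v : V} (hv : v ∈ S)
    (hvx : v ≠ x) : 0 < D v := by
  obtain ⟨u, hu, -, hD⟩ := h.pred v hv hvx
  linarith [N.d_pos u v, h.nonneg u hu]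

/-- A subset closed under tight predecessors inherits the distance function. -/
theorem IsDist.subset {S L : Finset V} {x : V} {D : V → ℝ} (h : N.IsDist S x D) (hL : L ⊆ S)
    (hx : x ∈ L)
    (hclosed : ∀ u ∈ S, ∀ v ∈ L, N.c u v ≠ 0 → D v = D u + N.d u v → u ∈ L) :
    N.IsDist L x D where
  mem := hx
  root := h.root
  lip u hu v hv := h.lip u (hL hu) v (hL hv)
  pred v hv hvx := by
    obtain ⟨u, hu, hc, hD⟩ := h.pred v (hL hv) hvx
    exact ⟨u, hclosed u hu v hv hc hD, hc, hD⟩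

/-- The component of `x` in a vertex set carries a distance function. -/
theorem exists_isDist (N : Net V) {Y : Finset V} {x : V} (hx : x ∈ Y) :
    ∃ Z ⊆ Y, ∃ D, N.IsDist Z x D ∧ ∀ u ∈ Z, ∀ v ∈ Y, N.c u v ≠ 0 → v ∈ Z := by
  set A : V → V → Prop := fun u v => N.c u v ≠ 0 ∧ u ∈ Y ∧ v ∈ Y with hA
  set Z := Y.filter fun v => ∃ l, Path A N.d x v l with hZ
  set D : V → ℝ := fun v => sInf {l | Path A N.d x v l} with hD
  have hbdd : ∀ v, BddBelow {l | Path A N.d x v l} := fun v =>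
    ⟨0, fun l hl => hl.length_nonneg N.d_pos⟩
  have hcl : ∀ u ∈ Z, ∀ v ∈ Y, N.c u v ≠ 0 → v ∈ Z := by
    intro u hu v hv hc
    rw [hZ, Finset.mem_filter] at hu ⊢
    obtain ⟨hu, l, hl⟩ := hu
    exact ⟨hv, _, hl.snoc ⟨hc, hu, hv⟩⟩
  have hlip : ∀ u ∈ Z, ∀ v ∈ Z, N.c u v ≠ 0 → D v ≤ D u + N.d u v := by
    intro u hu v hv hc
    rw [hZ, Finset.mem_filter] at hu hv
    have : D v - N.d u v ≤ D u := by
      refine le_csInf hu.2 fun l hl => ?_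
      have : D v ≤ l + N.d u v := csInf_le (hbdd v) (hl.snoc ⟨hc, hu.1, hv.1⟩)
      linarith
    linarith
  refine ⟨Z, Finset.filter_subset _ _, D, ⟨?_, ?_, hlip, ?_⟩, hcl⟩
  · rw [hZ, Finset.mem_filter]
    exact ⟨hx, 0, .nil⟩
  · exact le_antisymm (csInf_le (hbdd x) .nil)
      (le_csInf ⟨0, .nil⟩ fun l hl => hl.length_nonneg N.d_pos)
  · intro v hv hvx
    have hlast : ∀ l, Path A N.d x v l →
        ∃ u ∈ Z, N.c u v ≠ 0 ∧ D u + N.d u v ≤ l := by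
      intro l hl
      cases hl with
      | nil => exact absurd rfl hvx
      | @snoc u _ l hl huv =>
        refine ⟨u, ?_, huv.1, ?_⟩
        · rw [hZ, Finset.mem_filter]
          exact ⟨huv.2.1, _, hl⟩
        · have : D u ≤ l := csInf_le (hbdd u) hl
          linarith
    have hv' := hv
    rw [hZ, Finset.mem_filter] at hv'
    obtain ⟨-, l₀, hl₀⟩ := hv'
    obtain ⟨u₀, hu₀, hc₀, -⟩ := hlast l₀ hl₀
    obtain ⟨u, hu, hmin⟩ := (Z.filter fun u => N.c u v ≠ 0).exists_min_image
      (fun u => D u + N.d u v) ⟨u₀, by simp [hu₀, hc₀]⟩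
    rw [Finset.mem_filter] at hu
    refine ⟨u, hu.1, hu.2, le_antisymm (hlip u hu.1 v hv hu.2) ?_⟩
    refine le_csInf ⟨l₀, hl₀⟩ fun l hl => ?_
    obtain ⟨w, hw, hcw, hle⟩ := hlast l hl
    exact (hmin w (by simp [hw, hcw])).trans hle

/-- The multiplicity of a pair, counted only when its length is comparable with the scale `ρ`. -/
noncomputable def act (N : Net V) (θ ρ : ℝ) (u v : V) : ℝ :=
  if θ * ρ ≤ N.d u v ∧ N.d u v ≤ 2 * ρ then N.c u v else 0

theorem act_nonneg (θ ρ : ℝ) (u v : V) : 0 ≤ N.act θ ρ u v := by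
  unfold act
  split_ifs
  exacts [N.c_nonneg u v, le_rfl]

theorem act_le (θ ρ : ℝ) (u v : V) : N.act θ ρ u v ≤ N.c u v := by
  unfold act
  split_ifs
  exacts [le_rfl, N.c_nonneg u v]

theorem act_symm (θ ρ : ℝ) (u v : V) : N.act θ ρ u v = N.act θ ρ v u := by
  unfold act
  rw [N.d_symm u v, N.c_symm u v]

theorem act_cases (θ ρ : ℝ) (u v : V) : N.act θ ρ u v = 0 ∨ 1 ≤ N.act θ ρ u v := by
  unfold act
  split_ifs
  exacts [N.c_cases u v, .inl rfl]

/-- The degree of `v` in `C`, counting pairs whose length is comparable with `ρ`. -/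
noncomputable def deg (N : Net V) (θ ρ : ℝ) (C : Finset V) (v : V) : ℝ :=
  ∑ u ∈ C, N.act θ ρ v u

theorem deg_nonneg (θ ρ : ℝ) (C : Finset V) (v : V) : 0 ≤ N.deg θ ρ C v :=
  Finset.sum_nonneg fun _ _ => act_nonneg _ _ _ _

/-- A sublevel set of a Lipschitz function that separates no short pair, with a bound on the
separated pairs of comparable length. -/
theorem exists_cut (N : Net V) {S : Finset V} {h : V → ℝ} {θ ρ a b F : ℝ}
    (hlip : ∀ u ∈ S, ∀ v ∈ S, N.c u v ≠ 0 → h v ≤ h u + 2 * N.d u v) (hab : a < b) (hF : 0 < F)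
    (hθρ : 0 ≤ θ * ρ)
    (hmass : ∑ u ∈ S with h u ≤ b, N.deg θ ρ S u ≤ F)
    (hshort : (S.card : ℝ) ^ 2 * (2 * (θ * ρ)) ≤ (b - a) / 2) :
    ∃ r, a ≤ r ∧ r < b ∧
      (∀ u ∈ S, ∀ v ∈ S, N.c u v ≠ 0 → h u ≤ r → r < h v → θ * ρ ≤ N.d u v) ∧
      ∑ u ∈ S with h u ≤ r, ∑ v ∈ S with ¬ h v ≤ r, N.act θ ρ u v / N.d u v ≤
        8 * F / (b - a) := by
  set ℓ := b - a with hℓ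
  have hℓ0 : 0 < ℓ := sub_pos.2 hab
  set κ : V × V → ℝ := fun q =>
    (if N.c q.1 q.2 ≠ 0 ∧ N.d q.1 q.2 < θ * ρ then 1 else 0) +
      N.act θ ρ q.1 q.2 / N.d q.1 q.2 * (ℓ / (8 * F)) with hκ
  have hκ1 : ∀ q : V × V, 0 ≤ N.act θ ρ q.1 q.2 / N.d q.1 q.2 * (ℓ / (8 * F)) := fun q =>
    mul_nonneg (div_nonneg (act_nonneg _ _ _ _) (N.d_pos _ _).le) (by positivity)
  have hκ0 : ∀ q ∈ S ×ˢ S, 0 ≤ κ q := fun q _ =>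
    add_nonneg (by split_ifs <;> norm_num) (hκ1 q)
  have hterm : ∀ q ∈ S ×ˢ S,
      (if h q.1 ≤ b then κ q * max 0 (h q.2 - h q.1) else 0) ≤
        2 * (θ * ρ) + (if h q.1 ≤ b then N.act θ ρ q.1 q.2 else 0) * (ℓ / (4 * F)) := by
    rintro ⟨u, v⟩ hq
    rw [Finset.mem_product] at hq
    simp only at hq ⊢
    split_ifs with hb
    · by_cases hc : N.c u v = 0
      · have : N.act θ ρ u v = 0 :=
          le_antisymm ((act_le θ ρ u v).trans hc.le) (act_nonneg _ _ _ _)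
        simp [hκ, hc, this, hθρ]
      · have hd := N.d_pos u v
        have hmax : max 0 (h v - h u) ≤ 2 * N.d u v :=
          max_le (by linarith) (by linarith [hlip u hq.1 v hq.2 hc])
        refine (mul_le_mul_of_nonneg_left hmax (hκ0 (u, v) (by simp [hq]))).trans ?_
        have e1 : N.act θ ρ u v / N.d u v * (ℓ / (8 * F)) * (2 * N.d u v) =
            N.act θ ρ u v * (ℓ / (4 * F)) := by
          field_simp; ring
        simp only [hκ, add_mul, e1]
        refine add_le_add ?_ le_rfl
        split_ifs with hs
        · linarith [hs.2]
        · linarith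
    · linarith
  obtain ⟨r, hr1, hr2, hr⟩ := exists_threshold (S ×ˢ S) (fun q => h q.1) (fun q => h q.2) κ hab
    hκ0 (by
      refine (Finset.sum_le_sum hterm).trans_lt ?_
      have e1 : ∑ u ∈ S, ∑ v ∈ S, (if h u ≤ b then N.act θ ρ u v else 0) ≤ F := by
        rw [Finset.sum_filter] at hmass
        refine le_trans (le_of_eq (Finset.sum_congr rfl fun u _ => ?_)) hmass
        split_ifs with hb
        · rfl
        · simp
      have e2 : (∑ u ∈ S, ∑ v ∈ S, (if h u ≤ b then N.act θ ρ u v else 0)) * (ℓ / (4 * F)) ≤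
          ℓ / 4 := by
        refine (mul_le_mul_of_nonneg_right e1 (by positivity)).trans (le_of_eq ?_)
        field_simp
      have e3 : (S.card * S.card) • (2 * (θ * ρ)) = (S.card : ℝ) ^ 2 * (2 * (θ * ρ)) := by
        rw [nsmul_eq_mul]; push_cast; ring
      rw [Finset.sum_add_distrib, Finset.sum_const, Finset.card_product, e3, ← Finset.sum_mul,
        Finset.sum_product]
      simp only
      linarith)
  have hpos : ∀ q ∈ S ×ˢ S, 0 ≤ (if h q.1 ≤ r ∧ r < h q.2 then κ q else 0) := fun q hq => by
    split_ifs
    exacts [hκ0 q hq, le_rfl]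
  refine ⟨r, hr1, hr2, ?_, ?_⟩
  · intro u hu v hv hc h1 h2
    by_contra! hlt
    have := Finset.single_le_sum hpos (Finset.mk_mem_product hu hv)
    have h3 : 1 ≤ κ (u, v) := by
      have := hκ1 (u, v)
      simp only [hκ]
      rw [if_pos ⟨hc, hlt⟩]
      simp only at this
      linarith
    simp only at this
    rw [if_pos ⟨h1, h2⟩] at this
    linarith
  · have h1 : (∑ u ∈ S with h u ≤ r, ∑ v ∈ S with ¬ h v ≤ r, N.act θ ρ u v / N.d u v) *
        (ℓ / (8 * F)) ≤ ∑ q ∈ S ×ˢ S, (if h q.1 ≤ r ∧ r < h q.2 then κ q else 0) := by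
      rw [Finset.sum_product, Finset.sum_filter, Finset.sum_mul]
      refine Finset.sum_le_sum fun u hu => ?_
      split_ifs with hur
      · rw [Finset.sum_filter, Finset.sum_mul]
        refine Finset.sum_le_sum fun v hv => ?_
        by_cases hvr : h v ≤ r
        · simp [hvr, not_lt.2 hvr]
        · rw [if_pos hvr, if_pos ⟨hur, not_le.1 hvr⟩]
          simp only [hκ]
          split_ifs <;> linarith
      · simp [hur]
    have h2 := h1.trans hr.le
    rw [← le_div_iff₀ (by positivity)] at h2
    refine h2.trans (le_of_eq ?_)
    field_simp

end Net


/-- The entropy-type charge `x (1 + log (M / x))`, expanded. -/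
noncomputable def ent (M x : ℝ) : ℝ := x + x * Real.log M - x * Real.log x

theorem ent_nonneg {M x : ℝ} (hx : 0 ≤ x) (hxM : x ≤ M) : 0 ≤ ent M x := by
  unfold ent
  rcases hx.eq_or_lt with rfl | hx
  · simp
  · have := mul_le_mul_of_nonneg_left (Real.log_le_log hx hxM) hx.le
    linarith

/-- The total of `q` over ordered pairs in `Y` separated by `root`. -/
noncomputable def cutSum {V : Type} (q : V → V → ℝ) (Y : Finset V) (root : V → V) : ℝ :=
  ∑ u ∈ Y, ∑ v ∈ Y, if root u = root v then 0 else q u v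

section merge

variable {V : Type} {Y L : Finset V} {x : V} {root' : V → V}

theorem filter_merge_self (hL : L ⊆ Y) (hx : x ∈ L) (hroot : ∀ v ∈ Y \ L, root' v ∈ Y \ L) :
    (Y.filter fun v => (if v ∈ L then x else root' v) = x) = L := by
  ext v
  rw [Finset.mem_filter]
  constructor
  · rintro ⟨hv, h⟩
    by_contra hvL
    rw [if_neg hvL] at h
    have := hroot v (Finset.mem_sdiff.2 ⟨hv, hvL⟩)
    rw [h] at this
    exact (Finset.mem_sdiff.1 this).2 hx
  · exact fun hv => ⟨hL hv, if_pos hv⟩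

theorem filter_merge_of_mem (hx : x ∈ L) {z : V} (hz : z ∈ Y \ L) :
    (Y.filter fun v => (if v ∈ L then x else root' v) = z) =
      (Y \ L).filter fun v => root' v = z := by
  ext v
  simp only [Finset.mem_filter, Finset.mem_sdiff]
  have hxz : x ≠ z := fun e => (Finset.mem_sdiff.1 hz).2 (e ▸ hx)
  by_cases hv : v ∈ L <;> simp [hv, hxz]

theorem sum_image_merge (hL : L ⊆ Y) (hx : x ∈ L) (hroot : ∀ v ∈ Y \ L, root' v ∈ Y \ L)
    (G : Finset V → ℝ) :
    ∑ z ∈ Y.image (fun v => if v ∈ L then x else root' v),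
        G (Y.filter fun v => (if v ∈ L then x else root' v) = z) =
      G L + ∑ z ∈ (Y \ L).image root', G ((Y \ L).filter fun v => root' v = z) := by
  have himage : Y.image (fun v => if v ∈ L then x else root' v) =
      insert x ((Y \ L).image root') := by
    ext z
    simp only [Finset.mem_image, Finset.mem_insert]
    constructor
    · rintro ⟨v, hv, rfl⟩
      by_cases hvL : v ∈ L
      · simp [hvL]
      · right
        exact ⟨v, Finset.mem_sdiff.2 ⟨hv, hvL⟩, by simp [hvL]⟩
    · rintro (rfl | ⟨v, hv, rfl⟩)
      · exact ⟨z, hL hx, by simp [hx]⟩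
      · rw [Finset.mem_sdiff] at hv
        exact ⟨v, hv.1, by simp [hv.2]⟩
  have hnot : x ∉ (Y \ L).image root' := by
    rw [Finset.mem_image]
    rintro ⟨v, hv, hvx⟩
    have := hroot v hv
    rw [hvx] at this
    exact (Finset.mem_sdiff.1 this).2 hx
  rw [himage, Finset.sum_insert hnot, filter_merge_self hL hx hroot]
  congr 1
  refine Finset.sum_congr rfl fun z hz => ?_
  obtain ⟨v, hv, rfl⟩ := Finset.mem_image.1 hz
  rw [filter_merge_of_mem hx (hroot v hv)]

theorem cutSum_merge (hL : L ⊆ Y) (hx : x ∈ L) (hroot : ∀ v ∈ Y \ L, root' v ∈ Y \ L)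
    {q : V → V → ℝ} (hq : ∀ u v, q u v = q v u) :
    cutSum q Y (fun v => if v ∈ L then x else root' v) =
      cutSum q (Y \ L) root' + 2 * ∑ u ∈ L, ∑ v ∈ Y \ L, q u v := by
  have hne : ∀ v ∈ Y \ L, root' v ≠ x := fun v hv e => by
    have := hroot v hv
    rw [e] at this
    exact (Finset.mem_sdiff.1 this).2 hx
  have e1 : ∑ u ∈ Y \ L, ∑ v ∈ L, q u v = ∑ u ∈ L, ∑ v ∈ Y \ L, q u v := by
    rw [Finset.sum_comm]
    exact Finset.sum_congr rfl fun u _ => Finset.sum_congr rfl fun v _ => hq v u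
  unfold cutSum
  rw [← Finset.sum_sdiff hL]
  simp_rw [← Finset.sum_sdiff (f := fun v => ite _ _ _) hL]
  rw [Finset.sum_add_distrib, Finset.sum_add_distrib]
  have h1 : ∑ u ∈ Y \ L, ∑ v ∈ Y \ L, (if (if u ∈ L then x else root' u) =
      (if v ∈ L then x else root' v) then 0 else q u v) =
      ∑ u ∈ Y \ L, ∑ v ∈ Y \ L, if root' u = root' v then 0 else q u v :=
    Finset.sum_congr rfl fun u hu => Finset.sum_congr rfl fun v hv => by
      rw [if_neg (Finset.mem_sdiff.1 hu).2, if_neg (Finset.mem_sdiff.1 hv).2]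
  have h2 : ∑ u ∈ Y \ L, ∑ v ∈ L, (if (if u ∈ L then x else root' u) =
      (if v ∈ L then x else root' v) then 0 else q u v) = ∑ u ∈ Y \ L, ∑ v ∈ L, q u v :=
    Finset.sum_congr rfl fun u hu => Finset.sum_congr rfl fun v hv => by
      rw [if_neg (Finset.mem_sdiff.1 hu).2, if_pos hv, if_neg (hne u hu)]
  have h3 : ∑ u ∈ L, ∑ v ∈ Y \ L, (if (if u ∈ L then x else root' u) =
      (if v ∈ L then x else root' v) then 0 else q u v) = ∑ u ∈ L, ∑ v ∈ Y \ L, q u v :=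
    Finset.sum_congr rfl fun u hu => Finset.sum_congr rfl fun v hv => by
      rw [if_neg (Finset.mem_sdiff.1 hv).2, if_pos hu, if_neg (hne v hv).symm]
  have h4 : ∑ u ∈ L, ∑ v ∈ L, (if (if u ∈ L then x else root' u) =
      (if v ∈ L then x else root' v) then 0 else q u v) = 0 :=
    Finset.sum_eq_zero fun u hu => Finset.sum_eq_zero fun v hv => by simp [hu, hv]
  rw [h1, h2, h3, h4, e1]
  ring

end merge

namespace Net

variable {V : Type} {N : Net V}

/-- Region growing: a sublevel set at a level in `[0, Δ]` whose boundary is charged to the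
entropy of its volume. -/
theorem exists_cone_cut (N : Net V) {C Z : Finset V} (hZ : Z ⊆ C) {h : V → ℝ} {θ ρ Δ : ℝ}
    {t Nm : ℕ} (hlip : ∀ u ∈ Z, ∀ v ∈ Z, N.c u v ≠ 0 → h v ≤ h u + 2 * N.d u v) (hΔ : 0 < Δ)
    (hθρ : 0 ≤ θ * ρ) (hNm : 1 + Real.log (max 1 (∑ v ∈ C, N.deg θ ρ C v)) ≤ Nm)
    (ht : Nm < 2 ^ t)
    (hshort : (C.card : ℝ) ^ 2 * (2 * (θ * ρ)) ≤ Δ / (t * Nm) / 2) :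
    ∃ r, 0 ≤ r ∧ r ≤ Δ ∧
      (∀ u ∈ Z, ∀ v ∈ Z, N.c u v ≠ 0 → h u ≤ r → r < h v → θ * ρ ≤ N.d u v) ∧
      ∑ u ∈ Z with h u ≤ r, ∑ v ∈ Z with ¬ h v ≤ r, N.act θ ρ u v / N.d u v ≤
        72 * t / Δ * ent (∑ v ∈ C, N.deg θ ρ C v) (∑ u ∈ Z with h u ≤ r, N.deg θ ρ C u) := by
  set μ := ∑ v ∈ C, N.deg θ ρ C v with hμ
  set m : ℝ → ℝ := fun r => ∑ u ∈ Z with h u ≤ r, N.deg θ ρ C u with hm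
  have hm0 : ∀ r, 0 ≤ m r := fun r => Finset.sum_nonneg fun _ _ => deg_nonneg _ _ _ _
  have hmμ : ∀ r, m r ≤ μ := fun r =>
    Finset.sum_le_sum_of_subset_of_nonneg ((Finset.filter_subset _ _).trans hZ)
      fun _ _ _ => deg_nonneg _ _ _ _
  have hmono : Monotone m := fun r s hrs =>
    Finset.sum_le_sum_of_subset_of_nonneg
      (Finset.monotone_filter_right _ fun _ _ hv => hv.trans hrs)
      fun _ _ _ => deg_nonneg _ _ _ _
  set g : ℝ → ℝ := fun r => max 1 (m r) with hg
  have hgmono : Monotone g := fun r s hrs => max_le_max le_rfl (hmono hrs)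
  have hg1 : ∀ r, 1 ≤ g r := fun r => le_max_left _ _
  have hgM : ∀ r, g r ≤ max 1 μ := fun r => max_le_max le_rfl (hmμ r)
  have hM1 : 1 ≤ max 1 μ := le_max_left _ _
  obtain ⟨a, b, n, ha, hab, hb, hgab, hn1, hnNm, hlen, hn⟩ :=
    exists_scale g hgmono (M := max 1 μ) (fun r => one_pos.trans_le (hg1 r)) hgM hΔ
      (t := t) (Nm := Nm) (by
        refine le_trans ?_ hNm
        have : Real.log (max 1 μ / g 0) ≤ Real.log (max 1 μ) :=
          Real.log_le_log (div_pos (by linarith) (one_pos.trans_le (hg1 0)))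
            (div_le_self (by linarith) (hg1 0))
        linarith) ht
  have hba : 0 < b - a := sub_pos.2 hab
  have hnR : (1 : ℝ) ≤ n := by exact_mod_cast hn1
  have ht0 : (0 : ℝ) < t := by
    have : 0 ≤ (t : ℝ) := Nat.cast_nonneg t
    rcases this.eq_or_lt with h0 | h0
    · rw [← h0] at hlen
      simp at hlen
      linarith
    · exact h0
  obtain ⟨r, har, hrb, hs, hcut⟩ := N.exists_cut (S := Z) (h := h) (θ := θ) (ρ := ρ)
    (a := a) (b := b) (F := g b) hlip hab (one_pos.trans_le (hg1 b)) hθρ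
    (by
      refine le_trans (Finset.sum_le_sum fun u _ => ?_) (le_max_right _ _)
      exact Finset.sum_le_sum_of_subset_of_nonneg hZ fun _ _ _ => act_nonneg _ _ _ _)
    (by
      have h1 : (Z.card : ℝ) ≤ C.card := by exact_mod_cast Finset.card_le_card hZ
      have h2 : (Z.card : ℝ) ^ 2 * (2 * (θ * ρ)) ≤ (C.card : ℝ) ^ 2 * (2 * (θ * ρ)) := by
        gcongr
      refine h2.trans (hshort.trans ?_)
      rw [hlen]
      gcongr)
  refine ⟨r, ha.trans har, hrb.le.trans hb, hs, ?_⟩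
  change _ ≤ 72 * t / Δ * ent μ (m r)
  have hent : 0 ≤ ent μ (m r) := ent_nonneg (hm0 r) (hmμ r)
  by_cases hmr : m r < 1
  · refine le_trans (le_of_eq ?_) (by positivity)
    refine Finset.sum_eq_zero fun u hu => Finset.sum_eq_zero fun v hv => ?_
    have h1 : N.act θ ρ u v ≤ N.deg θ ρ C u :=
      Finset.single_le_sum (f := fun v => N.act θ ρ u v) (fun _ _ => act_nonneg _ _ _ _)
        (hZ (Finset.mem_filter.1 hv).1)
    have h2 : N.deg θ ρ C u ≤ m r :=
      Finset.single_le_sum (f := fun u => N.deg θ ρ C u) (fun _ _ => deg_nonneg _ _ _ _) hu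
    rcases act_cases (N := N) θ ρ u v with h3 | h3
    · rw [h3, zero_div]
    · linarith
  · rw [not_lt] at hmr
    have hgr : g r = m r := max_eq_right hmr
    have hμ1 : max 1 μ = μ := max_eq_right (hmr.trans (hmμ r))
    refine hcut.trans ?_
    have h1 : g b ≤ 3 * m r := by
      have h3 : g a ≤ m r := hgr ▸ hgmono har
      have h4 : Real.exp 1 ≤ 3 := by linarith [Real.exp_one_lt_d9]
      calc g b ≤ Real.exp 1 * g a := hgab
        _ ≤ 3 * m r := by
          have := hg1 a
          gcongr
    have h2 : (n : ℝ) ≤ 3 * (1 + Real.log μ - Real.log (m r)) := by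
      rw [hμ1] at hn
      have h3 : Real.log (μ / g b) ≤ Real.log μ - Real.log (m r) := by
        rw [Real.log_div (by linarith) (by linarith [hg1 b])]
        have : Real.log (m r) ≤ Real.log (g b) :=
          Real.log_le_log (by linarith) (hgr ▸ hgmono hrb.le)
        linarith
      linarith
    rw [hlen]
    calc 8 * g b / (Δ / (t * n)) = 8 * t / Δ * (g b * n) := by
          field_simp
      _ ≤ 8 * t / Δ * ((3 * m r) * (3 * (1 + Real.log μ - Real.log (m r)))) := by
          have := hg1 b
          have := hm0 r
          gcongr
      _ = 72 * t / Δ * ent μ (m r) := by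
          unfold ent; ring

/-- The combinatorial properties of a partition of `Y` into cones: `root v` is the anchor of the
part of `v`, and `E x` is the distance from the anchor `x` inside its part. -/
structure IsConePartition (N : Net V) (θ ρ Δ : ℝ) (P Y : Finset V) (D : V → ℝ) (root : V → V)
    (E : V → V → ℝ) : Prop where
  root_mem : ∀ v ∈ Y, root v ∈ Y
  bridge : ∀ v ∈ Y, ∃ y ∈ P, N.c y (root v) ≠ 0 ∧ D (root v) = D y + N.d y (root v)
  isDist : ∀ v ∈ Y, N.IsDist (Y.filter fun w => root w = root v) (root v) (E (root v))
  radius : ∀ v ∈ Y, E (root v) v ≤ D v - D (root v) + Δ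
  short : ∀ u ∈ Y, ∀ v ∈ Y, root u ≠ root v → N.c u v ≠ 0 → θ * ρ ≤ N.d u v

theorem exists_conePartition {C P : Finset V} {x₀ : V} {D : V → ℝ} (hD : N.IsDist C x₀ D)
    {θ ρ Δ : ℝ} {t Nm : ℕ} (hΔ : 0 < Δ) (hθρ : 0 ≤ θ * ρ)
    (hNm : 1 + Real.log (max 1 (∑ v ∈ C, N.deg θ ρ C v)) ≤ Nm) (ht : Nm < 2 ^ t)
    (hshort : (C.card : ℝ) ^ 2 * (2 * (θ * ρ)) ≤ Δ / (t * Nm) / 2) :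
    ∀ Y ⊆ C, (∀ v ∈ Y, ∃ u, (u ∈ Y ∨ u ∈ P) ∧ N.c u v ≠ 0 ∧ D v = D u + N.d u v) →
      ∃ root E, N.IsConePartition θ ρ Δ P Y D root E ∧
        cutSum (fun u v => N.act θ ρ u v / N.d u v) Y root ≤
          144 * t / Δ * ∑ z ∈ Y.image root,
            ent (∑ v ∈ C, N.deg θ ρ C v) (∑ v ∈ Y with root v = z, N.deg θ ρ C v) := by
  intro Y
  induction Y using Finset.strongInduction with
  | H Y ih =>
  intro hYC hpred
  rcases Y.eq_empty_or_nonempty with rfl | hne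
  · exact ⟨id, fun _ _ => 0, ⟨by simp, by simp, by simp, by simp, by simp⟩, by simp [cutSum]⟩
  obtain ⟨x, hxY, hxmin⟩ := Y.exists_min_image D hne
  obtain ⟨y, hy, hcy, hDy⟩ := hpred x hxY
  have hyP : y ∈ P := hy.resolve_left fun h => by
    linarith [hxmin y h, N.d_pos y x]
  obtain ⟨Z, hZY, E₀, hE₀, hZcl⟩ := N.exists_isDist hxY
  have hZC := hZY.trans hYC
  set h : V → ℝ := fun v => E₀ v - D v + D x with hh
  have hlip : ∀ u ∈ Z, ∀ v ∈ Z, N.c u v ≠ 0 → h v ≤ h u + 2 * N.d u v := by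
    intro u hu v hv hc
    have h1 := hE₀.lip u hu v hv hc
    have h2 := hD.lip v (hZC hv) u (hZC hu) (by rwa [N.c_symm])
    rw [N.d_symm v u] at h2
    simp only [hh]
    linarith
  obtain ⟨r, hr0, hrΔ, hrs, hcut⟩ := N.exists_cone_cut hZC hlip hΔ hθρ hNm ht hshort
  set L := Z.filter fun v => h v ≤ r with hL
  have hxL : x ∈ L := by
    rw [hL, Finset.mem_filter]
    exact ⟨hE₀.mem, by simp only [hh]; rw [hE₀.root]; linarith⟩
  have hLZ : L ⊆ Z := Finset.filter_subset _ _
  have hLY : L ⊆ Y := hLZ.trans hZY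
  have hEL : N.IsDist L x E₀ := hE₀.subset hLZ hxL fun u hu v hv hc he => by
    rw [hL, Finset.mem_filter] at hv ⊢
    refine ⟨hu, le_trans ?_ hv.2⟩
    have := hD.lip u (hZC hu) v (hZC hv.1) hc
    simp only [hh]
    linarith
  have hforward : ∀ u ∈ L, ∀ v ∈ Y, N.c u v ≠ 0 → D v = D u + N.d u v → v ∈ L := by
    intro u hu v hv hc he
    rw [hL, Finset.mem_filter] at hu ⊢
    have hvZ := hZcl u hu.1 v hv hc
    refine ⟨hvZ, le_trans ?_ hu.2⟩
    have := hE₀.lip u hu.1 v hvZ hc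
    simp only [hh]
    linarith
  obtain ⟨root', E', hpart, hcut'⟩ := ih (Y \ L)
    (Finset.sdiff_ssubset hLY ⟨x, hxL⟩) (Finset.sdiff_subset.trans hYC) (by
      intro v hv
      rw [Finset.mem_sdiff] at hv
      obtain ⟨u, hu, hc, he⟩ := hpred v hv.1
      refine ⟨u, hu.imp_left fun huY => ?_, hc, he⟩
      exact Finset.mem_sdiff.2 ⟨huY, fun huL => hv.2 (hforward u huL v hv.1 hc he)⟩)
  have hroot := hpart.root_mem
  have hsep : ∀ u ∈ L, ∀ v ∈ Y \ L, N.c u v ≠ 0 → θ * ρ ≤ N.d u v := by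
    intro u hu v hv hc
    rw [Finset.mem_sdiff] at hv
    have hvZ := hZcl u (hLZ hu) v hv.1 hc
    refine hrs u (hLZ hu) v hvZ hc (Finset.mem_filter.1 hu).2 ?_
    by_contra hcon
    exact hv.2 (Finset.mem_filter.2 ⟨hvZ, not_lt.1 hcon⟩)
  refine ⟨fun v => if v ∈ L then x else root' v, fun z => if z = x then E₀ else E' z,
    ⟨?_, ?_, ?_, ?_, ?_⟩, ?_⟩
  · intro v hv
    by_cases hvL : v ∈ L
    · simp [hvL, hxY]
    · simp only [hvL, if_false]
      exact Finset.sdiff_subset (hroot v (Finset.mem_sdiff.2 ⟨hv, hvL⟩))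
  · intro v hv
    by_cases hvL : v ∈ L
    · simp only [hvL, if_true]
      exact ⟨y, hyP, hcy, hDy⟩
    · simp only [hvL, if_false]
      exact hpart.bridge v (Finset.mem_sdiff.2 ⟨hv, hvL⟩)
  · intro v hv
    by_cases hvL : v ∈ L
    · simp only [hvL, if_true]
      rw [filter_merge_self hLY hxL hroot]
      exact hEL
    · have hv' := Finset.mem_sdiff.2 ⟨hv, hvL⟩
      have hne : root' v ≠ x := fun e =>
        (Finset.mem_sdiff.1 (hroot v hv')).2 (e ▸ hxL)
      simp only [hvL, if_false, hne]
      rw [filter_merge_of_mem hxL (hroot v hv')]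
      exact hpart.isDist v hv'
  · intro v hv
    by_cases hvL : v ∈ L
    · simp only [hvL, if_true]
      have := (Finset.mem_filter.1 hvL).2
      simp only [hh] at this
      linarith
    · have hv' := Finset.mem_sdiff.2 ⟨hv, hvL⟩
      have hne : root' v ≠ x := fun e =>
        (Finset.mem_sdiff.1 (hroot v hv')).2 (e ▸ hxL)
      simp only [hvL, if_false, hne]
      exact hpart.radius v hv'
  · intro u hu v hv huv hc
    by_cases huL : u ∈ L <;> by_cases hvL : v ∈ L
    · simp [huL, hvL] at huv
    · exact hsep u huL v (Finset.mem_sdiff.2 ⟨hv, hvL⟩) hc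
    · rw [N.d_symm]
      exact hsep v hvL u (Finset.mem_sdiff.2 ⟨hu, huL⟩) (by rwa [N.c_symm])
    · simp only [huL, hvL, if_false] at huv
      exact hpart.short u (Finset.mem_sdiff.2 ⟨hu, huL⟩) v (Finset.mem_sdiff.2 ⟨hv, hvL⟩) huv hc
  · rw [cutSum_merge hLY hxL hroot (fun u v => by rw [act_symm, N.d_symm]),
      sum_image_merge hLY hxL hroot fun S => ent (∑ v ∈ C, N.deg θ ρ C v) (∑ v ∈ S, N.deg θ ρ C v)]
    have h1 : ∑ u ∈ L, ∑ v ∈ Y \ L, N.act θ ρ u v / N.d u v =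
        ∑ u ∈ L, ∑ v ∈ Z with ¬ h v ≤ r, N.act θ ρ u v / N.d u v := by
      refine Finset.sum_congr rfl fun u hu => (Finset.sum_subset ?_ ?_).symm
      · intro v hv
        rw [Finset.mem_filter] at hv
        rw [Finset.mem_sdiff, hL, Finset.mem_filter]
        exact ⟨hZY hv.1, fun h => hv.2 h.2⟩
      · intro v hv hv'
        have hc : N.c u v = 0 := by
          by_contra hc
          rw [Finset.mem_sdiff] at hv
          have hvZ := hZcl u (hLZ hu) v hv.1 hc
          exact hv' (Finset.mem_filter.2 ⟨hvZ, fun h => hv.2 (Finset.mem_filter.2 ⟨hvZ, h⟩)⟩)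
        have : N.act θ ρ u v = 0 := le_antisymm ((act_le θ ρ u v).trans hc.le) (act_nonneg _ _ _ _)
        rw [this, zero_div]
    rw [h1, mul_add]
    have h2 : 144 * t / Δ * ent (∑ v ∈ C, N.deg θ ρ C v) (∑ v ∈ L, N.deg θ ρ C v) =
      2 * (72 * t / Δ * ent (∑ v ∈ C, N.deg θ ρ C v) (∑ v ∈ L, N.deg θ ρ C v)) := by ring
    rw [h2]
    linarith

end Net

namespace Net

variable {V : Type} {N : Net V}

/-- A star partition of the cluster `C` with center `x₀`: a central ball of radius `r₀` and cones
of width `ε ρ` attached to it by tight bridges. -/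
structure IsStarPartition (N : Net V) (θ ρ ε r₀ : ℝ) (C : Finset V) (x₀ : V) (D : V → ℝ)
    (root : V → V) (E : V → V → ℝ) : Prop where
  root_mem : ∀ v ∈ C, root v ∈ C
  root_center : root x₀ = x₀
  isDist : ∀ v ∈ C, N.IsDist (C.filter fun w => root w = root v) (root v) (E (root v))
  center : E x₀ = D
  ball : ∀ v ∈ C, root v = x₀ → D v ≤ r₀
  bridge : ∀ v ∈ C, root v ≠ x₀ → r₀ < D (root v) ∧
    ∃ y ∈ C, root y = x₀ ∧ N.c y (root v) ≠ 0 ∧ D (root v) = D y + N.d y (root v)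
  radius : ∀ v ∈ C, root v ≠ x₀ → E (root v) v ≤ D v - D (root v) + ε * ρ
  short : ∀ u ∈ C, ∀ v ∈ C, root u ≠ root v → N.c u v ≠ 0 → θ * ρ ≤ N.d u v

theorem exists_ball_cut (N : Net V) {C : Finset V} {x₀ : V} {D : V → ℝ} (hD : N.IsDist C x₀ D)
    {θ ρ : ℝ} (hρ : 0 < ρ) (hθρ : 0 ≤ θ * ρ)
    (hshort : (C.card : ℝ) ^ 2 * (2 * (θ * ρ)) ≤ ρ / 6) :
    ∃ r, ρ / 3 ≤ r ∧ r < 2 * ρ / 3 ∧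
      (∀ u ∈ C, ∀ v ∈ C, N.c u v ≠ 0 → D u ≤ r → r < D v → θ * ρ ≤ N.d u v) ∧
      ∑ u ∈ C with D u ≤ r, ∑ v ∈ C with ¬ D v ≤ r, N.act θ ρ u v / N.d u v ≤
        24 * (∑ v ∈ C, N.deg θ ρ C v) / ρ := by
  set μ := ∑ v ∈ C, N.deg θ ρ C v with hμ
  have hμ0 : 0 ≤ μ := Finset.sum_nonneg fun _ _ => deg_nonneg _ _ _ _
  obtain ⟨r, h1, h2, h3, h4⟩ := N.exists_cut (S := C) (h := D) (θ := θ) (ρ := ρ)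
    (a := ρ / 3) (b := 2 * ρ / 3) (F := max 1 μ)
    (fun u hu v hv hc => by linarith [hD.lip u hu v hv hc, N.d_pos u v]) (by linarith)
    (one_pos.trans_le (le_max_left _ _)) hθρ
    ((Finset.sum_le_sum_of_subset_of_nonneg (Finset.filter_subset _ _)
      fun _ _ _ => deg_nonneg _ _ _ _).trans (le_max_right _ _)) (by linarith)
  refine ⟨r, h1, h2, h3, ?_⟩
  by_cases hm : μ < 1
  · refine le_trans (le_of_eq ?_) (by positivity)
    refine Finset.sum_eq_zero fun u hu => Finset.sum_eq_zero fun v hv => ?_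
    have h1 : N.act θ ρ u v ≤ N.deg θ ρ C u :=
      Finset.single_le_sum (f := fun v => N.act θ ρ u v) (fun _ _ => act_nonneg _ _ _ _)
        (Finset.mem_filter.1 hv).1
    have h2 : N.deg θ ρ C u ≤ μ :=
      Finset.single_le_sum (f := fun u => N.deg θ ρ C u) (fun _ _ => deg_nonneg _ _ _ _)
        (Finset.mem_filter.1 hu).1
    rcases act_cases (N := N) θ ρ u v with h3 | h3
    · rw [h3, zero_div]
    · linarith
  · rw [max_eq_right (not_lt.1 hm)] at h4
    refine h4.trans (le_of_eq ?_)
    have : 2 * ρ / 3 - ρ / 3 = ρ / 3 := by ring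
    rw [this]
    field_simp
    ring

theorem exists_starPartition (N : Net V) {C : Finset V} {x₀ : V} {D : V → ℝ}
    (hD : N.IsDist C x₀ D) {θ ρ ε : ℝ} {t Nm : ℕ} (hρ : 0 < ρ) (hε : 0 < ε) (hε1 : ε ≤ 1 / 12)
    (hθ : 0 ≤ θ) (hNm : 1 + Real.log (max 1 (∑ v ∈ C, N.deg θ ρ C v)) ≤ Nm) (ht : Nm < 2 ^ t)
    (hshort : (C.card : ℝ) ^ 2 * (2 * θ) ≤ ε / (t * Nm) / 2) :
    ∃ r₀ root E, ρ / 3 ≤ r₀ ∧ r₀ < 2 * ρ / 3 ∧ N.IsStarPartition θ ρ ε r₀ C x₀ D root E ∧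
      cutSum (fun u v => N.act θ ρ u v / N.d u v) C root ≤
        144 * t / (ε * ρ) * ∑ z ∈ C.image root,
            ent (∑ v ∈ C, N.deg θ ρ C v) (∑ v ∈ C with root v = z, N.deg θ ρ C v) +
          48 * (∑ v ∈ C, N.deg θ ρ C v) / ρ := by
  set μ := ∑ v ∈ C, N.deg θ ρ C v with hμ
  have hθρ : 0 ≤ θ * ρ := mul_nonneg hθ hρ.le
  have hNm1 : (1 : ℝ) ≤ Nm := by
    have : 0 ≤ Real.log (max 1 μ) := Real.log_nonneg (le_max_left _ _)
    linarith
  have hNm1' : 1 ≤ Nm := by exact_mod_cast hNm1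
  have ht1 : 1 ≤ t := by
    rcases Nat.eq_zero_or_pos t with h | h
    · subst h; simp at ht; omega
    · exact h
  have ht1R : (1 : ℝ) ≤ t := by exact_mod_cast ht1
  have hscale : (C.card : ℝ) ^ 2 * (2 * (θ * ρ)) ≤ ε * ρ / (t * Nm) / 2 := by
    calc (C.card : ℝ) ^ 2 * (2 * (θ * ρ)) = (C.card : ℝ) ^ 2 * (2 * θ) * ρ := by ring
      _ ≤ ε / (t * Nm) / 2 * ρ := mul_le_mul_of_nonneg_right hshort hρ.le
      _ = _ := by ring
  obtain ⟨r₀, hr1, hr2, hsep, hball⟩ := N.exists_ball_cut hD hρ hθρ (by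
    refine hscale.trans ?_
    have : ε * ρ / (t * Nm) ≤ ε * ρ :=
      div_le_self (by positivity) (one_le_mul_of_one_le_of_one_le ht1R hNm1)
    nlinarith)
  set P := C.filter fun v => D v ≤ r₀ with hP
  have hxP : x₀ ∈ P := by
    rw [hP, Finset.mem_filter, hD.root]
    exact ⟨hD.mem, by linarith⟩
  have hPC : P ⊆ C := Finset.filter_subset _ _
  have hnP : ∀ {v}, v ∈ C → v ∉ P → r₀ < D v := fun hv hvP => by
    by_contra hcon
    exact hvP (Finset.mem_filter.2 ⟨hv, not_lt.1 hcon⟩)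
  have hDP : N.IsDist P x₀ D := hD.subset hPC hxP fun u hu v hv _ he => by
    rw [hP, Finset.mem_filter] at hv ⊢
    exact ⟨hu, by linarith [N.d_pos u v, hv.2]⟩
  obtain ⟨root', E', hpart, hcut⟩ := exists_conePartition (P := P) hD (Δ := ε * ρ) (by positivity)
    hθρ hNm ht hscale (C \ P) Finset.sdiff_subset (by
      intro v hv
      rw [Finset.mem_sdiff] at hv
      have hvx : v ≠ x₀ := fun e => hv.2 (e ▸ hxP)
      obtain ⟨u, hu, hc, he⟩ := hD.pred v hv.1 hvx
      refine ⟨u, ?_, hc, he⟩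
      rw [Finset.mem_sdiff]
      by_cases huP : u ∈ P
      · exact .inr huP
      · exact .inl ⟨hu, huP⟩)
  have hroot := hpart.root_mem
  have hne : ∀ v ∈ C \ P, root' v ≠ x₀ := fun v hv e =>
    (Finset.mem_sdiff.1 (hroot v hv)).2 (e ▸ hxP)
  have hsepP : ∀ u ∈ P, ∀ v ∈ C, v ∉ P → N.c u v ≠ 0 → θ * ρ ≤ N.d u v :=
    fun u hu v hv hvP hc => hsep u (hPC hu) v hv hc (Finset.mem_filter.1 hu).2 (hnP hv hvP)
  refine ⟨r₀, fun v => if v ∈ P then x₀ else root' v, fun z => if z = x₀ then D else E' z,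
    hr1, hr2, ⟨?_, by simp [hxP], ?_, by simp, ?_, ?_, ?_, ?_⟩, ?_⟩
  · intro v hv
    by_cases hvP : v ∈ P
    · simp [hvP, hD.mem]
    · simp only [hvP, if_false]
      exact Finset.sdiff_subset (hroot v (Finset.mem_sdiff.2 ⟨hv, hvP⟩))
  · intro v hv
    by_cases hvP : v ∈ P
    · simp only [hvP, if_true]
      rw [filter_merge_self hPC hxP hroot]
      exact hDP
    · have hv' := Finset.mem_sdiff.2 ⟨hv, hvP⟩
      simp only [hvP, if_false, hne v hv']
      rw [filter_merge_of_mem hxP (hroot v hv')]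
      exact hpart.isDist v hv'
  · intro v hv hvx
    by_cases hvP : v ∈ P
    · exact (Finset.mem_filter.1 hvP).2
    · simp only [hvP, if_false] at hvx
      exact absurd hvx (hne v (Finset.mem_sdiff.2 ⟨hv, hvP⟩))
  · intro v hv hvx
    by_cases hvP : v ∈ P
    · simp [hvP] at hvx
    · have hv' := Finset.mem_sdiff.2 ⟨hv, hvP⟩
      simp only [hvP, if_false]
      have hr := Finset.mem_sdiff.1 (hroot v hv')
      obtain ⟨y, hy, hc, he⟩ := hpart.bridge v hv'
      exact ⟨hnP hr.1 hr.2, y, hPC hy, by simp [hy], hc, he⟩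
  · intro v hv hvx
    by_cases hvP : v ∈ P
    · simp [hvP] at hvx
    · have hv' := Finset.mem_sdiff.2 ⟨hv, hvP⟩
      simp only [hvP, if_false, hne v hv']
      exact hpart.radius v hv'
  · intro u hu v hv huv hc
    by_cases huP : u ∈ P <;> by_cases hvP : v ∈ P
    · simp [huP, hvP] at huv
    · exact hsepP u huP v hv hvP hc
    · rw [N.d_symm]
      exact hsepP v hvP u hu huP (by rwa [N.c_symm])
    · simp only [huP, hvP, if_false] at huv
      exact hpart.short u (Finset.mem_sdiff.2 ⟨hu, huP⟩) v (Finset.mem_sdiff.2 ⟨hv, hvP⟩) huv hc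
  · rw [cutSum_merge hPC hxP hroot (fun u v => by rw [act_symm, N.d_symm]),
      sum_image_merge hPC hxP hroot fun S => ent μ (∑ v ∈ S, N.deg θ ρ C v), mul_add]
    have h1 : C \ P = C.filter fun v => ¬ D v ≤ r₀ := by
      rw [hP, Finset.filter_not]
    have h2 : 0 ≤ 144 * t / (ε * ρ) * ent μ (∑ v ∈ P, N.deg θ ρ C v) :=
      mul_nonneg (by positivity) (ent_nonneg (Finset.sum_nonneg fun _ _ => deg_nonneg _ _ _ _)
        (Finset.sum_le_sum_of_subset_of_nonneg hPC fun _ _ _ => deg_nonneg _ _ _ _))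
    have h3 : 48 * μ / ρ = 2 * (24 * μ / ρ) := by ring
    rw [← h1] at hball
    rw [h3]
    linarith

end Net

/-- The charge of a pair of length `d` in a cluster of radius `ρ`. -/
noncomputable def charge (θ L ρ d : ℝ) : ℝ :=
  if 2 * ρ < d then 0
  else if θ * ρ ≤ d then 2 * (1 + 4 * Real.log (2 * ρ / d))
  else 2 * (1 + 4 * Real.log (2 / θ)) + L

theorem one_div_four_le_log : (1 : ℝ) / 4 ≤ Real.log (4 / 3) := by
  have := Real.one_sub_inv_le_log_of_pos (show (0 : ℝ) < 4 / 3 by norm_num)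
  norm_num at this ⊢
  exact this

section charge

variable {θ L ρ ρ' d : ℝ}

theorem charge_nonneg (hθ : 0 < θ) (hθ1 : θ ≤ 1) (hL : 0 ≤ L) (hd : 0 < d) :
    0 ≤ charge θ L ρ d := by
  unfold charge
  split_ifs with h1 h2
  · exact le_rfl
  · have := Real.log_nonneg ((one_le_div hd).2 (not_lt.1 h1))
    positivity
  · have := Real.log_nonneg ((one_le_div hθ).2 (by linarith : θ ≤ 2))
    positivity

theorem charge_le (hθ : 0 < θ) (hθ1 : θ ≤ 1) (hL : 0 ≤ L) (hd : 0 < d) (hρ : 0 < ρ) :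
    charge θ L ρ d ≤ 2 * (1 + 4 * Real.log (2 / θ)) + L := by
  have h0 := Real.log_nonneg ((one_le_div hθ).2 (by linarith : θ ≤ 2))
  unfold charge
  split_ifs with h1 h2
  · positivity
  · have : Real.log (2 * ρ / d) ≤ Real.log (2 / θ) := by
      refine Real.log_le_log (by positivity) ?_
      rw [div_le_div_iff₀ hd hθ]
      nlinarith
    linarith
  · exact le_rfl

theorem charge_drop (hθ : 0 < θ) (hθ1 : θ ≤ 1) (hL : 0 ≤ L) (hd : 0 < d) (hρ : 0 < ρ)
    (hρ' : ρ' ≤ 3 / 4 * ρ) :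
    charge θ L ρ' d + (if θ * ρ ≤ d ∧ d ≤ 2 * ρ then 2 else 0) +
      (if d < θ * ρ ∧ θ * ρ' ≤ d ∧ d ≤ 2 * ρ' then L else 0) ≤ charge θ L ρ d := by
  have h0 := Real.log_nonneg ((one_le_div hθ).2 (by linarith : θ ≤ 2))
  have hle : θ * ρ' ≤ θ * ρ := mul_le_mul_of_nonneg_left (by linarith) hθ.le
  by_cases h1 : 2 * ρ < d
  · have h2 : 2 * ρ' < d := by linarith
    simp [charge, h1, h2, not_le.2 h1, not_le.2 h2]
  · have h1' := not_lt.1 h1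
    by_cases h3 : θ * ρ ≤ d
    · have h4 : θ * ρ' ≤ d := hle.trans h3
      have h5 := Real.log_nonneg ((one_le_div hd).2 h1')
      by_cases h2 : 2 * ρ' < d
      · simp only [charge, h1, h2, h3, h1', not_lt.2 h3, if_true, if_false, and_self, false_and]
        linarith
      · have h2' := not_lt.1 h2
        have hp : 0 < ρ' := by linarith
        have h6 : Real.log (2 * ρ' / d) + 1 / 4 ≤ Real.log (2 * ρ / d) := by
          have : Real.log (2 * ρ' / d) + Real.log (4 / 3) ≤ Real.log (2 * ρ / d) := by
            rw [← Real.log_mul (by positivity) (by norm_num)]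
            refine Real.log_le_log (by positivity) ?_
            rw [div_mul_eq_mul_div, div_le_div_iff_of_pos_right hd]
            linarith
          linarith [one_div_four_le_log]
        simp only [charge, h1, h2, h3, h4, h1', not_lt.2 h3, if_true, if_false, and_self,
          false_and]
        linarith
    · by_cases h2 : 2 * ρ' < d
      · simp only [charge, h1, h2, h3, not_le.2 h2, if_true, if_false, and_false, false_and]
        linarith
      · have h2' := not_lt.1 h2
        by_cases h4 : θ * ρ' ≤ d
        · have hp : 0 < ρ' := by linarith
          have h6 : Real.log (2 * ρ' / d) ≤ Real.log (2 / θ) := by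
            refine Real.log_le_log (by positivity) ?_
            rw [div_le_div_iff₀ hd hθ]
            nlinarith
          simp only [charge, h1, h2, h3, h4, h2', not_le.1 h3, if_true, if_false, and_self,
            false_and]
          linarith
        · simp only [charge, h1, h2, h3, h4, if_false, and_false, false_and]
          linarith

theorem two_le_charge (hd : 0 < d) (h1 : θ * ρ ≤ d) (h2 : d ≤ 2 * ρ) :
    2 ≤ charge θ L ρ d := by
  have := Real.log_nonneg ((one_le_div hd).2 h2)
  simp only [charge, not_lt.2 h2, h1, if_true, if_false]
  linarith

end charge

theorem sum_eq_zero_or_one_le {ι : Type*} {s : Finset ι} {f : ι → ℝ}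
    (h : ∀ i ∈ s, f i = 0 ∨ 1 ≤ f i) : ∑ i ∈ s, f i = 0 ∨ 1 ≤ ∑ i ∈ s, f i := by
  by_cases h0 : ∀ i ∈ s, f i = 0
  · exact .inl (Finset.sum_eq_zero h0)
  · push Not at h0
    obtain ⟨i, hi, hne⟩ := h0
    refine .inr (((h i hi).resolve_left hne).trans
      (Finset.single_le_sum (fun j hj => ?_) hi))
    rcases h j hj with h | h <;> linarith

theorem mul_log_nonneg {x : ℝ} (hx : x = 0 ∨ 1 ≤ x) : 0 ≤ x * Real.log x := by
  rcases hx with rfl | hx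
  · simp
  · exact mul_nonneg (by linarith) (Real.log_nonneg hx)

/-- Adding mass `b` to `m` raises `x log x` by at most `b (log M + 1)`. -/
theorem mul_log_le {x m b M : ℝ} (hx : x = 0 ∨ 1 ≤ x) (hm : m = 0 ∨ 1 ≤ m) (hb : 0 ≤ b)
    (hxm : x ≤ m + b) (hxM : x ≤ M) (hM : 1 ≤ M) :
    x * Real.log x ≤ m * Real.log m + b * (Real.log M + 1) := by
  have hM0 := Real.log_nonneg hM
  have hm0 := mul_log_nonneg hm
  rcases hx with rfl | hx
  · simp only [Real.log_zero, mul_zero]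
    positivity
  · have hlog := Real.log_nonneg hx
    have h1 : b * Real.log x ≤ b * Real.log M :=
      mul_le_mul_of_nonneg_left (Real.log_le_log (by linarith) hxM) hb
    have h2 : x * Real.log x ≤ (m + b) * Real.log x := mul_le_mul_of_nonneg_right hxm hlog
    have h3 : m * Real.log x ≤ m * Real.log m + b := by
      rcases hm with rfl | hm
      · simpa using hb
      · have hmp : 0 < m := by linarith
        have h4 : Real.log x ≤ Real.log m + b / m := by
          have h5 : Real.log x ≤ Real.log (m * (1 + b / m)) := by
            refine Real.log_le_log (by linarith) (hxm.trans (le_of_eq ?_))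
            field_simp
          rw [Real.log_mul hmp.ne' (by positivity)] at h5
          have h6 := Real.log_le_sub_one_of_pos (show 0 < 1 + b / m by positivity)
          linarith
        calc m * Real.log x ≤ m * (Real.log m + b / m) := mul_le_mul_of_nonneg_left h4 hmp.le
          _ = _ := by field_simp
    linarith

section parts

variable {V : Type} {C : Finset V} {root : V → V}

theorem sum_image_parts (f : V → ℝ) :
    ∑ z ∈ C.image root, ∑ v ∈ C with root v = z, f v = ∑ v ∈ C, f v :=
  Finset.sum_fiberwise_of_maps_to (fun _ hv => Finset.mem_image_of_mem _ hv) _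

theorem sum_parts_add_cutSum (q : V → V → ℝ) :
    ∑ z ∈ C.image root, ∑ u ∈ C with root u = z, ∑ v ∈ C with root v = z, q u v +
      cutSum q C root = ∑ u ∈ C, ∑ v ∈ C, q u v := by
  have h : ∑ z ∈ C.image root, ∑ u ∈ C with root u = z, ∑ v ∈ C with root v = z, q u v =
      ∑ u ∈ C, ∑ v ∈ C, if root u = root v then q u v else 0 := by
    refine Eq.trans ?_ (sum_image_parts (root := root) _)
    refine Finset.sum_congr rfl fun z _ => Finset.sum_congr rfl fun u hu => ?_
    rw [Finset.sum_filter]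
    refine Finset.sum_congr rfl fun v _ => ?_
    rw [(Finset.mem_filter.1 hu).2]
    simp only [eq_comm]
  rw [h, cutSum, ← Finset.sum_add_distrib]
  refine Finset.sum_congr rfl fun u _ => ?_
  rw [← Finset.sum_add_distrib]
  refine Finset.sum_congr rfl fun v _ => ?_
  split_ifs <;> simp

theorem cutSum_mono {q q' : V → V → ℝ}
    (h : ∀ u ∈ C, ∀ v ∈ C, root u ≠ root v → q u v ≤ q' u v) :
    cutSum q C root ≤ cutSum q' C root := by
  refine Finset.sum_le_sum fun u hu => Finset.sum_le_sum fun v hv => ?_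
  split_ifs with he
  exacts [le_rfl, h u hu v hv he]

theorem cutSum_nonneg {q : V → V → ℝ} (h : ∀ u ∈ C, ∀ v ∈ C, 0 ≤ q u v) :
    0 ≤ cutSum q C root := by
  refine Finset.sum_nonneg fun u hu => Finset.sum_nonneg fun v hv => ?_
  split_ifs
  exacts [le_rfl, h u hu v hv]

theorem cutSum_linear (a b : ℝ) (q q' : V → V → ℝ) :
    cutSum (fun u v => a * q u v + b * q' u v) C root =
      a * cutSum q C root + b * cutSum q' C root := by
  simp only [cutSum, Finset.mul_sum, ← Finset.sum_add_distrib]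
  refine Finset.sum_congr rfl fun u _ => Finset.sum_congr rfl fun v _ => ?_
  split_ifs <;> simp

end parts

namespace Net

variable {V : Type} {N : Net V}

/-- The potential bounding the total stretch of a cluster `S` of radius `ρ`. -/
noncomputable def pot (N : Net V) (θ L A ρ : ℝ) (S : Finset V) : ℝ :=
  A * (∑ u ∈ S, ∑ v ∈ S, N.c u v * charge θ L ρ (N.d u v) +
      (∑ v ∈ S, N.deg θ ρ S v) * Real.log (∑ v ∈ S, N.deg θ ρ S v)) +
    4 * ∑ u ∈ S, ∑ v ∈ S, N.c u v

theorem sum_deg_cases (θ ρ : ℝ) (S C : Finset V) :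
    ∑ v ∈ S, N.deg θ ρ C v = 0 ∨ 1 ≤ ∑ v ∈ S, N.deg θ ρ C v :=
  sum_eq_zero_or_one_le fun _ _ => sum_eq_zero_or_one_le fun _ _ => act_cases _ _ _ _

theorem sum_deg_le (θ ρ : ℝ) (S : Finset V) :
    ∑ v ∈ S, N.deg θ ρ S v ≤ ∑ u ∈ S, ∑ v ∈ S, N.c u v :=
  Finset.sum_le_sum fun _ _ => Finset.sum_le_sum fun _ _ => act_le _ _ _ _

theorem pot_nonneg {θ L A ρ : ℝ} {S : Finset V} (hθ : 0 < θ) (hθ1 : θ ≤ 1) (hL : 0 ≤ L)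
    (hA : 0 ≤ A) : 0 ≤ N.pot θ L A ρ S := by
  have h1 : 0 ≤ ∑ u ∈ S, ∑ v ∈ S, N.c u v * charge θ L ρ (N.d u v) :=
    Finset.sum_nonneg fun _ _ => Finset.sum_nonneg fun _ _ =>
      mul_nonneg (N.c_nonneg _ _) (charge_nonneg hθ hθ1 hL (N.d_pos _ _))
  have h2 := mul_log_nonneg (N.sum_deg_cases θ ρ S S)
  have h3 : 0 ≤ ∑ u ∈ S, ∑ v ∈ S, N.c u v :=
    Finset.sum_nonneg fun _ _ => Finset.sum_nonneg fun _ _ => N.c_nonneg _ _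
  unfold pot
  positivity

/-- The potential of a part, in terms of quantities at the scale of the whole cluster. -/
theorem pot_part_le {θ A ρ ρ' M : ℝ} {S C : Finset V} (hθ : 0 < θ) (hθ1 : θ ≤ 1) (hA : 0 ≤ A)
    (hM : 1 ≤ M) (hSC : S ⊆ C) (hSM : ∑ u ∈ S, ∑ v ∈ S, N.c u v ≤ M) (hρ : 0 < ρ)
    (hρ' : ρ' ≤ 3 / 4 * ρ) :
    N.pot θ (Real.log M + 1) A ρ' S ≤
      A * (∑ u ∈ S, ∑ v ∈ S,
          (N.c u v * charge θ (Real.log M + 1) ρ (N.d u v) - 2 * N.act θ ρ u v) +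
        (∑ v ∈ S, N.deg θ ρ C v) * Real.log (∑ v ∈ S, N.deg θ ρ C v)) +
      4 * ∑ u ∈ S, ∑ v ∈ S, N.c u v := by
  set L := Real.log M + 1 with hL
  have hL0 : 0 ≤ L := by linarith [Real.log_nonneg hM]
  set β : V → V → ℝ := fun u v =>
    if N.d u v < θ * ρ ∧ θ * ρ' ≤ N.d u v ∧ N.d u v ≤ 2 * ρ' then N.c u v else 0 with hβ
  have hβ0 : ∀ u v, 0 ≤ β u v := fun u v => by
    simp only [hβ]
    split_ifs
    exacts [N.c_nonneg u v, le_rfl]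
  have hmass : ∑ v ∈ S, N.deg θ ρ' S v ≤
      ∑ v ∈ S, N.deg θ ρ C v + ∑ u ∈ S, ∑ v ∈ S, β u v := by
    rw [← Finset.sum_add_distrib]
    refine Finset.sum_le_sum fun u _ => ?_
    have h1 : N.deg θ ρ S u ≤ N.deg θ ρ C u :=
      Finset.sum_le_sum_of_subset_of_nonneg hSC fun _ _ _ => act_nonneg _ _ _ _
    refine le_trans ?_ (add_le_add_left h1 _)
    unfold deg
    rw [← Finset.sum_add_distrib]
    refine Finset.sum_le_sum fun v _ => ?_
    by_cases h : θ * ρ' ≤ N.d u v ∧ N.d u v ≤ 2 * ρ'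
    · by_cases h' : N.d u v < θ * ρ
      · have := N.act_nonneg θ ρ u v
        have := N.act_le θ ρ' u v
        simp only [hβ, h, h', and_self, if_true]
        linarith
      · have h2 : N.act θ ρ u v = N.c u v := if_pos ⟨not_lt.1 h', by linarith [h.2]⟩
        linarith [N.act_le θ ρ' u v, hβ0 u v]
    · have h2 : N.act θ ρ' u v = 0 := if_neg h
      linarith [N.act_nonneg θ ρ u v, hβ0 u v]
  have hlog := mul_log_le (N.sum_deg_cases θ ρ' S S) (N.sum_deg_cases θ ρ S C)
    (Finset.sum_nonneg fun u _ => Finset.sum_nonneg fun v _ => hβ0 u v) hmass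
    ((N.sum_deg_le θ ρ' S).trans hSM) hM
  have hcharge : ∑ u ∈ S, ∑ v ∈ S, N.c u v * charge θ L ρ' (N.d u v) +
      (∑ u ∈ S, ∑ v ∈ S, β u v) * L ≤
        ∑ u ∈ S, ∑ v ∈ S, (N.c u v * charge θ L ρ (N.d u v) - 2 * N.act θ ρ u v) := by
    rw [Finset.sum_mul, ← Finset.sum_add_distrib]
    refine Finset.sum_le_sum fun u _ => ?_
    rw [Finset.sum_mul, ← Finset.sum_add_distrib]
    refine Finset.sum_le_sum fun v _ => ?_
    have h1 := mul_le_mul_of_nonneg_left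
      (charge_drop hθ hθ1 hL0 (N.d_pos u v) hρ hρ') (N.c_nonneg u v)
    simp only [hβ, act]
    rw [mul_add, mul_add] at h1
    split_ifs at h1 ⊢ <;> linarith
  unfold pot
  refine add_le_add_left (mul_le_mul_of_nonneg_left ?_ hA) _
  linarith

/-- One level of the recursion: the potential pays for the stretch of the separated pairs. -/
theorem sum_pot_parts_le {θ ε r₀ ρ M : ℝ} {t : ℕ} {C : Finset V} {x₀ : V} {D : V → ℝ}
    {root : V → V} {E : V → V → ℝ} (hθ : 0 < θ) (hθ1 : θ ≤ 1) (hε : 0 < ε) (hε1 : ε ≤ 1)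
    (ht : 1 ≤ t) (hρ : 0 < ρ) (hM : 1 ≤ M) (hCM : ∑ u ∈ C, ∑ v ∈ C, N.c u v ≤ M)
    (hpart : N.IsStarPartition θ ρ ε r₀ C x₀ D root E)
    (hcut : cutSum (fun u v => N.act θ ρ u v / N.d u v) C root ≤
        144 * t / (ε * ρ) * ∑ z ∈ C.image root,
            ent (∑ v ∈ C, N.deg θ ρ C v) (∑ v ∈ C with root v = z, N.deg θ ρ C v) +
          48 * (∑ v ∈ C, N.deg θ ρ C v) / ρ)
    {R : V → ℝ} (hR : ∀ z ∈ C.image root, R z ≤ 3 / 4 * ρ) {σ : V → V → ℝ}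
    (hσ : ∀ u ∈ C, ∀ v ∈ C, root u ≠ root v → σ u v ≤ 8 * ρ)
    (hparts : ∀ z ∈ C.image root,
      ∑ u ∈ C with root u = z, ∑ v ∈ C with root v = z, N.c u v * (σ u v / N.d u v) ≤
        N.pot θ (Real.log M + 1) (1152 * t / ε) (R z) (C.filter fun v => root v = z)) :
    ∑ u ∈ C, ∑ v ∈ C, N.c u v * (σ u v / N.d u v) ≤
      N.pot θ (Real.log M + 1) (1152 * t / ε) ρ C := by
  set L := Real.log M + 1 with hL
  have hL0 : 0 ≤ L := by linarith [Real.log_nonneg hM]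
  set A := 1152 * (t : ℝ) / ε with hA
  have htR : (1 : ℝ) ≤ t := by exact_mod_cast ht
  have hA1 : 1152 ≤ A := by
    rw [hA, le_div_iff₀ hε]
    nlinarith
  set μ := ∑ v ∈ C, N.deg θ ρ C v with hμ
  have hμ0 : 0 ≤ μ := Finset.sum_nonneg fun _ _ => deg_nonneg _ _ _ _
  set m : V → ℝ := fun z => ∑ v ∈ C with root v = z, N.deg θ ρ C v with hm
  set q : V → V → ℝ := fun u v => N.c u v * charge θ L ρ (N.d u v) - 2 * N.act θ ρ u v with hq
  have hq0 : ∀ u v, 0 ≤ q u v := fun u v => by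
    simp only [hq, act]
    split_ifs with h
    · nlinarith [two_le_charge (L := L) (N.d_pos u v) h.1 h.2, N.c_nonneg u v]
    · simpa using mul_nonneg (N.c_nonneg u v) (charge_nonneg hθ hθ1 hL0 (N.d_pos u v))
  have hmsum : ∑ z ∈ C.image root, m z = μ := sum_image_parts _
  have hent : ∑ z ∈ C.image root, ent μ (m z) =
      μ + μ * Real.log μ - ∑ z ∈ C.image root, m z * Real.log (m z) := by
    simp only [ent]
    rw [Finset.sum_sub_distrib, Finset.sum_add_distrib, ← Finset.sum_mul, hmsum]
  have hcutσ : cutSum (fun u v => N.c u v * (σ u v / N.d u v)) C root ≤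
      8 * ρ * cutSum (fun u v => N.act θ ρ u v / N.d u v) C root + 4 * cutSum N.c C root := by
    rw [← cutSum_linear]
    refine cutSum_mono fun u hu v hv huv => ?_
    have hd := N.d_pos u v
    have hc := N.c_nonneg u v
    have hact := N.act_nonneg θ ρ u v
    by_cases hc0 : N.c u v = 0
    · rw [hc0]
      have : 0 ≤ N.act θ ρ u v / N.d u v := by positivity
      nlinarith
    have h1 := hpart.short u hu v hv huv hc0
    have h2 : N.c u v * (σ u v / N.d u v) ≤ N.c u v * (8 * ρ / N.d u v) := by
      have := hσ u hu v hv huv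
      gcongr
    by_cases h3 : N.d u v ≤ 2 * ρ
    · rw [show N.act θ ρ u v = N.c u v from if_pos ⟨h1, h3⟩]
      have h4 : N.c u v * (8 * ρ / N.d u v) = 8 * ρ * (N.c u v / N.d u v) := by ring
      linarith
    · have h4 : 8 * ρ / N.d u v ≤ 4 := by
        rw [div_le_iff₀ hd]
        linarith
      have h5 : 0 ≤ 8 * ρ * (N.act θ ρ u v / N.d u v) := by positivity
      nlinarith
  have hcut' : 8 * ρ * cutSum (fun u v => N.act θ ρ u v / N.d u v) C root ≤
      A * (2 * μ + μ * Real.log μ - ∑ z ∈ C.image root, m z * Real.log (m z)) := by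
    calc _ ≤ 8 * ρ * (144 * t / (ε * ρ) * ∑ z ∈ C.image root, ent μ (m z) + 48 * μ / ρ) :=
          mul_le_mul_of_nonneg_left hcut (by positivity)
      _ = A * ∑ z ∈ C.image root, ent μ (m z) + 384 * μ := by
          rw [hA]
          field_simp
          ring
      _ ≤ A * ∑ z ∈ C.image root, ent μ (m z) + A * μ := by nlinarith
      _ = _ := by rw [hent]; ring
  have hsum : ∑ z ∈ C.image root, N.pot θ L A (R z) (C.filter fun v => root v = z) ≤
      A * (∑ u ∈ C, ∑ v ∈ C, q u v + ∑ z ∈ C.image root, m z * Real.log (m z)) +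
        4 * (∑ u ∈ C, ∑ v ∈ C, N.c u v - cutSum N.c C root) := by
    have h1 := sum_parts_add_cutSum (C := C) (root := root) q
    have h2 := sum_parts_add_cutSum (C := C) (root := root) N.c
    have h3 : 0 ≤ cutSum q C root := cutSum_nonneg fun u _ v _ => hq0 u v
    calc _ ≤ ∑ z ∈ C.image root, (A * (∑ u ∈ C with root u = z, ∑ v ∈ C with root v = z, q u v +
            m z * Real.log (m z)) +
              4 * ∑ u ∈ C with root u = z, ∑ v ∈ C with root v = z, N.c u v) := by
          refine Finset.sum_le_sum fun z hz => ?_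
          refine pot_part_le hθ hθ1 (by linarith) hM (Finset.filter_subset _ _) ?_ hρ (hR z hz)
          refine le_trans (Finset.sum_le_sum_of_subset_of_nonneg (Finset.filter_subset _ _) ?_ |>.trans
            (Finset.sum_le_sum fun u _ => ?_)) hCM
          · exact fun _ _ _ => Finset.sum_nonneg fun _ _ => N.c_nonneg _ _
          · exact Finset.sum_le_sum_of_subset_of_nonneg (Finset.filter_subset _ _)
              fun _ _ _ => N.c_nonneg _ _
      _ = A * (∑ z ∈ C.image root, ∑ u ∈ C with root u = z, ∑ v ∈ C with root v = z, q u v +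
            ∑ z ∈ C.image root, m z * Real.log (m z)) +
              4 * ∑ z ∈ C.image root,
                ∑ u ∈ C with root u = z, ∑ v ∈ C with root v = z, N.c u v := by
          rw [Finset.sum_add_distrib, ← Finset.mul_sum, ← Finset.mul_sum, Finset.sum_add_distrib]
      _ ≤ _ := by
          have h4 : ∑ z ∈ C.image root, ∑ u ∈ C with root u = z, ∑ v ∈ C with root v = z, q u v ≤
              ∑ u ∈ C, ∑ v ∈ C, q u v := by linarith
          have h5 := mul_le_mul_of_nonneg_left h4 (by linarith : 0 ≤ A)
          linarith
  have hqsum : ∑ u ∈ C, ∑ v ∈ C, q u v =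
      ∑ u ∈ C, ∑ v ∈ C, N.c u v * charge θ L ρ (N.d u v) - 2 * μ := by
    simp only [hq, hμ, deg, Finset.sum_sub_distrib, Finset.mul_sum]
  have htot := sum_parts_add_cutSum (C := C) (root := root)
    fun u v => N.c u v * (σ u v / N.d u v)
  have hp := Finset.sum_le_sum hparts
  rw [hqsum] at hsum
  unfold pot
  linarith

end Net

/-- Adjacency in the tree on `S` rooted at `x` with parent function `p`. -/
def treeAdj {V : Type} (p : V → V) (S : Finset V) (x u v : V) : Prop :=
  (u ∈ S ∧ u ≠ x ∧ v = p u) ∨ (v ∈ S ∧ v ≠ x ∧ u = p v)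

theorem treeAdj_symm {V : Type} {p : V → V} {S : Finset V} {x u v : V}
    (h : treeAdj p S x u v) : treeAdj p S x v u :=
  Or.symm h

namespace Net

variable {V : Type} {N : Net V}

/-- `p` is the parent function of a tree on `S` rooted at `x`, with depth function `τ`. -/
structure IsTree (N : Net V) (S : Finset V) (x : V) (p : V → V) (τ : V → ℝ) : Prop where
  root : τ x = 0
  step : ∀ v ∈ S, v ≠ x → p v ∈ S ∧ N.c v (p v) ≠ 0 ∧ τ v = τ (p v) + N.d v (p v)

theorem IsTree.path {S : Finset V} {x : V} {p : V → V} {τ : V → ℝ} (h : N.IsTree S x p τ) :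
    ∀ v ∈ S, Path (treeAdj p S x) N.d x v (τ v) := by
  by_contra! hcon
  obtain ⟨v₀, hv₀, hP₀⟩ := hcon
  obtain ⟨v, hv, hmin⟩ :=
    (S.filter fun v => ¬ Path (treeAdj p S x) N.d x v (τ v)).exists_min_image τ
      ⟨v₀, by simp [hv₀, hP₀]⟩
  rw [Finset.mem_filter] at hv
  have hvx : v ≠ x := by
    rintro rfl
    exact hv.2 (h.root.symm ▸ .nil)
  obtain ⟨hp, -, hτ⟩ := h.step v hv.1 hvx
  have hpath : Path (treeAdj p S x) N.d x (p v) (τ (p v)) := by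
    by_contra hP
    have := hmin (p v) (by simp [hp, hP])
    linarith [N.d_pos v (p v)]
  refine hv.2 ?_
  rw [hτ, N.d_symm]
  exact hpath.snoc (.inr ⟨hv.1, hvx, rfl⟩)

theorem IsTree.path_between {S : Finset V} {x : V} {p : V → V} {τ : V → ℝ}
    (h : N.IsTree S x p τ) {u v : V} (hu : u ∈ S) (hv : v ∈ S) :
    Path (treeAdj p S x) N.d u v (τ u + τ v) :=
  ((h.path u hu).reverse (fun _ _ => treeAdj_symm) N.d_symm).trans (h.path v hv)

/-- Trees on the parts of a star partition are joined by the bridges. -/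
theorem IsStarPartition.isTree {θ ρ ε r₀ : ℝ} {C : Finset V} {x₀ : V} {D : V → ℝ}
    {root : V → V} {E : V → V → ℝ} (hpart : N.IsStarPartition θ ρ ε r₀ C x₀ D root E)
    (hx₀ : x₀ ∈ C) {y : V → V}
    (hy : ∀ v ∈ C, root v ≠ x₀ → y (root v) ∈ C ∧ root (y (root v)) = x₀ ∧
      N.c (y (root v)) (root v) ≠ 0)
    {p : V → V → V} {τ : V → V → ℝ}
    (htree : ∀ z ∈ C.image root, N.IsTree (C.filter fun v => root v = z) z (p z) (τ z)) :
    N.IsTree C x₀ (fun v => if root v = v then y v else p (root v) v)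
      (fun v => if root v = x₀ then τ x₀ v
        else τ x₀ (y (root v)) + N.d (y (root v)) (root v) + τ (root v) v) ∧
    ∀ z ∈ C.image root, ∀ u v, treeAdj (p z) (C.filter fun v => root v = z) z u v →
      treeAdj (fun v => if root v = v then y v else p (root v) v) C x₀ u v := by
  refine ⟨⟨?_, ?_⟩, ?_⟩
  · simp only [hpart.root_center, if_true]
    exact (htree x₀ (Finset.mem_image.2 ⟨x₀, hx₀, hpart.root_center⟩)).root
  · intro v hv hvx
    by_cases hr : root v = v
    · obtain ⟨h1, h2, h3⟩ := hy v hv (hr.trans_ne hvx)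
      rw [hr] at h1 h2 h3
      have h4 : τ v v = 0 := (htree v (Finset.mem_image.2 ⟨v, hv, hr⟩)).root
      simp only [hr, if_true, hvx, if_false, h2, h4]
      refine ⟨h1, by rwa [N.c_symm], ?_⟩
      rw [N.d_symm, add_zero]
    · have hvS : v ∈ C.filter fun w => root w = root v := Finset.mem_filter.2 ⟨hv, rfl⟩
      obtain ⟨h1, h2, h3⟩ := (htree (root v) (Finset.mem_image_of_mem _ hv)).step v hvS (Ne.symm hr)
      rw [Finset.mem_filter] at h1
      simp only [hr, if_false, h1.2]
      refine ⟨h1.1, h2, ?_⟩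
      split_ifs with h4
      · rw [h4] at h3 ⊢
        exact h3
      · rw [h3]
        ring
  · have key : ∀ z u, u ∈ C.filter (fun v => root v = z) → u ≠ z →
        u ∈ C ∧ u ≠ x₀ ∧ (if root u = u then y u else p (root u) u) = p z u := by
      intro z u hu huz
      rw [Finset.mem_filter] at hu
      obtain ⟨hu, rfl⟩ := hu
      refine ⟨hu, fun e => huz ?_, by simp [huz.symm]⟩
      rw [e, hpart.root_center]
    rintro z - u v (⟨h1, h2, h3⟩ | ⟨h1, h2, h3⟩)
    · obtain ⟨h4, h5, h6⟩ := key z u h1 h2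
      exact .inl ⟨h4, h5, h3.trans h6.symm⟩
    · obtain ⟨h4, h5, h6⟩ := key z v h1 h2
      exact .inr ⟨h4, h5, h3.trans h6.symm⟩

/-- The depth bound for a tree in a cluster of radius `ρ`, for every recursion depth `k`. -/
def DepthBound (ε ρ : ℝ) (C : Finset V) (D τ : V → ℝ) : Prop :=
  ∀ (k : ℕ) (η : ℝ), ρ * (3 / 4) ^ k ≤ η →
    ∀ v ∈ C, τ v ≤ D v + ((1 + ε) ^ k - 1) * ρ + (C.card - 1) * η

theorem card_part_add_le {C : Finset V} {root : V → V} {a b : V} (hab : a ≠ b) :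
    ((C.filter fun v => root v = a).card : ℝ) + (C.filter fun v => root v = b).card ≤ C.card := by
  have hdisj : Disjoint (C.filter fun v => root v = a) (C.filter fun v => root v = b) := by
    rw [Finset.disjoint_filter]
    exact fun v _ h1 h2 => hab (h1.symm.trans h2)
  rw [← Nat.cast_add, ← Finset.card_union_of_disjoint hdisj]
  exact_mod_cast Finset.card_le_card
    (Finset.union_subset (Finset.filter_subset _ _) (Finset.filter_subset _ _))

theorem IsStarPartition.depthBound {θ ρ ε r₀ : ℝ} {C : Finset V} {x₀ : V} {D : V → ℝ}
    {root : V → V} {E : V → V → ℝ} (hpart : N.IsStarPartition θ ρ ε r₀ C x₀ D root E)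
    (hx₀ : x₀ ∈ C) (hε : 0 < ε) (hε1 : ε ≤ 1) (hρ : 0 < ρ)
    {y : V → V}
    (hy : ∀ v ∈ C, root v ≠ x₀ → y (root v) ∈ C ∧ root (y (root v)) = x₀ ∧
      D (root v) = D (y (root v)) + N.d (y (root v)) (root v))
    {τ : V → V → ℝ} {R : V → ℝ}
    (hR : ∀ z ∈ C.image root, R z ≤ 3 / 4 * ρ)
    (hR2 : ∀ z ∈ C.image root, z ≠ x₀ → R x₀ + R z ≤ (1 + ε) * ρ)
    (hdepth : ∀ z ∈ C.image root, DepthBound ε (R z) (C.filter fun v => root v = z) (E z) (τ z)) :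
    DepthBound ε ρ C D (fun v => if root v = x₀ then τ x₀ v
        else τ x₀ (y (root v)) + N.d (y (root v)) (root v) + τ (root v) v) := by
  have hxim : x₀ ∈ C.image root := Finset.mem_image.2 ⟨x₀, hx₀, hpart.root_center⟩
  intro k η hη v hv
  have hη0 : 0 ≤ η := le_trans (by positivity) hη
  -- the inductive hypothesis at depth `j` applied to every part
  obtain ⟨j, hj, hj1, hj2⟩ : ∃ j : ℕ, (∀ z ∈ C.image root, R z * (3 / 4) ^ j ≤ η) ∧
      ((1 + ε) ^ j - 1) * ρ ≤ ((1 + ε) ^ k - 1) * ρ ∧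
      ε * ρ + ((1 + ε) ^ j - 1) * ((1 + ε) * ρ) ≤ ((1 + ε) ^ k - 1) * ρ + η := by
    cases k with
    | zero =>
      refine ⟨0, fun z hz => ?_, le_rfl, ?_⟩
      · have := hR z hz
        simp only [pow_zero, mul_one] at hη ⊢
        linarith
      · simp only [pow_zero, mul_one] at hη ⊢
        nlinarith
    | succ j =>
      refine ⟨j, fun z hz => ?_, ?_, ?_⟩
      · refine (mul_le_mul_of_nonneg_right (hR z hz) (by positivity)).trans (le_trans ?_ hη)
        rw [pow_succ]
        exact le_of_eq (by ring)
      · have := pow_le_pow_right₀ (by linarith : 1 ≤ 1 + ε) (j.le_add_right 1)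
        exact mul_le_mul_of_nonneg_right (by linarith) hρ.le
      · rw [pow_succ]
        linarith
  have hpow : 0 ≤ (1 + ε) ^ j - 1 := by
    linarith [one_le_pow₀ (n := j) (by linarith : 1 ≤ 1 + ε)]
  have hpart_depth : ∀ w ∈ C, τ (root w) w ≤ E (root w) w + ((1 + ε) ^ j - 1) * R (root w) +
      ((C.filter fun v => root v = root w).card - 1) * η := fun w hw =>
    hdepth _ (Finset.mem_image_of_mem _ hw) j η (hj _ (Finset.mem_image_of_mem _ hw)) w
      (Finset.mem_filter.2 ⟨hw, rfl⟩)
  have hball : ∀ w ∈ C, root w = x₀ → τ x₀ w ≤ D w + ((1 + ε) ^ j - 1) * R x₀ +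
      ((C.filter fun v => root v = x₀).card - 1) * η := fun w hw he => by
    have := hpart_depth w hw
    rwa [he, hpart.center] at this
  simp only
  split_ifs with h
  · have h1 := hball v hv h
    have h2 : ((C.filter fun v => root v = x₀).card : ℝ) ≤ C.card := by
      exact_mod_cast Finset.card_le_card (Finset.filter_subset _ _)
    have h3 : ((1 + ε) ^ j - 1) * R x₀ ≤ ((1 + ε) ^ j - 1) * ρ :=
      mul_le_mul_of_nonneg_left (by linarith [hR x₀ hxim]) hpow
    have h4 := mul_le_mul_of_nonneg_right h2 hη0
    linarith
  · obtain ⟨h1, h2, h3⟩ := hy v hv h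
    have h4 := hball _ h1 h2
    have h5 := hpart_depth v hv
    have h6 := hpart.radius v hv h
    have h7 := mul_le_mul_of_nonneg_left
      (hR2 (root v) (Finset.mem_image_of_mem _ hv) h) hpow
    have h8 := mul_le_mul_of_nonneg_right
      (card_part_add_le (C := C) (root := root) (Ne.symm h)) hη0
    linarith

/-- Every cluster has a spanning tree of small depth whose total stretch is bounded by the
potential. -/
theorem exists_tree (N : Net V) {U : Finset V} {θ ε M : ℝ} {t Nm K : ℕ} (hθ : 0 < θ)
    (hθ1 : θ ≤ 1) (hε : 0 < ε) (hε1 : ε ≤ 1 / 12) (ht1 : 1 ≤ t) (hM : 1 ≤ M)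
    (hUM : ∑ u ∈ U, ∑ v ∈ U, N.c u v ≤ M) (hNm : 1 + Real.log M ≤ Nm) (ht : Nm < 2 ^ t)
    (hshort : (U.card : ℝ) ^ 2 * (2 * θ) ≤ ε / (t * Nm) / 2) (hK : (1 + ε) ^ K ≤ 2)
    (hKU : (U.card : ℝ) * (3 / 4) ^ K ≤ 1) :
    ∀ C ⊆ U, ∀ (x : V) (D : V → ℝ) (ρ : ℝ), N.IsDist C x D → (∀ v ∈ C, D v ≤ ρ) →
      (∃ v ∈ C, D v = ρ) → ∃ (p : V → V) (τ : V → ℝ) (σ : V → V → ℝ), N.IsTree C x p τ ∧ DepthBound ε ρ C D τ ∧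
        (∀ u ∈ C, ∀ v ∈ C, Path (treeAdj p C x) N.d u v (σ u v)) ∧
        ∑ u ∈ C, ∑ v ∈ C, N.c u v * (σ u v / N.d u v) ≤
          N.pot θ (Real.log M + 1) (1152 * t / ε) ρ C := by
  intro C
  induction C using Finset.strongInduction with
  | H C ih =>
  intro hCU x₀ D ρ hD hDρ hDmax
  obtain ⟨vmax, hvmax, hDvmax⟩ := hDmax
  have hL0 : 0 ≤ Real.log M + 1 := by linarith [Real.log_nonneg hM]
  have hsub : ∀ S ⊆ U, ∑ u ∈ S, ∑ v ∈ S, N.c u v ≤ M := fun S hS =>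
    ((Finset.sum_le_sum_of_subset_of_nonneg hS fun _ _ _ =>
      Finset.sum_nonneg fun _ _ => N.c_nonneg _ _).trans (Finset.sum_le_sum fun _ _ =>
        Finset.sum_le_sum_of_subset_of_nonneg hS fun _ _ _ => N.c_nonneg _ _)).trans hUM
  have hρ0 : 0 ≤ ρ := hDvmax ▸ hD.nonneg vmax hvmax
  rcases hρ0.eq_or_lt with rfl | hρ
  · have hall : ∀ v ∈ C, v = x₀ := fun v hv => by
      by_contra hne
      linarith [hD.pos hv hne, hDρ v hv]
    refine ⟨id, fun _ => 0, fun _ _ => 0, ⟨rfl, fun v hv hne => absurd (hall v hv) hne⟩, ?_, ?_, ?_⟩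
    · intro k η hη v hv
      have h1 : (1 : ℝ) ≤ C.card := by
        exact_mod_cast Finset.card_pos.2 ⟨v, hv⟩
      have h2 : 0 ≤ (C.card - 1 : ℝ) * η := mul_nonneg (by linarith) (by simpa using hη)
      linarith [hD.nonneg v hv]
    · intro u hu v hv
      rw [hall u hu, hall v hv]
      exact .nil
    · simpa using pot_nonneg hθ hθ1 hL0 (by positivity)
  have hcardCU : (C.card : ℝ) ≤ U.card := by exact_mod_cast Finset.card_le_card hCU
  have hmax : 1 + Real.log (max 1 (∑ v ∈ C, N.deg θ ρ C v)) ≤ Nm := by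
    have := Real.log_le_log (one_pos.trans_le (le_max_left 1 _))
      (max_le hM ((N.sum_deg_le θ ρ C).trans (hsub C hCU)))
    linarith
  obtain ⟨r₀, root, E, hr1, hr2, hpart, hcut⟩ := N.exists_starPartition hD hρ hε hε1 hθ.le hmax ht
    (le_trans (by gcongr) hshort)
  have hself : ∀ v ∈ C, root (root v) = root v := fun v hv =>
    (Finset.mem_filter.1 (hpart.isDist v hv).mem).2
  have hxim : x₀ ∈ C.image root := Finset.mem_image.2 ⟨x₀, hD.mem, hpart.root_center⟩
  have him : ∀ z ∈ C.image root, z ∈ C ∧ root z = z := fun z hz => by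
    obtain ⟨v, hv, rfl⟩ := Finset.mem_image.1 hz
    exact ⟨hpart.root_mem v hv, hself v hv⟩
  have hdist : ∀ z ∈ C.image root, N.IsDist (C.filter fun w => root w = z) z (E z) :=
    fun z hz => by simpa [(him z hz).2] using hpart.isDist z (him z hz).1
  -- radii of the parts
  have hrad : ∀ z ∈ C.image root, ∃ r, (∀ v ∈ C.filter fun w => root w = z, E z v ≤ r) ∧
      ∃ v ∈ C.filter fun w => root w = z, E z v = r := fun z hz => by
    obtain ⟨v, hv, hmax⟩ := (C.filter fun w => root w = z).exists_max_image (E z)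
      ⟨z, (hdist z hz).mem⟩
    exact ⟨E z v, hmax, v, hv, rfl⟩
  choose! R hRle hRmax using hrad
  have hRx : R x₀ ≤ r₀ := by
    obtain ⟨v, hv, he⟩ := hRmax x₀ hxim
    rw [Finset.mem_filter] at hv
    rw [← he, hpart.center]
    exact hpart.ball v hv.1 hv.2
  have hRz : ∀ z ∈ C.image root, z ≠ x₀ → R z ≤ ρ - r₀ + ε * ρ := fun z hz hzx => by
    obtain ⟨v, hv, he⟩ := hRmax z hz
    rw [Finset.mem_filter] at hv
    obtain ⟨hv, rfl⟩ := hv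
    have h1 := hpart.radius v hv hzx
    have h2 := (hpart.bridge v hv hzx).1
    linarith [hDρ v hv]
  have hR : ∀ z ∈ C.image root, R z ≤ 3 / 4 * ρ := fun z hz => by
    by_cases hzx : z = x₀
    · rw [hzx]
      linarith
    · nlinarith [hRz z hz hzx]
  have hR2 : ∀ z ∈ C.image root, z ≠ x₀ → R x₀ + R z ≤ (1 + ε) * ρ := fun z hz hzx => by
    linarith [hRz z hz hzx]
  have hlt : ∀ z ∈ C.image root, (C.filter fun w => root w = z) ⊂ C := fun z hz => by
    refine (Finset.filter_subset _ _).ssubset_of_ne fun he => ?_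
    have hall : ∀ v ∈ C, root v = z := fun v hv => by
      rw [← he] at hv
      exact (Finset.mem_filter.1 hv).2
    have h1 := hpart.ball vmax hvmax
      ((hall vmax hvmax).trans ((hall x₀ hD.mem).symm.trans hpart.root_center))
    linarith
  have hrec : ∀ z ∈ C.image root, ∃ (p : V → V) (τ : V → ℝ) (σ : V → V → ℝ), N.IsTree (C.filter fun w => root w = z) z p τ ∧
      DepthBound ε (R z) (C.filter fun w => root w = z) (E z) τ ∧
      (∀ u ∈ C.filter fun w => root w = z, ∀ v ∈ C.filter fun w => root w = z,
        Path (treeAdj p (C.filter fun w => root w = z) z) N.d u v (σ u v)) ∧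
      ∑ u ∈ C.filter fun w => root w = z, ∑ v ∈ C.filter fun w => root w = z,
        N.c u v * (σ u v / N.d u v) ≤
          N.pot θ (Real.log M + 1) (1152 * t / ε) (R z) (C.filter fun w => root w = z) :=
    fun z hz => ih _ (hlt z hz) ((Finset.filter_subset _ _).trans hCU) z (E z) (R z)
      (hdist z hz) (hRle z hz) (hRmax z hz)
  choose! p τ σ htree hdepth hpath hstretch using hrec
  have hbridge : ∀ z ∈ C.image root, z ≠ x₀ → ∃ y ∈ C, root y = x₀ ∧ N.c y z ≠ 0 ∧
      D z = D y + N.d y z := fun z hz hzx => by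
    obtain ⟨v, hv, rfl⟩ := Finset.mem_image.1 hz
    exact (hpart.bridge v hv hzx).2
  choose! y hyC hyroot hyc hyD using hbridge
  have hmem : ∀ v ∈ C, root v ∈ C.image root := fun v hv => Finset.mem_image_of_mem _ hv
  obtain ⟨hT, hadj⟩ := hpart.isTree hD.mem (y := y)
    (fun v hv h => ⟨hyC _ (hmem v hv) h, hyroot _ (hmem v hv) h, hyc _ (hmem v hv) h⟩) htree
  have hDB := hpart.depthBound hD.mem hε (by linarith) hρ (y := y)
    (fun v hv h => ⟨hyC _ (hmem v hv) h, hyroot _ (hmem v hv) h, hyD _ (hmem v hv) h⟩)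
    hR hR2 hdepth
  set p' : V → V := fun v => if root v = v then y v else p (root v) v with hp'
  set τ' : V → ℝ := fun v => if root v = x₀ then τ x₀ v
        else τ x₀ (y (root v)) + N.d (y (root v)) (root v) + τ (root v) v with hτ'
  have hτ4 : ∀ v ∈ C, τ' v ≤ 4 * ρ := fun v hv => by
    have h1 := hDB K (ρ * (3 / 4) ^ K) le_rfl v hv
    have h2 : ((1 + ε) ^ K - 1) * ρ ≤ 1 * ρ := mul_le_mul_of_nonneg_right (by linarith) hρ0
    have h3 : (C.card - 1 : ℝ) * (ρ * (3 / 4) ^ K) ≤ ρ := by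
      calc (C.card - 1 : ℝ) * (ρ * (3 / 4) ^ K) ≤ U.card * (ρ * (3 / 4) ^ K) :=
            mul_le_mul_of_nonneg_right (by linarith) (by positivity)
        _ = U.card * (3 / 4) ^ K * ρ := by ring
        _ ≤ 1 * ρ := mul_le_mul_of_nonneg_right hKU hρ0
        _ = ρ := one_mul ρ
    linarith [hDρ v hv]
  refine ⟨p', τ', fun u v => if root u = root v then σ (root u) u v else τ' u + τ' v, hT, hDB,
    ?_, ?_⟩
  · intro u hu v hv
    simp only
    split_ifs with h
    · exact (hpath _ (hmem u hu) u (Finset.mem_filter.2 ⟨hu, rfl⟩) v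
        (Finset.mem_filter.2 ⟨hv, h.symm⟩)).mono (hadj _ (hmem u hu))
    · exact hT.path_between hu hv
  · refine sum_pot_parts_le hθ hθ1 hε (by linarith) ht1 hρ hM (hsub C hCU) hpart hcut hR ?_ ?_
    · intro u hu v hv huv
      simp only [huv, if_false]
      linarith [hτ4 u hu, hτ4 v hv]
    · intro z hz
      refine le_trans (le_of_eq ?_) (hstretch z hz)
      refine Finset.sum_congr rfl fun u hu => Finset.sum_congr rfl fun v hv => ?_
      simp only [(Finset.mem_filter.1 hu).2, (Finset.mem_filter.1 hv).2, if_true]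

end Net

theorem two_thirds_le_log_two : (2 : ℝ) / 3 ≤ Real.log 2 := by
  linarith [Real.log_two_gt_d9]

theorem four_thirds_le_log {x : ℝ} (hx : 4 ≤ x) : (4 : ℝ) / 3 ≤ Real.log x := by
  have h : Real.log 4 = 2 * Real.log 2 := by
    rw [show (4 : ℝ) = 2 ^ 2 by norm_num, Real.log_pow]
    norm_num
  have := Real.log_le_log (by norm_num) hx
  linarith [two_thirds_le_log_two]

theorem one_quarter_le_log_log {x : ℝ} (hx : 4 ≤ x) : (1 : ℝ) / 4 ≤ Real.log (Real.log x) :=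
  one_div_four_le_log.trans (Real.log_le_log (by norm_num) (four_thirds_le_log hx))

theorem clog_sub_one_mul_le {m : ℕ} (hm : 2 ≤ m) :
    ((Nat.clog 2 m : ℝ) - 1) * (2 / 3) ≤ Real.log m := by
  have h1 : 1 ≤ Nat.clog 2 m := Nat.clog_pos one_lt_two hm
  have h2 : 2 ^ (Nat.clog 2 m).pred < m := Nat.pow_pred_clog_lt_self one_lt_two hm
  have h3 : (2 : ℝ) ^ (Nat.clog 2 m).pred ≤ m := by exact_mod_cast h2.le
  have h4 := Real.log_le_log (by positivity) h3
  have h5 : ((Nat.clog 2 m).pred : ℝ) = Nat.clog 2 m - 1 := by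
    rw [Nat.pred_eq_sub_one, Nat.cast_sub h1, Nat.cast_one]
  have h6 : (0 : ℝ) ≤ Nat.clog 2 m - 1 := h5 ▸ Nat.cast_nonneg _
  rw [Real.log_pow, h5] at h4
  exact (mul_le_mul_of_nonneg_left two_thirds_le_log_two h6).trans h4

theorem two_le_clog {n : ℕ} (hn : 4 ≤ n) : 2 ≤ Nat.clog 2 n :=
  (Nat.lt_clog_iff_pow_lt one_lt_two).2 (by omega)

theorem clog_le_three_mul_log {n : ℕ} (hn : 4 ≤ n) : (Nat.clog 2 n : ℝ) ≤ 3 * Real.log n := by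
  have h1 : (2 : ℝ) ≤ Nat.clog 2 n := by exact_mod_cast two_le_clog hn
  linarith [clog_sub_one_mul_le (show 2 ≤ n by omega)]

theorem clog_clog_le {n : ℕ} (hn : 4 ≤ n) :
    (Nat.clog 2 (Nat.clog 2 n) : ℝ) + 3 ≤ 30 * Real.log (Real.log n) := by
  have hnR : (4 : ℝ) ≤ n := by exact_mod_cast hn
  have h1 := clog_sub_one_mul_le (two_le_clog hn)
  have h2 : (2 : ℝ) ≤ Nat.clog 2 n := by exact_mod_cast two_le_clog hn
  have h3 := Real.log_le_log (by linarith) (clog_le_three_mul_log hn)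
  have h4 := four_thirds_le_log hnR
  rw [Real.log_mul (by norm_num) (by linarith)] at h3
  have h5 := Real.log_le_sub_one_of_pos (show (0 : ℝ) < 3 by norm_num)
  linarith [one_quarter_le_log_log hnR]

theorem one_add_pow_le {l : ℕ} (hl : 0 < l) :
    (1 + 1 / (6 * (l : ℝ))) ^ (3 * l) ≤ Real.sqrt (Real.exp 1) := by
  have hlR : (0 : ℝ) < l := by exact_mod_cast hl
  refine Real.le_sqrt_of_sq_le ?_
  calc ((1 + 1 / (6 * (l : ℝ))) ^ (3 * l)) ^ 2
      ≤ (Real.exp (1 / (6 * (l : ℝ))) ^ (3 * l)) ^ 2 := by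
        have := Real.add_one_le_exp (1 / (6 * (l : ℝ)))
        rw [add_comm] at this
        gcongr
    _ = Real.exp 1 := by
        rw [← pow_mul, ← Real.exp_nat_mul]
        congr 1
        push_cast
        field_simp
        norm_num

theorem mul_add_mul_le {a m L b X : ℝ} (ha : 0 ≤ a) (hm : 0 ≤ m) (hL : 0 ≤ L) (hb : b ≤ 5 * L)
    (haX : a ≤ X) (hX : 4 ≤ X * L) :
    a * (m * (95 * L) + m * b) + 4 * m ≤ 101 * (X * L * m) := by
  have h1 : a * (m * b) ≤ a * (m * (5 * L)) := by gcongr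
  have h2 : a * (m * L) ≤ X * (m * L) := by gcongr
  have h3 := mul_le_mul_of_nonneg_right hX hm
  linarith

namespace Net

variable {V : Type}

theorem pot_le (N : Net V) {U : Finset V} {θ ρ A M B : ℝ} (hθ : 0 < θ) (hθ1 : θ ≤ 1)
    (hA : 0 ≤ A) (hM : 1 ≤ M) (hρ : 0 < ρ) (hUM : ∑ u ∈ U, ∑ v ∈ U, N.c u v ≤ M)
    (hB : 2 * (1 + 4 * Real.log (2 / θ)) + (Real.log M + 1) ≤ B) :
    N.pot θ (Real.log M + 1) A ρ U ≤ A * (M * B + M * Real.log M) + 4 * M := by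
  have hL := Real.log_nonneg hM
  have hB0 : 0 ≤ B := by
    have := Real.log_nonneg ((one_le_div hθ).2 (by linarith : θ ≤ 2))
    linarith
  have h1 : ∑ u ∈ U, ∑ v ∈ U, N.c u v * charge θ (Real.log M + 1) ρ (N.d u v) ≤ M * B := by
    refine le_trans ?_ (mul_le_mul_of_nonneg_right hUM hB0)
    simp only [Finset.sum_mul]
    exact Finset.sum_le_sum fun u _ => Finset.sum_le_sum fun v _ =>
      mul_le_mul_of_nonneg_left
        ((charge_le hθ hθ1 (by linarith) (N.d_pos u v) hρ).trans hB) (N.c_nonneg u v)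
  have h2 := (N.sum_deg_le θ ρ U).trans hUM
  have h3 : (∑ v ∈ U, N.deg θ ρ U v) * Real.log (∑ v ∈ U, N.deg θ ρ U v) ≤ M * Real.log M := by
    rcases N.sum_deg_cases θ ρ U U with h | h
    · rw [h, zero_mul]
      exact mul_nonneg (by linarith) hL
    · exact mul_le_mul h2 (Real.log_le_log (by linarith) h2) (Real.log_nonneg h) (by linarith)
  unfold pot
  gcongr

set_option maxHeartbeats 800000 in
/-- Low-stretch trees for networks on `n ≥ 4` vertices with total multiplicity at most `3 n²`. -/
theorem exists_lowStretch [Fintype V] (N : Net V) (hn : 4 ≤ Fintype.card V)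
    (hc : ∑ u, ∑ v, N.c u v ≤ 3 * (Fintype.card V : ℝ) ^ 2) {x : V} {D : V → ℝ} {ρ : ℝ}
    (hD : N.IsDist Finset.univ x D) (hDρ : ∀ v, D v ≤ ρ) (hmax : ∃ v, D v = ρ) (hρ : 0 < ρ) :
    ∃ (p : V → V) (τ : V → ℝ) (σ : V → V → ℝ), N.IsTree Finset.univ x p τ ∧
      (∀ v, τ v ≤ 2 * Real.sqrt (Real.exp 1) * ρ) ∧
      (∀ u v, Path (treeAdj p Finset.univ x) N.d u v (σ u v)) ∧
      ∑ u, ∑ v, N.c u v * (σ u v / N.d u v) ≤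
        188490240 * (Fintype.card V : ℝ) ^ 2 * (Real.log (Fintype.card V) ^ 2 *
          Real.log (Real.log (Fintype.card V))) := by
  set n := Fintype.card V with hn'
  have hnR : (4 : ℝ) ≤ n := by exact_mod_cast hn
  set l := Nat.clog 2 n with hl
  have hl2 : 2 ≤ l := two_le_clog hn
  have hl2R : (2 : ℝ) ≤ l := by exact_mod_cast hl2
  have hnl : n ≤ 2 ^ l := Nat.le_pow_clog one_lt_two n
  have hnlR : (n : ℝ) ≤ 2 ^ l := by exact_mod_cast hnl
  have hln : l ≤ n := Nat.clog_le_of_le_pow Nat.lt_two_pow_self.le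
  set t := Nat.clog 2 l + 3 with ht
  have htl : t ≤ 2 * n := by
    have : Nat.clog 2 l ≤ l := Nat.clog_le_of_le_pow Nat.lt_two_pow_self.le
    omega
  have hlogn := four_thirds_le_log hnR
  have hll := one_quarter_le_log_log hnR
  have hlogl : Real.log n ≤ l * (7 / 10) := by
    have h := Real.log_le_log (by linarith) hnlR
    rw [Real.log_pow] at h
    have := mul_le_mul_of_nonneg_left
      (show Real.log 2 ≤ 7 / 10 by linarith [Real.log_two_lt_d9]) (by linarith : (0 : ℝ) ≤ l)
    linarith
  have hlog3 := Real.log_le_sub_one_of_pos (show (0 : ℝ) < 3 by norm_num)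
  have hlog2 := Real.log_le_sub_one_of_pos (show (0 : ℝ) < 2 by norm_num)
  have hlogM : Real.log (3 * (n : ℝ) ^ 2) = Real.log 3 + 2 * Real.log n := by
    rw [Real.log_mul (by norm_num) (by positivity), Real.log_pow]
    norm_num
  have hM1 : (1 : ℝ) ≤ 3 * (n : ℝ) ^ 2 := by nlinarith
  set θ : ℝ := 1 / (n : ℝ) ^ 10 with hθ
  have hθ0 : 0 < θ := by positivity
  have hθ1 : θ ≤ 1 := by
    rw [hθ, div_le_one (by positivity)]
    exact one_le_pow₀ (by linarith)
  set ε : ℝ := 1 / (6 * l) with hε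
  have hε0 : 0 < ε := by positivity
  have hε1 : ε ≤ 1 / 12 := by
    rw [hε, div_le_div_iff₀ (by positivity) (by norm_num)]
    linarith
  have hsqrt : Real.sqrt (Real.exp 1) ≤ 2 := by
    rw [Real.sqrt_le_left (by norm_num)]
    linarith [Real.exp_one_lt_d9]
  have hsqrt1 : 1 ≤ Real.sqrt (Real.exp 1) :=
    Real.one_le_sqrt.2 (Real.one_le_exp zero_le_one)
  have hpow : (1 + ε) ^ (3 * l) ≤ Real.sqrt (Real.exp 1) := one_add_pow_le (by omega)
  have hdecay : (n : ℝ) * (3 / 4) ^ (3 * l) ≤ 1 := by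
    calc (n : ℝ) * (3 / 4) ^ (3 * l) = n * ((3 / 4) ^ 3) ^ l := by rw [pow_mul]
      _ ≤ 2 ^ l * (1 / 2) ^ l := by
          gcongr
          norm_num
      _ = 1 := by rw [← mul_pow]; norm_num
  have hshort : ((Finset.univ : Finset V).card : ℝ) ^ 2 * (2 * θ) ≤
      ε / (t * (4 * l : ℕ)) / 2 := by
    rw [Finset.card_univ, ← hn', hε, hθ]
    have hlnR : (l : ℝ) ≤ n := by exact_mod_cast hln
    have htlR : (t : ℝ) ≤ 2 * n := by exact_mod_cast htl
    have ht0 : (0 : ℝ) < t := by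
      rw [ht]
      positivity
    have h1 : (l : ℝ) ^ 2 * t ≤ n ^ 2 * (2 * n) := by gcongr
    have h2 : (1024 : ℝ) ≤ n ^ 5 := by
      calc (1024 : ℝ) = 4 ^ 5 := by norm_num
        _ ≤ n ^ 5 := by gcongr
    have h3 : 1024 * (n : ℝ) ^ 3 ≤ n ^ 5 * n ^ 3 := by gcongr
    have h4 : (n : ℝ) ^ 2 * (2 * (1 / n ^ 10)) = 2 / n ^ 8 := by
      field_simp
    have h5 : 1 / (6 * (l : ℝ)) / (t * (4 * l : ℕ)) / 2 = 1 / (48 * (l ^ 2 * t)) := by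
      push_cast
      field_simp
      norm_num
    rw [h4, h5, div_le_div_iff₀ (by positivity) (by positivity)]
    have h6 : (n : ℝ) ^ 8 = n ^ 5 * n ^ 3 := by ring
    have h7 : (0 : ℝ) ≤ n ^ 3 := by positivity
    nlinarith
  have hNm : 1 + Real.log (3 * (n : ℝ) ^ 2) ≤ (4 * l : ℕ) := by
    rw [hlogM]
    push_cast
    linarith
  have htpow : 4 * l < 2 ^ t := by
    have := Nat.le_pow_clog one_lt_two l
    rw [ht, pow_add]
    omega
  obtain ⟨p, τ, σ, hT, hdepth, hpath, hstretch⟩ :=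
    N.exists_tree (U := Finset.univ) (K := 3 * l) hθ0 hθ1 hε0 hε1 (by omega : 1 ≤ t) hM1 hc hNm
      htpow hshort (hpow.trans hsqrt) (by rwa [Finset.card_univ]) Finset.univ
      (Finset.Subset.refl _) x D ρ hD (fun v _ => hDρ v) (by simpa using hmax)
  refine ⟨p, τ, σ, hT, fun v => ?_, fun u v => hpath u (Finset.mem_univ _) v (Finset.mem_univ _),
    hstretch.trans ?_⟩
  · have h1 := hdepth (3 * l) (ρ * (3 / 4) ^ (3 * l)) le_rfl v (Finset.mem_univ _)
    rw [Finset.card_univ, ← hn'] at h1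
    have h2 := mul_le_mul_of_nonneg_right hpow hρ.le
    have h3 := mul_le_mul_of_nonneg_right hdecay hρ.le
    have h4 : 0 ≤ ρ * (3 / 4) ^ (3 * l) := by positivity
    have h5 := mul_le_mul_of_nonneg_right hsqrt1 hρ.le
    linarith [hDρ v]
  · set A : ℝ := 1152 * t / ε with hA
    have hlog2θ : Real.log (2 / θ) ≤ 11 * Real.log n := by
      rw [hθ, div_div_eq_mul_div, div_one, Real.log_mul (by norm_num) (by positivity),
        Real.log_pow]
      push_cast
      linarith
    have hA0 : 0 ≤ A := by positivity
    have hbound := N.pot_le (A := A) (B := 95 * Real.log n) hθ0 hθ1 hA0 hM1 hρ hc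
      (by rw [hlogM]; linarith)
    refine hbound.trans ?_
    set M : ℝ := 3 * (n : ℝ) ^ 2 with hM
    have hlogM' : Real.log M ≤ 5 * Real.log n := by rw [hlogM]; linarith
    have htl : (t : ℝ) ≤ 30 * Real.log (Real.log n) := by
      have := clog_clog_le hn
      rw [ht]
      push_cast
      linarith
    have hAle : A ≤ 622080 * (Real.log n * Real.log (Real.log n)) := by
      have h1 : A = 6912 * (t * l) := by
        rw [hA, hε]
        field_simp
        ring
      have h2 : (t : ℝ) * l ≤ 30 * Real.log (Real.log n) * (3 * Real.log n) := by
        gcongr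
        exact clog_le_three_mul_log hn
      rw [h1]
      linarith
    have hA4 : 4 ≤ 622080 * (Real.log n * Real.log (Real.log n)) * Real.log n := by
      have h1 : 1 / 3 ≤ Real.log n * Real.log (Real.log n) := by nlinarith
      nlinarith
    have hM0 : 0 ≤ M := zero_le_one.trans hM1
    have hlogn0 : 0 ≤ Real.log n := by linarith
    clear_value M A
    have hfinal := mul_add_mul_le hA0 hM0 hlogn0 hlogM' hAle hA4
    rw [hM] at hfinal ⊢
    linarith

end Net

section graph

variable {V E : Type}

theorem len_pos (G : WGraph V E) (e : E) : 0 < G.len e :=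
  one_div_pos.2 (G.w_pos e)

theorem walk_length_nonneg {G : WGraph V E} {u v : V} (p : G.Walk u v) : 0 ≤ p.length := by
  induction p with
  | nil => exact le_rfl
  | cons _ _ _ e _ _ ih => exact add_nonneg (len_pos G e).le ih

theorem dist_le_length {G : WGraph V E} {u v : V} (p : G.Walk u v) : G.dist u v ≤ p.length :=
  csInf_le ⟨0, by rintro _ ⟨q, rfl⟩; exact walk_length_nonneg q⟩ ⟨p, rfl⟩

theorem dist_nonneg (G : WGraph V E) (u v : V) : 0 ≤ G.dist u v :=
  Real.sInf_nonneg (by rintro _ ⟨q, rfl⟩; exact walk_length_nonneg q)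

theorem dist_self (G : WGraph V E) (u : V) : G.dist u u = 0 :=
  le_antisymm (dist_le_length (.nil u)) (dist_nonneg G u u)

theorem dist_le_radius [Finite V] (G : WGraph V E) (x v : V) : G.dist x v ≤ G.radius x := by
  obtain ⟨r, hr⟩ := Set.finite_range (G.dist x) |>.bddAbove
  exact le_csInf ⟨r, fun v => hr ⟨v, rfl⟩⟩ fun s hs => hs v

theorem radius_le {G : WGraph V E} {x : V} {r : ℝ} (h : ∀ v, G.dist x v ≤ r) : G.radius x ≤ r :=
  csInf_le ⟨0, fun _ hs => (dist_nonneg G x x).trans (hs x)⟩ h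

theorem exists_walk_of_path {G : WGraph V E} {A : V → V → Prop} {d : V → V → ℝ}
    (hA : ∀ u v, A u v → ∃ e, (G.ends e = (u, v) ∨ G.ends e = (v, u)) ∧ G.len e = d u v)
    {x y : V} {l : ℝ} (h : Path A d x y l) : ∃ p : G.Walk y x, p.length = l := by
  induction h with
  | nil => exact ⟨.nil x, rfl⟩
  | @snoc u v l _ huv ih =>
    obtain ⟨p, hp⟩ := ih
    obtain ⟨e, he, hl⟩ := hA u v huv
    exact ⟨.cons v u x e he.symm p, by rw [WGraph.Walk.length, hp, hl, add_comm]⟩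

/-- The least length of an edge in `s`, or `1` if there is none. -/
noncomputable def minLen (G : WGraph V E) (s : Finset E) : ℝ :=
  if h : s.Nonempty then s.inf' h G.len else 1

theorem minLen_pos (G : WGraph V E) (s : Finset E) : 0 < minLen G s := by
  unfold minLen
  split_ifs with h
  · exact (Finset.lt_inf'_iff h).2 fun e _ => len_pos G e
  · exact one_pos

theorem minLen_le {G : WGraph V E} {s : Finset E} {e : E} (he : e ∈ s) :
    minLen G s ≤ G.len e := by
  rw [minLen, dif_pos ⟨e, he⟩]
  exact Finset.inf'_le _ he

theorem exists_len_eq_minLen {G : WGraph V E} {s : Finset E} (hs : s.Nonempty) :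
    ∃ e ∈ s, G.len e = minLen G s := by
  rw [minLen, dif_pos hs]
  obtain ⟨e, he, h⟩ := s.exists_mem_eq_inf' hs G.len
  exact ⟨e, he, h.symm⟩

variable [Fintype E]

/-- The edges oriented from `u` to `v`. -/
noncomputable def arcs (G : WGraph V E) (u v : V) : Finset E :=
  Finset.univ.filter fun e => G.ends e = (u, v)

theorem mem_arcs {G : WGraph V E} {u v : V} {e : E} : e ∈ arcs G u v ↔ G.ends e = (u, v) := by
  simp [arcs]

theorem mem_arcs_union {G : WGraph V E} {u v : V} {e : E} :
    e ∈ arcs G u v ∪ arcs G v u ↔ G.ends e = (u, v) ∨ G.ends e = (v, u) := by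
  rw [Finset.mem_union, mem_arcs, mem_arcs]

variable [Fintype V]

/-- The network of a weighted multigraph: parallel edges are merged into the shortest one, with
multiplicities rescaled to total order `n²`. -/
noncomputable def toNet (G : WGraph V E) : Net V where
  c u v := if u ≠ v ∧ (arcs G u v ∪ arcs G v u).Nonempty then
    1 + (Fintype.card V : ℝ) ^ 2 / Fintype.card E * ((arcs G u v).card + (arcs G v u).card) else 0
  d u v := minLen G (arcs G u v ∪ arcs G v u)
  c_symm u v := by
    rw [Finset.union_comm, add_comm ((arcs G u v).card : ℝ)]
    exact if_congr (and_congr_left' ne_comm) rfl rfl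
  d_symm u v := by rw [Finset.union_comm]
  d_pos u v := minLen_pos G _
  c_cases u v := by
    split_ifs
    · exact .inr (le_add_of_nonneg_right (by positivity))
    · exact .inl rfl

theorem toNet_c_ne_zero {G : WGraph V E} {u v : V} {e : E} (huv : u ≠ v)
    (he : G.ends e = (u, v) ∨ G.ends e = (v, u)) : (toNet G).c u v ≠ 0 := by
  have : (0 : ℝ) < (toNet G).c u v := by
    simp only [toNet]
    rw [if_pos ⟨huv, e, mem_arcs_union.2 he⟩]
    positivity
  exact this.ne'

theorem toNet_d_le {G : WGraph V E} {u v : V} {e : E}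
    (he : G.ends e = (u, v) ∨ G.ends e = (v, u)) : (toNet G).d u v ≤ G.len e :=
  minLen_le (mem_arcs_union.2 he)

theorem exists_edge_of_toNet {G : WGraph V E} {u v : V} (h : (toNet G).c u v ≠ 0) :
    ∃ e, (G.ends e = (u, v) ∨ G.ends e = (v, u)) ∧ G.len e = (toNet G).d u v := by
  have h' : u ≠ v ∧ (arcs G u v ∪ arcs G v u).Nonempty := by
    by_contra hcon
    exact h (if_neg hcon)
  obtain ⟨e, he, hl⟩ := exists_len_eq_minLen (G := G) h'.2
  exact ⟨e, mem_arcs_union.1 he, hl⟩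

theorem sum_arcs (G : WGraph V E) (f : E → ℝ) :
    ∑ u, ∑ v, ∑ e ∈ arcs G u v, f e = ∑ e, f e := by
  rw [← Fintype.sum_prod_type' fun u v => ∑ e ∈ arcs G u v, f e]
  exact Finset.sum_fiberwise Finset.univ G.ends f

theorem sum_card_arcs (G : WGraph V E) :
    ∑ u, ∑ v, ((arcs G u v).card : ℝ) = Fintype.card E := by
  have := sum_arcs G fun _ => 1
  simpa using this

theorem sum_toNet_c_le [Nonempty E] (G : WGraph V E) :
    ∑ u, ∑ v, (toNet G).c u v ≤ 3 * (Fintype.card V : ℝ) ^ 2 := by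
  have hm : (Fintype.card E : ℝ) ≠ 0 := by exact_mod_cast Fintype.card_ne_zero
  have hswap : ∑ u, ∑ v, ((arcs G v u).card : ℝ) = Fintype.card E := by
    rw [Finset.sum_comm, sum_card_arcs]
  calc ∑ u, ∑ v, (toNet G).c u v ≤ ∑ u : V, ∑ v : V, (1 +
        (Fintype.card V : ℝ) ^ 2 / Fintype.card E * ((arcs G u v).card + (arcs G v u).card)) := by
        refine Finset.sum_le_sum fun u _ => Finset.sum_le_sum fun v _ => ?_
        simp only [toNet]
        split_ifs
        · exact le_rfl
        · positivity
    _ = (Fintype.card V : ℝ) ^ 2 +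
          (Fintype.card V : ℝ) ^ 2 / Fintype.card E * (Fintype.card E + Fintype.card E) := by
        simp only [Finset.sum_add_distrib, ← Finset.mul_sum, sum_card_arcs, hswap]
        simp [sq]
    _ = _ := by
        field_simp
        norm_num

theorem card_arcs_le_toNet_c [Nonempty E] (G : WGraph V E) {u v : V} (huv : u ≠ v) :
    (Fintype.card V : ℝ) ^ 2 / Fintype.card E * (arcs G u v).card ≤ (toNet G).c u v := by
  by_cases h : (arcs G u v).Nonempty
  · simp only [toNet]
    rw [if_pos ⟨huv, h.mono Finset.subset_union_left⟩, mul_add]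
    have : 0 ≤ (Fintype.card V : ℝ) ^ 2 / Fintype.card E * (arcs G v u).card := by positivity
    linarith
  · rw [Finset.not_nonempty_iff_eq_empty.1 h]
    simpa using (toNet G).c_nonneg u v

/-- The distance function of a connected weighted graph. -/
theorem exists_isDist_univ {G : WGraph V E} (hG : G.Connected) (x : V) :
    ∃ D, (toNet G).IsDist Finset.univ x D ∧ ∀ v, D v ≤ G.radius x := by
  obtain ⟨Z, -, D, hD, hcl⟩ := (toNet G).exists_isDist (Finset.mem_univ x)
  have hwalk : ∀ {u v : V} (p : G.Walk u v), u ∈ Z → v ∈ Z ∧ D v ≤ D u + p.length := by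
    intro u v p
    induction p with
    | nil v => exact fun h => ⟨h, by simp [WGraph.Walk.length]⟩
    | cons u v w e he p ih =>
      intro hu
      have hv : v ∈ Z ∧ D v ≤ D u + G.len e := by
        by_cases huv : u = v
        · subst huv
          exact ⟨hu, by linarith [len_pos G e]⟩
        · have hc := toNet_c_ne_zero huv he
          have hv := hcl u hu v (Finset.mem_univ v) hc
          exact ⟨hv, by linarith [hD.lip u hu v hv hc, toNet_d_le he]⟩
      obtain ⟨h1, h2⟩ := ih hv.1
      exact ⟨h1, by rw [WGraph.Walk.length]; linarith⟩
  have hZ : Z = Finset.univ := Finset.eq_univ_of_forall fun v =>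
    (hwalk (hG x v).some hD.mem).1
  refine ⟨D, hZ ▸ hD, fun v => le_trans ?_ (dist_le_radius G x v)⟩
  refine le_csInf ⟨_, (hG x v).some, rfl⟩ ?_
  rintro _ ⟨p, rfl⟩
  simpa [hD.root] using (hwalk p hD.mem).2

/-- A rooted spanning tree of the network lifts to a spanning tree of the graph. -/
theorem exists_spanningTree [Nonempty E] {G : WGraph V E} {x : V} {p : V → V} {τ : V → ℝ}
    (hT : (toNet G).IsTree Finset.univ x p τ) :
    ∃ T : Finset E, G.IsSpanningTree T ∧ ∀ u v l,
      Path (treeAdj p Finset.univ x) (toNet G).d u v l →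
        (G.restrictE (T : Set E)).dist u v ≤ l := by
  have hedge : ∀ v, v ≠ x → ∃ e, (G.ends e = (v, p v) ∨ G.ends e = (p v, v)) ∧
      G.len e = (toNet G).d v (p v) := fun v hv =>
    exists_edge_of_toNet (hT.step v (Finset.mem_univ v) hv).2.1
  choose! f hf hlen using hedge
  set T : Finset E := (Finset.univ.erase x).image f with hTdef
  have hmemT : ∀ v, v ≠ x → f v ∈ (T : Set E) := fun v hv =>
    Finset.mem_coe.2 (Finset.mem_image_of_mem f (Finset.mem_erase.2 ⟨hv, Finset.mem_univ v⟩))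
  have hA : ∀ u v, treeAdj p Finset.univ x u v → ∃ e,
      ((G.restrictE (T : Set E)).ends e = (u, v) ∨ (G.restrictE (T : Set E)).ends e = (v, u)) ∧
        (G.restrictE (T : Set E)).len e = (toNet G).d u v := by
    rintro u v (⟨-, h, rfl⟩ | ⟨-, h, rfl⟩)
    · exact ⟨⟨f u, hmemT u h⟩, hf u h, hlen u h⟩
    · exact ⟨⟨f v, hmemT v h⟩, (hf v h).symm, (hlen v h).trans ((toNet G).d_symm _ _)⟩
  have hwalk : ∀ u v l, Path (treeAdj p Finset.univ x) (toNet G).d u v l →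
      ∃ q : (G.restrictE (T : Set E)).Walk u v, q.length = l := fun u v l h =>
    exists_walk_of_path hA (h.reverse (fun _ _ => treeAdj_symm) (toNet G).d_symm)
  refine ⟨T, ⟨fun u v => ?_, ?_⟩, fun u v l h => ?_⟩
  · obtain ⟨q, -⟩ := hwalk u v _ (hT.path_between (Finset.mem_univ u) (Finset.mem_univ v))
    exact ⟨q⟩
  · have hinj : Set.InjOn f (Finset.univ.erase x : Finset V) := by
      intro u hu v hv huv
      replace hu := Finset.ne_of_mem_erase (Finset.mem_coe.1 hu)
      replace hv := Finset.ne_of_mem_erase (Finset.mem_coe.1 hv)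
      by_contra hne
      have h : u = p v ∧ p u = v := by
        have h1 := hf u hu
        rw [huv] at h1
        rcases h1 with h1 | h1 <;> rcases hf v hv with h2 | h2 <;> rw [h1] at h2 <;>
          obtain ⟨h3, h4⟩ := Prod.mk.inj h2
        exacts [absurd h3 hne, ⟨h3, h4⟩, ⟨h4, h3⟩, absurd h4 hne]
      have h1 := (hT.step u (Finset.mem_univ u) hu).2.2
      have h2 := (hT.step v (Finset.mem_univ v) hv).2.2
      have h3 := (toNet G).d_pos u (p u)
      have h4 := (toNet G).d_pos v (p v)
      rw [h.2] at h1 h3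
      rw [← h.1] at h2 h4
      linarith
    rw [hTdef, Finset.card_image_of_injOn hinj, Finset.card_erase_of_mem (Finset.mem_univ x),
      Finset.card_univ]
    exact Nat.sub_add_cancel (Fintype.card_pos_iff.2 ⟨x⟩)
  · obtain ⟨q, rfl⟩ := hwalk u v l h
    exact dist_le_length q

theorem sum_stretch_le [Nonempty E] [Nonempty V] {G : WGraph V E} {T : Finset E} {σ : V → V → ℝ}
    (hσ0 : ∀ u v, 0 ≤ σ u v) (hσ : ∀ u v, (G.restrictE (T : Set E)).dist u v ≤ σ u v) :
    ∑ e, G.stretch T e ≤ Fintype.card E / (Fintype.card V : ℝ) ^ 2 *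
      ∑ u, ∑ v, (toNet G).c u v * (σ u v / (toNet G).d u v) := by
  have hm : (Fintype.card E : ℝ) ≠ 0 := by exact_mod_cast Fintype.card_ne_zero
  have hn : (Fintype.card V : ℝ) ≠ 0 := by exact_mod_cast Fintype.card_ne_zero
  rw [← sum_arcs G, Finset.mul_sum]
  refine Finset.sum_le_sum fun u _ => ?_
  rw [Finset.mul_sum]
  refine Finset.sum_le_sum fun v _ => ?_
  have hd := (toNet G).d_pos u v
  have hq : 0 ≤ σ u v / (toNet G).d u v := div_nonneg (hσ0 u v) hd.le
  by_cases huv : u = v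
  · subst huv
    refine (Finset.sum_nonpos fun e he => ?_).trans (mul_nonneg (by positivity)
      (mul_nonneg ((toNet G).c_nonneg u u) hq))
    rw [WGraph.stretch, mem_arcs.1 he, dist_self, zero_div]
  · have h1 : ∀ e ∈ arcs G u v, G.stretch T e ≤ σ u v / (toNet G).d u v := fun e he => by
      rw [WGraph.stretch, mem_arcs.1 he]
      exact div_le_div₀ (hσ0 u v) (hσ u v) hd (toNet_d_le (.inl (mem_arcs.1 he)))
    have h2 := Finset.sum_le_sum h1
    rw [Finset.sum_const, nsmul_eq_mul] at h2
    refine h2.trans ?_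
    have h3 := mul_le_mul_of_nonneg_right (card_arcs_le_toNet_c G huv) hq
    have h4 := mul_le_mul_of_nonneg_left h3
      (by positivity : 0 ≤ (Fintype.card E : ℝ) / (Fintype.card V : ℝ) ^ 2)
    refine le_trans (le_of_eq ?_) h4
    field_simp

end graph

end LowStretch

/-- Low-stretch spanning trees for weighted connected graphs:
there is a universal constant `C` such that every weighted connected graph with
`n ≥ 4` vertices and every root `x0` admit a spanning tree `T ⊆ E` with
`radius(T,x0) ≤ 2√e · radius(G,x0)` and
`avestretch(T,E) ≤ C · (log n)² · log log n`. -/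
theorem lowStretchTree_weighted :
    ∃ C : ℝ, ∀ (V E : Type) [Fintype V] [Fintype E] (G : WGraph V E),
      G.Connected → 4 ≤ Fintype.card V → ∀ x0 : V,
        ∃ T : Finset E, G.IsSpanningTree T ∧
          (G.restrictE (T : Set E)).radius x0 ≤
            2 * Real.sqrt (Real.exp 1) * G.radius x0 ∧
          G.avestretch T ≤
            C * Real.log (Fintype.card V) ^ 2 *
              Real.log (Real.log (Fintype.card V)) := by
  refine ⟨188490240, fun V E _ _ G hG hn x0 => ?_⟩
  obtain ⟨D, hD, hDrad⟩ := LowStretch.exists_isDist_univ hG x0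
  obtain ⟨y, hy⟩ := Fintype.exists_ne_of_one_lt_card (by omega : 1 < Fintype.card V) x0
  obtain ⟨z, -, hc, -⟩ := hD.pred y (Finset.mem_univ y) hy
  have : Nonempty E := ⟨(LowStretch.exists_edge_of_toNet hc).choose⟩
  have : Nonempty V := ⟨x0⟩
  obtain ⟨w, hw⟩ := Finite.exists_max D
  have hρ : 0 < D w := (hD.pos (Finset.mem_univ y) hy).trans_le (hw y)
  obtain ⟨p, τ, σ, hT, hτ, hσ, hstretch⟩ := (LowStretch.toNet G).exists_lowStretch hn
    (LowStretch.sum_toNet_c_le G) hD hw ⟨w, rfl⟩ hρ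
  obtain ⟨T, hspan, hdist⟩ := LowStretch.exists_spanningTree hT
  refine ⟨T, hspan, LowStretch.radius_le fun v => ?_, ?_⟩
  · refine (hdist x0 v _ (hT.path v (Finset.mem_univ v))).trans ((hτ v).trans ?_)
    exact mul_le_mul_of_nonneg_left (hDrad w) (by positivity)
  · have hm : (0 : ℝ) < Fintype.card E := by exact_mod_cast Fintype.card_pos
    have hn0 : (0 : ℝ) < Fintype.card V := by exact_mod_cast Fintype.card_pos
    rw [WGraph.avestretch, div_le_iff₀ hm]
    refine (LowStretch.sum_stretch_le (fun u v => (hσ u v).length_nonneg (LowStretch.toNet G).d_pos)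
      fun u v => hdist u v _ (hσ u v)).trans ?_
    refine (mul_le_mul_of_nonneg_left hstretch (by positivity)).trans (le_of_eq ?_)
    field_simp
end

section
/- There is a universal constant C such that for every unweighted connected graph G = (V,E) (all edges of weight 1, hence length 1) with m = |E| ≥ 2 edges and every vertex x0 ∈ V, there exists a spanning tree T of G that is a subgraph of G satisfying radius(T, x0) ≤ √e · radius(G, x0) and avestretch(T, E) ≤ C · (log m)^3. -/
open scoped Classical

namespace WGraph

variable {V E : Type}

/-- The edge `e` joins `u` and `v`. -/
def Joins (G : WGraph V E) (e : E) (u v : V) : Prop :=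
  G.ends e = (u, v) ∨ G.ends e = (v, u)

/-- `G.Reach F n u v`: there is a walk with `n` steps from `u` to `v` using only edges of `F`. -/
inductive Reach (G : WGraph V E) (F : Finset E) : ℕ → V → V → Prop
  | nil (v : V) : Reach G F 0 v v
  | snoc {n : ℕ} {u v w : V} {e : E} (h : Reach G F n u v) (he : e ∈ F)
      (hj : G.Joins e v w) : Reach G F (n + 1) u w

theorem joins_ends (G : WGraph V E) (e : E) : G.Joins e (G.ends e).1 (G.ends e).2 := Or.inl rfl

theorem Joins.symm {G : WGraph V E} {e : E} {u v : V} (h : G.Joins e u v) : G.Joins e v u :=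
  Or.symm h

namespace Reach

variable {G : WGraph V E} {F F' : Finset E} {m n : ℕ} {u v w : V}

theorem mono (hF : F ⊆ F') (h : G.Reach F n u v) : G.Reach F' n u v := by
  induction h with
  | nil v => exact .nil v
  | snoc _ he hj ih => exact .snoc ih (hF he) hj

theorem trans (h : G.Reach F m u v) (h' : G.Reach F n v w) : G.Reach F (m + n) u w := by
  induction h' with
  | nil v => exact h
  | snoc _ he hj ih => exact .snoc (ih h) he hj

theorem single {e : E} (he : e ∈ F) (hj : G.Joins e u v) : G.Reach F 1 u v :=
  .snoc (.nil u) he hj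

theorem symm (h : G.Reach F n u v) : G.Reach F n v u := by
  induction h with
  | nil v => exact .nil v
  | snoc _ he hj ih =>
    rw [Nat.add_comm]
    exact (single he hj.symm).trans ih

end Reach

/-- Hop distance between the endpoints of `e`, using only edges of `F`. -/
noncomputable def hopDist (G : WGraph V E) (F : Finset E) (e : E) : ℕ :=
  sInf {n | G.Reach F n (G.ends e).1 (G.ends e).2}

theorem hopDist_le {G : WGraph V E} {F : Finset E} {e : E} {n : ℕ}
    (h : G.Reach F n (G.ends e).1 (G.ends e).2) : G.hopDist F e ≤ n :=
  Nat.sInf_le h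

theorem hopDist_mono {G : WGraph V E} {F F' : Finset E} {e : E} {n : ℕ} (hF : F ⊆ F')
    (h : G.Reach F n (G.ends e).1 (G.ends e).2) : G.hopDist F' e ≤ G.hopDist F e :=
  hopDist_le ((Nat.sInf_mem (s := {n | G.Reach F n (G.ends e).1 (G.ends e).2}) ⟨n, h⟩).mono hF)

section Counting

variable [Fintype E] (G : WGraph V E)

/-- The edges with both endpoints in `A`. -/
noncomputable def edgesWithin (A : Finset V) : Finset E :=
  Finset.univ.filter fun e => (G.ends e).1 ∈ A ∧ (G.ends e).2 ∈ A

/-- The edges with one endpoint in `A` and the other in `B`. -/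
noncomputable def edgesAcross (A B : Finset V) : Finset E :=
  Finset.univ.filter fun e =>
    ((G.ends e).1 ∈ A ∧ (G.ends e).2 ∈ B) ∨ ((G.ends e).1 ∈ B ∧ (G.ends e).2 ∈ A)

variable {G}

theorem mem_edgesWithin {A : Finset V} {e : E} :
    e ∈ G.edgesWithin A ↔ (G.ends e).1 ∈ A ∧ (G.ends e).2 ∈ A := by
  simp [edgesWithin]

theorem mem_edgesAcross {A B : Finset V} {e : E} :
    e ∈ G.edgesAcross A B ↔
      ((G.ends e).1 ∈ A ∧ (G.ends e).2 ∈ B) ∨ ((G.ends e).1 ∈ B ∧ (G.ends e).2 ∈ A) := by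
  simp [edgesAcross]

theorem Joins.mem_edgesWithin_iff {A : Finset V} {e : E} {u v : V} (h : G.Joins e u v) :
    e ∈ G.edgesWithin A ↔ u ∈ A ∧ v ∈ A := by
  rw [mem_edgesWithin]
  rcases h with h | h <;> simp [h, and_comm]

theorem Joins.mem_edgesAcross_iff {A B : Finset V} {e : E} {u v : V} (h : G.Joins e u v) :
    e ∈ G.edgesAcross A B ↔ (u ∈ A ∧ v ∈ B) ∨ (u ∈ B ∧ v ∈ A) := by
  rw [mem_edgesAcross]
  rcases h with h | h <;> simp [h]
  tauto

theorem edgesWithin_mono {A B : Finset V} (h : A ⊆ B) : G.edgesWithin A ⊆ G.edgesWithin B := by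
  intro e he
  rw [mem_edgesWithin] at he ⊢
  exact ⟨h he.1, h he.2⟩

theorem edgesWithin_union (A B : Finset V) :
    G.edgesWithin (A ∪ B) = G.edgesWithin A ∪ G.edgesWithin B ∪ G.edgesAcross A B := by
  ext e
  simp only [Finset.mem_union, mem_edgesWithin, mem_edgesAcross]
  tauto

theorem disjoint_edgesWithin {A B : Finset V} (h : Disjoint A B) :
    Disjoint (G.edgesWithin A) (G.edgesWithin B) := by
  rw [Finset.disjoint_left] at h ⊢
  intro e he he'
  rw [mem_edgesWithin] at he he'
  exact h he.1 he'.1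

theorem disjoint_edgesWithin_edgesAcross {A B : Finset V} (h : Disjoint A B) :
    Disjoint (G.edgesWithin A ∪ G.edgesWithin B) (G.edgesAcross A B) := by
  rw [Finset.disjoint_left] at h ⊢
  intro e he he'
  have h1 := @h (G.ends e).1
  have h2 := @h (G.ends e).2
  simp only [Finset.mem_union, mem_edgesWithin, mem_edgesAcross] at he he'
  tauto

theorem card_edgesWithin_union {A B : Finset V} (h : Disjoint A B) :
    (G.edgesWithin (A ∪ B)).card =
      (G.edgesWithin A).card + (G.edgesWithin B).card + (G.edgesAcross A B).card := by
  rw [edgesWithin_union, Finset.card_union_of_disjoint (disjoint_edgesWithin_edgesAcross h),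
    Finset.card_union_of_disjoint (disjoint_edgesWithin h)]

theorem card_edgesAcross_union_left_le (A B C : Finset V) :
    (G.edgesAcross (A ∪ B) C).card ≤ (G.edgesAcross A C).card + (G.edgesAcross B C).card := by
  refine le_trans (Finset.card_le_card ?_) (Finset.card_union_le _ _)
  intro e he
  simp only [Finset.mem_union, mem_edgesAcross] at he ⊢
  tauto

theorem card_edgesAcross_add_le {A B C : Finset V} (hAB : Disjoint A B) (hAC : Disjoint A C)
    (hBC : Disjoint B C) :
    (G.edgesAcross A B).card + (G.edgesAcross A C).card ≤ (G.edgesAcross A (B ∪ C)).card := by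
  rw [← Finset.card_union_of_disjoint]
  · refine Finset.card_le_card ?_
    intro e he
    simp only [Finset.mem_union, mem_edgesAcross] at he ⊢
    tauto
  · rw [Finset.disjoint_left] at hAB hAC hBC ⊢
    intro e he he'
    have h1 := @hAB (G.ends e).1
    have h2 := @hAB (G.ends e).2
    have h3 := @hAC (G.ends e).1
    have h4 := @hAC (G.ends e).2
    have h5 := @hBC (G.ends e).1
    have h6 := @hBC (G.ends e).2
    simp only [mem_edgesAcross] at he he'
    tauto

end Counting

/-- `F` is the edge set of a tree on the vertex set `A`, with root `x`, height at most `h` and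
total stretch at most `s` over the edges within `A`. -/
structure IsTreeOn [Fintype E] (G : WGraph V E) (A : Finset V) (x : V) (F : Finset E)
    (h s : ℝ) : Prop where
  subset : F ⊆ G.edgesWithin A
  card : F.card + 1 = A.card
  height : ∀ v ∈ A, ∃ n : ℕ, (n : ℝ) ≤ h ∧ G.Reach F n x v
  stretch : ∑ e ∈ G.edgesWithin A, (G.hopDist F e : ℝ) ≤ s

section Trees

variable [Fintype E] {G : WGraph V E} {A B C : Finset V} {x y : V} {F F' : Finset E}
  {h h' s s' : ℝ}

theorem IsTreeOn.mono (hF : G.IsTreeOn A x F h s) (hh : h ≤ h') (hs : s ≤ s') :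
    G.IsTreeOn A x F h' s' where
  subset := hF.subset
  card := hF.card
  height v hv := by
    obtain ⟨n, hn, hr⟩ := hF.height v hv
    exact ⟨n, hn.trans hh, hr⟩
  stretch := hF.stretch.trans hs

omit [Fintype E] in
theorem exists_reach_of_height (hF : ∀ v ∈ A, ∃ n : ℕ, (n : ℝ) ≤ h ∧ G.Reach F n x v)
    {u v : V} (hu : u ∈ A) (hv : v ∈ A) : ∃ n : ℕ, (n : ℝ) ≤ 2 * h ∧ G.Reach F n u v := by
  obtain ⟨n, hn, hr⟩ := hF u hu
  obtain ⟨n', hn', hr'⟩ := hF v hv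
  exact ⟨n + n', by push_cast; linarith, hr.symm.trans hr'⟩

theorem hopDist_le_of_height (hF : ∀ v ∈ A, ∃ n : ℕ, (n : ℝ) ≤ h ∧ G.Reach F n x v)
    {e : E} (he : e ∈ G.edgesWithin A) : (G.hopDist F e : ℝ) ≤ 2 * h := by
  rw [mem_edgesWithin] at he
  obtain ⟨n, hn, hr⟩ := exists_reach_of_height hF he.1 he.2
  exact le_trans (by exact_mod_cast hopDist_le hr) hn

theorem IsTreeOn.sum_hopDist_le (hF : G.IsTreeOn A x F h s) (hFF' : F ⊆ F') :
    ∑ e ∈ G.edgesWithin A, (G.hopDist F' e : ℝ) ≤ s := by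
  refine le_trans (Finset.sum_le_sum fun e he => ?_) hF.stretch
  rw [mem_edgesWithin] at he
  obtain ⟨n, -, hr⟩ := exists_reach_of_height hF.height he.1 he.2
  exact_mod_cast hopDist_mono hFF' hr

/-- Gluing a tree on `C` with root `y` to a tree on `A` along an edge from `y` to `z ∈ A`. -/
theorem IsTreeOn.glue {z : V} {b : E} {n : ℕ} {H : ℝ} (hF : G.IsTreeOn A x F H s)
    (hF' : G.IsTreeOn C y F' h' s') (hAC : Disjoint A C) (hy : y ∈ C) (hz : z ∈ A)
    (hb : G.Joins b z y) (hn : G.Reach F n x z) (hH : n + 1 + h' ≤ H) :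
    G.IsTreeOn (A ∪ C) x (insert b (F ∪ F')) H
      (s + s' + 2 * H * (G.edgesAcross A C).card) := by
  have hFsub : F ⊆ insert b (F ∪ F') := fun e he => by simp [he]
  have hF'sub : F' ⊆ insert b (F ∪ F') := fun e he => by simp [he]
  have hyA : y ∉ A := fun hyA => Finset.disjoint_left.1 hAC hyA hy
  have hzC : z ∉ C := Finset.disjoint_left.1 hAC hz
  have hheight : ∀ v ∈ A ∪ C, ∃ n : ℕ, (n : ℝ) ≤ H ∧ G.Reach (insert b (F ∪ F')) n x v := by
    intro v hv
    rcases Finset.mem_union.1 hv with hv | hv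
    · obtain ⟨k, hk, hr⟩ := hF.height v hv
      exact ⟨k, hk, hr.mono hFsub⟩
    · obtain ⟨k, hk, hr⟩ := hF'.height v hv
      refine ⟨n + 1 + k, by push_cast; linarith, ?_⟩
      exact (Reach.snoc (hn.mono hFsub) (Finset.mem_insert_self _ _) hb).trans (hr.mono hF'sub)
  refine ⟨?_, ?_, hheight, ?_⟩
  · intro e he
    rcases Finset.mem_insert.1 he with rfl | he
    · rw [hb.mem_edgesWithin_iff]
      simp [hz, hy]
    · rcases Finset.mem_union.1 he with he | he
      · exact edgesWithin_mono Finset.subset_union_left (hF.subset he)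
      · exact edgesWithin_mono Finset.subset_union_right (hF'.subset he)
  · have hbF : b ∉ F ∪ F' := by
      intro hbF
      rcases Finset.mem_union.1 hbF with hbF | hbF
      · exact hyA (hb.mem_edgesWithin_iff.1 (hF.subset hbF)).2
      · exact hzC (hb.mem_edgesWithin_iff.1 (hF'.subset hbF)).1
    have hdisj : Disjoint F F' :=
      (disjoint_edgesWithin hAC).mono hF.subset hF'.subset
    rw [Finset.card_insert_of_notMem hbF, Finset.card_union_of_disjoint hdisj,
      Finset.card_union_of_disjoint hAC, ← hF.card, ← hF'.card]
    ring
  · have hcross : ∑ e ∈ G.edgesAcross A C, (G.hopDist (insert b (F ∪ F')) e : ℝ) ≤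
        2 * H * (G.edgesAcross A C).card := by
      rw [mul_comm, ← nsmul_eq_mul]
      refine Finset.sum_le_card_nsmul _ _ _ fun e he => hopDist_le_of_height hheight ?_
      rw [edgesWithin_union]
      exact Finset.mem_union_right _ he
    rw [edgesWithin_union, Finset.sum_union (disjoint_edgesWithin_edgesAcross hAC),
      Finset.sum_union (disjoint_edgesWithin hAC)]
    exact add_le_add (add_le_add (hF.sum_hopDist_le hFsub) (hF'.sum_hopDist_le hF'sub)) hcross

end Trees

/-- Breadth-first levels of the subgraph induced on `A`, from the root `x`. -/
structure IsLevel [Fintype E] (G : WGraph V E) (A : Finset V) (x : V) (d : V → ℕ) : Prop where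
  lipschitz : ∀ u ∈ A, ∀ v ∈ A, ∀ e, G.Joins e u v → d v ≤ d u + 1
  pred : ∀ v ∈ A, v ≠ x → ∃ u ∈ A, ∃ e, G.Joins e u v ∧ d v = d u + 1

section Levels

variable [Fintype E] {G : WGraph V E} {A : Finset V} {x : V} {d : V → ℕ} {ρ : ℕ}

theorem Reach.mem_of_edgesWithin {n : ℕ} {v : V} (hx : x ∈ A)
    (h : G.Reach (G.edgesWithin A) n x v) : v ∈ A := by
  cases h with
  | nil => exact hx
  | snoc _ he hj => exact (hj.mem_edgesWithin_iff.1 he).2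

theorem exists_isLevel
    (hA : ∀ v ∈ A, ∃ n ≤ ρ, G.Reach (G.edgesWithin A) n x v) :
    ∃ d : V → ℕ, G.IsLevel A x d ∧ (∀ v ∈ A, d v ≤ ρ) ∧
      ∀ v n, G.Reach (G.edgesWithin A) n x v → d v ≤ n := by
  have hmem : ∀ v ∈ A, G.Reach (G.edgesWithin A)
      (sInf {n | G.Reach (G.edgesWithin A) n x v}) x v := fun v hv => by
    obtain ⟨n, -, hn⟩ := hA v hv
    exact Nat.sInf_mem (s := {n | G.Reach (G.edgesWithin A) n x v}) ⟨n, hn⟩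
  refine ⟨fun v => sInf {n | G.Reach (G.edgesWithin A) n x v}, ⟨?_, ?_⟩, ?_, ?_⟩
  · intro u hu v hv e he
    exact Nat.sInf_le (Reach.snoc (hmem u hu) (he.mem_edgesWithin_iff.2 ⟨hu, hv⟩) he)
  · intro v hv hvx
    have h := hmem v hv
    generalize hk : sInf {n | G.Reach (G.edgesWithin A) n x v} = k at h
    cases h with
    | nil => exact absurd rfl hvx
    | @snoc n _ u _ e h he hj =>
      refine ⟨u, (hj.mem_edgesWithin_iff.1 he).1, e, hj, ?_⟩
      have h1 : sInf {n | G.Reach (G.edgesWithin A) n x u} ≤ n := Nat.sInf_le h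
      have h2 : sInf {n | G.Reach (G.edgesWithin A) n x v} ≤
          sInf {n | G.Reach (G.edgesWithin A) n x u} + 1 :=
        Nat.sInf_le (Reach.snoc (hmem u (hj.mem_edgesWithin_iff.1 he).1) he hj)
      omega
  · intro v hv
    obtain ⟨n, hn, hr⟩ := hA v hv
    exact (Nat.sInf_le hr).trans hn
  · intro v n hn
    exact Nat.sInf_le hn

theorem IsLevel.reach (hd : G.IsLevel A x d) {r : ℕ} (F : Finset E)
    (hF : ∀ v ∈ A, v ≠ x → d v ≤ r → ∃ u ∈ A, ∃ e ∈ F, G.Joins e u v ∧ d v = d u + 1) :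
    ∀ v ∈ A, d v ≤ r → ∃ n ≤ d v, G.Reach F n x v := by
  intro v hv hvr
  induction hk : d v using Nat.strong_induction_on generalizing v with
  | _ k ih =>
    by_cases hvx : v = x
    · subst hvx
      exact ⟨0, Nat.zero_le _, .nil v⟩
    · obtain ⟨u, hu, e, he, hj, hdu⟩ := hF v hv hvx hvr
      obtain ⟨n, hn, hr⟩ := ih (d u) (by omega) u hu (by omega) rfl
      exact ⟨n + 1, by omega, hr.snoc he hj⟩

theorem exists_breadthFirst_tree [Nonempty E] (hx : x ∈ A)
    (hA : ∀ v ∈ A, ∃ n ≤ ρ, G.Reach (G.edgesWithin A) n x v) :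
    ∃ F, G.IsTreeOn A x F ρ (2 * ρ * (G.edgesWithin A).card) := by
  obtain ⟨d, hd, hdρ, -⟩ := exists_isLevel hA
  choose! p hpA b hb hp using hd.pred
  have hheight : ∀ v ∈ A, ∃ n : ℕ, (n : ℝ) ≤ ρ ∧ G.Reach ((A.erase x).image b) n x v := by
    intro v hv
    obtain ⟨n, hn, hr⟩ := hd.reach (r := ρ) ((A.erase x).image b) (fun v hv hvx _ =>
      ⟨p v, hpA v hv hvx, b v, Finset.mem_image_of_mem _ (by simp [hv, hvx]), hb v hv hvx,
        hp v hv hvx⟩) v hv (hdρ v hv)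
    exact ⟨n, by exact_mod_cast hn.trans (hdρ v hv), hr⟩
  refine ⟨(A.erase x).image b, ?_, ?_, hheight, ?_⟩
  · intro e he
    obtain ⟨v, hv, rfl⟩ := Finset.mem_image.1 he
    obtain ⟨hvx, hv⟩ := Finset.mem_erase.1 hv
    exact (hb v hv hvx).mem_edgesWithin_iff.2 ⟨hpA v hv hvx, hv⟩
  · rw [Finset.card_image_of_injOn, Finset.card_erase_add_one hx]
    intro v hv w hw hvw
    obtain ⟨hvx, hv⟩ := Finset.mem_erase.1 (Finset.mem_coe.1 hv)
    obtain ⟨hwx, hw⟩ := Finset.mem_erase.1 (Finset.mem_coe.1 hw)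
    have h1 := hb v hv hvx
    have h2 := hb w hw hwx
    have h3 := hp v hv hvx
    have h4 := hp w hw hwx
    rw [← hvw] at h2
    have key : (p v = p w ∧ v = w) ∨ (p v = w ∧ v = p w) := by
      rcases h1 with h1 | h1 <;> rcases h2 with h2 | h2 <;>
        rw [h1] at h2 <;> simp only [Prod.mk.injEq] at h2 <;> tauto
    rcases key with ⟨-, h⟩ | ⟨h, h'⟩
    · exact h
    · rw [h] at h3
      rw [← h'] at h4
      omega
  · rw [mul_comm, ← nsmul_eq_mul]
    exact Finset.sum_le_card_nsmul _ _ _ fun e he => hopDist_le_of_height hheight he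

theorem IsLevel.exists_card_edgesAcross_mul_le (hd : G.IsLevel A x d) (a : ℕ) {s : ℕ}
    (hs : 0 < s) :
    ∃ r, a ≤ r ∧ r < a + s ∧
      (G.edgesAcross (A.filter (d · ≤ r)) (A.filter (r < d ·))).card * s ≤
        (G.edgesWithin A).card := by
  by_contra! hcon
  set X : ℕ → Finset E := fun r =>
    G.edgesAcross (A.filter (d · ≤ r)) (A.filter (r < d ·)) with hX
  have hdisj : ((Finset.Ico a (a + s) : Finset ℕ) : Set ℕ).PairwiseDisjoint X := by
    intro i _ j _ hij
    rw [Function.onFun, Finset.disjoint_left]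
    intro e hi hj
    simp only [hX, mem_edgesAcross, Finset.mem_filter] at hi hj
    have h1 := fun hu hv => hd.lipschitz (G.ends e).1 hu (G.ends e).2 hv e (G.joins_ends e)
    have h2 := fun hu hv => hd.lipschitz (G.ends e).2 hv (G.ends e).1 hu e (G.joins_ends e).symm
    rcases hi with hi | hi <;> rcases hj with hj | hj <;>
    · have h1 := h1 (by tauto) (by tauto)
      have h2 := h2 (by tauto) (by tauto)
      omega
  have hsub : (Finset.Ico a (a + s)).biUnion X ⊆ G.edgesWithin A := by
    intro e he
    obtain ⟨r, -, hr⟩ := Finset.mem_biUnion.1 he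
    simp only [hX, mem_edgesAcross, Finset.mem_filter] at hr
    rw [mem_edgesWithin]
    tauto
  have h1 : ∑ r ∈ Finset.Ico a (a + s), (X r).card ≤ (G.edgesWithin A).card := by
    rw [← Finset.card_biUnion hdisj]
    exact Finset.card_le_card hsub
  have h2 : ∑ r ∈ Finset.Ico a (a + s), (G.edgesWithin A).card <
      ∑ r ∈ Finset.Ico a (a + s), (X r).card * s := by
    refine Finset.sum_lt_sum_of_nonempty ⟨a, by simp [hs]⟩ fun r hr => ?_
    rw [Finset.mem_Ico] at hr
    exact hcon r hr.1 hr.2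
  rw [← Finset.sum_mul, Finset.sum_const, Nat.card_Ico, smul_eq_mul, Nat.add_sub_cancel_left] at h2
  nlinarith

end Levels

/-- Discrete region growing. -/
theorem exists_mul_le_of_growth {f c : ℕ → ℕ} {q L : ℕ} (hq : 0 < q) (h0 : 1 ≤ f 0)
    (hf : ∀ l, f l + c l ≤ f (l + 1)) (hL : f (L * q) < 2 ^ L) : ∃ l < L * q, c l * q ≤ f l := by
  by_contra! hcon
  have hq' : (0 : ℝ) < q := by exact_mod_cast hq
  have key : ∀ l ≤ L * q, (1 + 1 / (q : ℝ)) ^ l ≤ f l := by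
    intro l hl
    induction l with
    | zero => simpa using h0
    | succ l ih =>
      have h1 := ih (by omega)
      have h2 : (f l : ℝ) ≤ c l * q := by exact_mod_cast (hcon l (by omega)).le
      have h3 : (f l : ℝ) + c l ≤ f (l + 1) := by exact_mod_cast hf l
      have h4 : (f l : ℝ) / q ≤ c l := by rwa [div_le_iff₀ hq']
      calc (1 + 1 / (q : ℝ)) ^ (l + 1) = (1 + 1 / (q : ℝ)) ^ l * (1 + 1 / q) := pow_succ _ _
        _ ≤ f l * (1 + 1 / q) := by gcongr
        _ = f l + f l / q := by ring
        _ ≤ f (l + 1) := by linarith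
  have h1 : (2 : ℝ) ≤ (1 + 1 / (q : ℝ)) ^ q := by
    have h : (-2 : ℝ) ≤ 1 / q := le_trans (by norm_num) (by positivity : (0 : ℝ) ≤ 1 / q)
    refine le_trans (le_of_eq ?_) (one_add_mul_le_pow h q)
    field_simp
    norm_num
  have h2 := key _ le_rfl
  rw [mul_comm, pow_mul] at h2
  have h3 : (2 : ℝ) ^ L ≤ ((1 + 1 / (q : ℝ)) ^ q) ^ L := by gcongr
  have h4 : (f (L * q) : ℝ) < 2 ^ L := by exact_mod_cast hL
  rw [mul_comm] at h4
  linarith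

/-- `G.ConeReach W d x l n v`: there is an `n`-step walk inside `W` from `x` to `v` that has at
most `l` steps that do not increase the level `d`. -/
inductive ConeReach (G : WGraph V E) (W : Finset V) (d : V → ℕ) (x : V) : ℕ → ℕ → V → Prop
  | nil : ConeReach G W d x 0 0 x
  | forward {l n : ℕ} {u v : V} {e : E} (h : ConeReach G W d x l n u) (hv : v ∈ W)
      (hj : G.Joins e u v) (hd : d v = d u + 1) : ConeReach G W d x l (n + 1) v
  | any {l n : ℕ} {u v : V} {e : E} (h : ConeReach G W d x l n u) (hv : v ∈ W)
      (hj : G.Joins e u v) : ConeReach G W d x (l + 1) (n + 1) v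

section Cones

variable [Fintype E] {G : WGraph V E} {B W : Finset V} {x y : V} {d : V → ℕ} {L q : ℕ}

theorem exists_cone (hq : 0 < q) (hL : Fintype.card E < 2 ^ L) (hBW : Disjoint B W)
    (hd : ∀ u ∈ W, ∀ v ∈ W, ∀ e, G.Joins e u v → d v ≤ d u + 1) (hx : x ∈ W) (hy : y ∈ B)
    {b : E} (hb : G.Joins b y x) :
    ∃ C ⊆ W, x ∈ C ∧ (∀ u ∈ C, ∀ v ∈ W, ∀ e, G.Joins e u v → d v = d u + 1 → v ∈ C) ∧
      (∀ v ∈ C, ∃ n, n + d x ≤ d v + 2 * (L * q) ∧ G.Reach (G.edgesWithin C) n x v) ∧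
      (G.edgesAcross (W \ C) C).card * q ≤
        (G.edgesWithin C).card + (G.edgesAcross B C).card := by
  set C : ℕ → Finset V := fun l => W.filter fun v => ∃ l' ≤ l, ∃ n, G.ConeReach W d x l' n v
    with hC
  have hCW : ∀ l, C l ⊆ W := fun l => Finset.filter_subset _ _
  have hxC : ∀ l, x ∈ C l := fun l =>
    Finset.mem_filter.2 ⟨hx, 0, Nat.zero_le l, 0, .nil⟩
  have hCmono : ∀ l, C l ⊆ C (l + 1) := by
    intro l v hv
    obtain ⟨hv, l', hl', h⟩ := Finset.mem_filter.1 hv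
    exact Finset.mem_filter.2 ⟨hv, l', by omega, h⟩
  have hnext : ∀ l, ∀ u ∈ C l, ∀ v ∈ W, ∀ e, G.Joins e u v → v ∈ C (l + 1) := by
    intro l u hu v hv e he
    obtain ⟨-, l', hl', n, h⟩ := Finset.mem_filter.1 hu
    exact Finset.mem_filter.2 ⟨hv, l' + 1, by omega, n + 1, h.any hv he⟩
  have hdisj : ∀ l, Disjoint B (C l) := fun l => hBW.mono_right (hCW l)
  have hrad : ∀ l l' n v, G.ConeReach W d x l' n v → l' ≤ l →
      v ∈ C l ∧ n + d x ≤ d v + 2 * l' ∧ G.Reach (G.edgesWithin (C l)) n x v := by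
    intro l l' n v h
    induction h with
    | nil => exact fun _ => ⟨hxC l, by omega, .nil x⟩
    | @forward l' n u v e h hv hj hdv ih =>
      intro hl
      obtain ⟨h1, h2, h3⟩ := ih hl
      have hvC : v ∈ C l := Finset.mem_filter.2 ⟨hv, l', hl, n + 1, h.forward hv hj hdv⟩
      exact ⟨hvC, by omega, h3.snoc (hj.mem_edgesWithin_iff.2 ⟨h1, hvC⟩) hj⟩
    | @any l' n u v e h hv hj ih =>
      intro hl
      obtain ⟨h1, h2, h3⟩ := ih (by omega)
      have hvC : v ∈ C l := Finset.mem_filter.2 ⟨hv, l' + 1, hl, n + 1, h.any hv hj⟩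
      have := hd v hv u (hCW l h1) e hj.symm
      exact ⟨hvC, by omega, h3.snoc (hj.mem_edgesWithin_iff.2 ⟨h1, hvC⟩) hj⟩
  set I : ℕ → Finset E := fun l => G.edgesWithin (C l) ∪ G.edgesAcross B (C l) with hI
  have hIcard : ∀ l, (I l).card =
      (G.edgesWithin (C l)).card + (G.edgesAcross B (C l)).card := fun l =>
    Finset.card_union_of_disjoint
      ((disjoint_edgesWithin_edgesAcross (hdisj l)).mono_left Finset.subset_union_right)
  obtain ⟨l, hl, hcut⟩ : ∃ l < L * q,
      (G.edgesAcross (W \ C l) (C l)).card * q ≤ (I l).card := by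
    refine exists_mul_le_of_growth (f := fun l => (I l).card)
      (c := fun l => (G.edgesAcross (W \ C l) (C l)).card) hq ?_ ?_ ?_
    · refine Finset.card_pos.2 ⟨b, Finset.mem_union_right _ ?_⟩
      exact hb.mem_edgesAcross_iff.2 (Or.inl ⟨hy, hxC 0⟩)
    · intro l
      rw [← Finset.card_union_of_disjoint]
      · refine Finset.card_le_card fun e he => ?_
        have h1 := fun hu hv => hnext l (G.ends e).1 hu (G.ends e).2 hv e (G.joins_ends e)
        have h2 := fun hu hv => hnext l (G.ends e).2 hu (G.ends e).1 hv e (G.joins_ends e).symm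
        have h3 := @hCmono l (G.ends e).1
        have h4 := @hCmono l (G.ends e).2
        simp only [hI, Finset.mem_union, mem_edgesWithin, mem_edgesAcross,
          Finset.mem_sdiff] at he ⊢
        tauto
      · rw [Finset.disjoint_left]
        intro e he he'
        have hBW' := Finset.disjoint_left.1 hBW
        have h1 := @hBW' (G.ends e).1
        have h2 := @hBW' (G.ends e).2
        simp only [hI, Finset.mem_union, mem_edgesWithin, mem_edgesAcross,
          Finset.mem_sdiff] at he he'
        tauto
    · exact lt_of_le_of_lt (Finset.card_le_univ _) hL
  refine ⟨C l, hCW l, hxC l, ?_, ?_, ?_⟩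
  · intro u hu v hv e he hdv
    obtain ⟨-, l', hl', n, h⟩ := Finset.mem_filter.1 hu
    exact Finset.mem_filter.2 ⟨hv, l', hl', n + 1, h.forward hv he hdv⟩
  · intro v hv
    obtain ⟨-, l', hl', n, h⟩ := Finset.mem_filter.1 hv
    obtain ⟨-, h2, h3⟩ := hrad l l' n v h hl'
    exact ⟨n, by omega, h3⟩
  · rw [← hIcard]
    exact hcut

/-- Extending a tree on a ball `B` of radius `r` to a tree on `B ∪ W`, by removing cones from `W`
one at a time. -/
theorem exists_tree_union_cones {x₀ : V} {r ρ : ℕ} {F₀ : Finset E} {h₀ h₁ H s₀ K : ℝ}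
    (hq : 0 < q) (hL : Fintype.card E < 2 ^ L)
    (hF₀ : G.IsTreeOn B x₀ F₀ h₀ s₀) (hh₁ : 0 ≤ h₁) (hH₀ : 0 ≤ H) (hK : 0 ≤ K)
    (hH : h₀ + 1 + h₁ ≤ H)
    (hcone : ∀ C x, x ∈ C →
      (∀ v ∈ C, ∃ n, n + (r + 1) ≤ ρ + 2 * (L * q) ∧ G.Reach (G.edgesWithin C) n x v) →
        ∃ F, G.IsTreeOn C x F h₁ (K * (G.edgesWithin C).card))
    (W : Finset V) (hBW : Disjoint B W)
    (hd : ∀ u ∈ W, ∀ v ∈ W, ∀ e, G.Joins e u v → d v ≤ d u + 1)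
    (hdρ : ∀ v ∈ W, d v ≤ ρ)
    (hroot : ∀ v ∈ W, d v = r + 1 → ∃ y ∈ B, ∃ e, G.Joins e y v)
    (hpred : ∀ v ∈ W, d v ≠ r + 1 → ∃ u ∈ W, ∃ e, G.Joins e u v ∧ d v = d u + 1) :
    ∃ F, F₀ ⊆ F ∧ G.IsTreeOn (B ∪ W) x₀ F H
      (s₀ + K * (G.edgesWithin W).card + 2 * H * (G.edgesAcross B W).card +
        2 * H / q * ((G.edgesWithin W).card + (G.edgesAcross B W).card)) := by
  induction W using Finset.strongInduction with
  | H W ih =>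
  rcases W.eq_empty_or_nonempty with rfl | hW
  · refine ⟨F₀, subset_rfl, ?_⟩
    rw [Finset.union_empty]
    refine hF₀.mono (by linarith) ?_
    simp [edgesWithin, edgesAcross]
  obtain ⟨x, hx, hmin⟩ := W.exists_min_image d hW
  have hdx : d x = r + 1 := by
    by_contra hne
    obtain ⟨u, hu, e, -, hdu⟩ := hpred x hx hne
    have := hmin u hu
    omega
  obtain ⟨y, hy, b, hb⟩ := hroot x hx hdx
  obtain ⟨C, hCW, hxC, hclosed, hrad, hcut⟩ := exists_cone hq hL hBW hd hx hy hb
  obtain ⟨F', hF'⟩ := hcone C x hxC fun v hv => by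
    obtain ⟨n, hn, hr⟩ := hrad v hv
    exact ⟨n, by have := hdρ v (hCW hv); omega, hr⟩
  have hsub : W \ C ⊆ W := Finset.sdiff_subset
  have hss : W \ C ⊂ W := Finset.sdiff_ssubset hCW ⟨x, hxC⟩
  obtain ⟨F, hF₀F, hF⟩ := ih (W \ C) hss (hBW.mono_right hsub)
    (fun u hu v hv => hd u (hsub hu) v (hsub hv)) (fun v hv => hdρ v (hsub hv))
    (fun v hv => hroot v (hsub hv)) (fun v hv hne => by
      obtain ⟨u, hu, e, he, hdu⟩ := hpred v (hsub hv) hne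
      refine ⟨u, Finset.mem_sdiff.2 ⟨hu, fun huC => ?_⟩, e, he, hdu⟩
      exact (Finset.mem_sdiff.1 hv).2 (hclosed u huC v (hsub hv) e he hdu))
  have hBC : Disjoint B C := hBW.mono_right hCW
  have hWC : Disjoint (W \ C) C := Finset.sdiff_disjoint
  have hWeq : W \ C ∪ C = W := Finset.sdiff_union_of_subset hCW
  obtain ⟨n, hn, hr⟩ := hF₀.height y hy
  have hglue := hF.glue hF' (Finset.disjoint_union_left.2 ⟨hBC, hWC⟩) hxC
    (Finset.mem_union_left _ hy) hb (hr.mono hF₀F) (by linarith)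
  rw [Finset.union_assoc, hWeq] at hglue
  refine ⟨_, fun e he => ?_, hglue.mono le_rfl ?_⟩
  · simp [hF₀F he]
  have e1 := card_edgesWithin_union (G := G) hWC
  have e2 := card_edgesAcross_add_le (G := G) (hBW.mono_right hsub) hBC hWC
  have e3 := card_edgesAcross_union_left_le (G := G) B (W \ C) C
  rw [hWeq] at e1 e2
  have e4 : ((G.edgesAcross (W \ C) C).card : ℝ) ≤
      ((G.edgesWithin C).card + (G.edgesAcross B C).card) / q := by
    rw [le_div_iff₀ (by exact_mod_cast hq)]
    exact_mod_cast hcut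
  have e1' : ((G.edgesWithin W).card : ℝ) = (G.edgesWithin (W \ C)).card +
      (G.edgesWithin C).card + (G.edgesAcross (W \ C) C).card := by exact_mod_cast e1
  have e2' : ((G.edgesAcross B (W \ C)).card : ℝ) + (G.edgesAcross B C).card ≤
      (G.edgesAcross B W).card := by exact_mod_cast e2
  have e3' : ((G.edgesAcross (B ∪ W \ C) C).card : ℝ) ≤
      (G.edgesAcross B C).card + (G.edgesAcross (W \ C) C).card := by exact_mod_cast e3
  have hH₂ : 0 ≤ 2 * H := by linarith
  have hHq : 0 ≤ 2 * H / q := by positivity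
  have hX : (0 : ℝ) ≤ (G.edgesAcross (W \ C) C).card := Nat.cast_nonneg _
  have i1 := mul_le_mul_of_nonneg_left e3' hH₂
  have i2 := mul_le_mul_of_nonneg_left e2' hH₂
  have i3 := mul_le_mul_of_nonneg_left e2' hHq
  have i4 := mul_le_mul_of_nonneg_left e4 hH₂
  have i5 := mul_nonneg hK hX
  have i6 := mul_nonneg hHq hX
  have i7 : 2 * H * (((G.edgesWithin C).card + (G.edgesAcross B C).card) / q) =
      2 * H / q * ((G.edgesWithin C).card + (G.edgesAcross B C).card) := by ring
  rw [e1']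
  linarith

end Cones

theorem one_add_pow_le_sqrt_exp {L t : ℕ} (hL : 0 < L) (ht : t ≤ 4 * L) :
    (1 + 1 / (8 * L) : ℝ) ^ t ≤ √(Real.exp 1) := by
  have hL' : (0 : ℝ) < L := by exact_mod_cast hL
  have ht' : (t : ℝ) ≤ 4 * L := by exact_mod_cast ht
  calc (1 + 1 / (8 * L) : ℝ) ^ t ≤ Real.exp (1 / (8 * L)) ^ t := by
        gcongr
        rw [add_comm]
        exact Real.add_one_le_exp _
    _ = Real.exp (t * (1 / (8 * L))) := (Real.exp_nat_mul _ _).symm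
    _ ≤ Real.exp (1 / 2) := by
        gcongr
        rw [mul_one_div, div_le_div_iff₀ (by positivity) (by norm_num)]
        linarith
    _ = √(Real.exp 1) := Real.exp_half 1

theorem sqrt_exp_one_le_two : √(Real.exp 1) ≤ 2 := by
  rw [Real.sqrt_le_iff]
  have := Real.exp_one_lt_three
  constructor <;> linarith

theorem exists_lowStretch_tree [Fintype E] [Nonempty E] {G : WGraph V E} {L : ℕ} (hL₀ : 0 < L)
    (hL : Fintype.card E < 2 ^ L) {t : ℕ} (ht : t ≤ 4 * L) {A : Finset V} {x : V} {ρ : ℕ}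
    (hx : x ∈ A) (hρ : (ρ : ℝ) ≤ (6 / 5) ^ t)
    (hA : ∀ v ∈ A, ∃ n ≤ ρ, G.Reach (G.edgesWithin A) n x v) :
    ∃ F, G.IsTreeOn A x F ((1 + 1 / (8 * L)) ^ t * ρ)
      ((32 * L ^ 2 + 144 * L ^ 2 * t) * (G.edgesWithin A).card) := by
  have hL₁ : (1 : ℝ) ≤ L := by exact_mod_cast hL₀
  have hL₂ : (1 : ℝ) ≤ (L : ℝ) ^ 2 := one_le_pow₀ hL₁
  induction t generalizing A x ρ with
  | zero =>
    obtain ⟨F, hF⟩ := exists_breadthFirst_tree hx hA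
    refine ⟨F, hF.mono (by simp) ?_⟩
    have : (ρ : ℝ) ≤ 1 := by simpa using hρ
    gcongr
    push_cast
    nlinarith
  | succ t ih =>
    have hκ₁ : (1 : ℝ) ≤ (1 + 1 / (8 * L)) ^ t := one_le_pow₀ (by simp)
    have hκ₂ : (1 + 1 / (8 * L) : ℝ) ^ (t + 1) ≤ 2 :=
      (one_add_pow_le_sqrt_exp hL₀ ht).trans sqrt_exp_one_le_two
    have hκ₃ : (1 : ℝ) ≤ (1 + 1 / (8 * L)) ^ (t + 1) := one_le_pow₀ (by simp)
    by_cases hsmall : ρ < 16 * L ^ 2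
    · obtain ⟨F, hF⟩ := exists_breadthFirst_tree hx hA
      have hρ' : (ρ : ℝ) ≤ 16 * L ^ 2 := by exact_mod_cast hsmall.le
      refine ⟨F, hF.mono (le_mul_of_one_le_left (Nat.cast_nonneg _) hκ₃) ?_⟩
      gcongr
      have : (0 : ℝ) ≤ 144 * L ^ 2 * (t + 1 : ℕ) := by positivity
      linarith
    push Not at hsmall
    have hρ₁₆ : 16 ≤ ρ := le_trans (by nlinarith) hsmall
    obtain ⟨d, hd, hdρ, hdle⟩ := exists_isLevel hA
    set s := ρ / 3 with hs
    set q := ρ / (16 * L ^ 2) with hqdef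
    have hq : 0 < q := Nat.div_pos hsmall (by positivity)
    have hqρ : q * (16 * L ^ 2) ≤ ρ := Nat.div_mul_le_self _ _
    have hρq : ρ < (q + 1) * (16 * L ^ 2) := by
      rw [mul_comm]
      exact Nat.lt_mul_div_succ ρ (by positivity)
    obtain ⟨r, hsr, hrs, hcut⟩ := hd.exists_card_edgesAcross_mul_le s (s := s) (by omega)
    set B := A.filter (d · ≤ r) with hB
    set W := A.filter (r < d ·) with hW
    have hBW : Disjoint B W := by
      rw [Finset.disjoint_left]
      intro v hv hv'
      exact absurd (Finset.mem_filter.1 hv).2 (not_le.2 (Finset.mem_filter.1 hv').2)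
    have hBWA : B ∪ W = A := by
      ext v
      simp only [hB, hW, Finset.mem_union, Finset.mem_filter, ← and_or_left, le_or_gt, and_true]
    have hqR : (0 : ℝ) < q := by exact_mod_cast hq
    have hqρR : (q : ℝ) * (16 * L ^ 2) ≤ ρ := by exact_mod_cast hqρ
    have hLq : 2 * (L * q : ℝ) ≤ 1 / (8 * L) * ρ := by
      rw [one_div, inv_mul_eq_div, le_div_iff₀ (by positivity)]
      linarith
    have hLq' : 2 * (L * q : ℝ) ≤ 1 / 8 * ρ := by
      refine hLq.trans ?_
      gcongr
      linarith
    have hrρ : (r : ℝ) + 1 ≤ 2 / 3 * ρ := by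
      have : 3 * (r + 1) ≤ 2 * ρ := by omega
      have : 3 * ((r : ℝ) + 1) ≤ 2 * ρ := by exact_mod_cast this
      linarith
    have hrρ' : (ρ : ℝ) ≤ 3 * (r + 1) := by
      have : ρ ≤ 3 * (r + 1) := by omega
      exact_mod_cast this
    have hρt : 5 / 6 * (ρ : ℝ) ≤ (6 / 5) ^ t := by
      rw [pow_succ] at hρ
      linarith
    have hρ₀ : (0 : ℝ) ≤ ρ := Nat.cast_nonneg _
    have hxB : x ∈ B := Finset.mem_filter.2 ⟨hx, by have := hdle x 0 (.nil x); omega⟩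
    obtain ⟨F₀, hF₀⟩ := ih (by omega) (ρ := r) hxB (by linarith) (fun v hv => by
      obtain ⟨hvA, hvr⟩ := Finset.mem_filter.1 hv
      obtain ⟨n, hn, hr⟩ := hd.reach (r := r) (G.edgesWithin B) (fun v hv hvx hvr => by
        obtain ⟨u, hu, e, he, hdu⟩ := hd.pred v hv hvx
        refine ⟨u, hu, e, he.mem_edgesWithin_iff.2 ⟨?_, ?_⟩, he, hdu⟩
        · exact Finset.mem_filter.2 ⟨hu, by omega⟩
        · exact Finset.mem_filter.2 ⟨hv, hvr⟩) v hvA hvr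
      exact ⟨n, hn.trans hvr, hr⟩)
    obtain ⟨ρ', hρ'⟩ : ∃ ρ', ρ' + (r + 1) = ρ + 2 * (L * q) :=
      ⟨ρ + 2 * (L * q) - (r + 1), by omega⟩
    have hρ'R : (ρ' : ℝ) + (r + 1) = ρ + 2 * (L * q) := by exact_mod_cast hρ'
    set κ : ℝ := (1 + 1 / (8 * L)) ^ t with hκ
    set K : ℝ := 32 * L ^ 2 + 144 * L ^ 2 * t with hK
    have hK₀ : 0 ≤ K := by positivity
    have hWA : W ⊆ A := Finset.filter_subset _ _
    obtain ⟨F, -, hF⟩ := exists_tree_union_cones (d := d) (r := r) (ρ := ρ) (h₁ := κ * ρ')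
      (H := κ * (ρ + 2 * (L * q))) (K := K) hq hL hF₀ (by positivity) (by positivity) hK₀
      (by rw [← hρ'R]; linarith)
      (fun C y hy hC => ih (by omega) hy (by linarith) fun v hv => by
        obtain ⟨n, hn, hr⟩ := hC v hv
        exact ⟨n, by omega, hr⟩)
      W hBW (fun u hu v hv => hd.lipschitz u (hWA hu) v (hWA hv))
      (fun v hv => hdρ v (hWA hv))
      (fun v hv hdv => by
        obtain ⟨u, hu, e, he, hdu⟩ := hd.pred v (hWA hv) (by
          rintro rfl
          exact Finset.disjoint_left.1 hBW hxB hv)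
        exact ⟨u, Finset.mem_filter.2 ⟨hu, by omega⟩, e, he⟩)
      (fun v hv hdv => by
        obtain ⟨u, hu, e, he, hdu⟩ := hd.pred v (hWA hv) (by
          rintro rfl
          exact Finset.disjoint_left.1 hBW hxB hv)
        have := (Finset.mem_filter.1 hv).2
        exact ⟨u, Finset.mem_filter.2 ⟨hu, by omega⟩, e, he, hdu⟩)
    rw [hBWA] at hF
    have hH : κ * (ρ + 2 * (L * q)) ≤ (1 + 1 / (8 * L)) ^ (t + 1) * ρ := by
      rw [pow_succ, ← hκ, mul_assoc]
      gcongr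
      linarith
    refine ⟨F, hF.mono hH ?_⟩
    have hH₂ : κ * (ρ + 2 * (L * q)) ≤ 2 * ρ := hH.trans (by gcongr)
    have hcard : ((G.edgesWithin A).card : ℝ) = (G.edgesWithin B).card +
        (G.edgesWithin W).card + (G.edgesAcross B W).card := by
      rw [← hBWA]
      exact_mod_cast card_edgesWithin_union hBW
    have hρs : (ρ : ℝ) ≤ 4 * s := by
      have : ρ ≤ 4 * s := by omega
      exact_mod_cast this
    have hcutR : ((G.edgesAcross B W).card : ℝ) * s ≤ (G.edgesWithin A).card := by
      exact_mod_cast hcut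
    have hcut₁ : 2 * (κ * (ρ + 2 * (L * q))) * (G.edgesAcross B W).card ≤
        16 * L ^ 2 * (G.edgesWithin A).card := by
      calc 2 * (κ * (ρ + 2 * (L * q))) * (G.edgesAcross B W).card
          ≤ 2 * (2 * (4 * s)) * (G.edgesAcross B W).card :=
            mul_le_mul_of_nonneg_right (by linarith) (Nat.cast_nonneg _)
        _ = 16 * ((G.edgesAcross B W).card * s) := by ring
        _ ≤ 16 * (G.edgesWithin A).card := by gcongr
        _ ≤ 16 * L ^ 2 * (G.edgesWithin A).card := by
            gcongr
            linarith
    have hρqR : (ρ : ℝ) ≤ 32 * L ^ 2 * q := by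
      have h1 : (ρ : ℝ) ≤ (q + 1) * (16 * L ^ 2) := by exact_mod_cast hρq.le
      have h2 : (1 : ℝ) ≤ q := by exact_mod_cast hq
      nlinarith
    have hcut₂ : 2 * (κ * (ρ + 2 * (L * q))) / q ≤ 128 * L ^ 2 := by
      rw [div_le_iff₀ hqR]
      linarith
    have hcut₃ : 2 * (κ * (ρ + 2 * (L * q))) / q *
        ((G.edgesWithin W).card + (G.edgesAcross B W).card) ≤
          128 * L ^ 2 * (G.edgesWithin A).card := by
      gcongr
      rw [hcard]
      have : (0 : ℝ) ≤ (G.edgesWithin B).card := Nat.cast_nonneg _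
      linarith
    have hKle : K * (G.edgesWithin B).card + K * (G.edgesWithin W).card ≤
        K * (G.edgesWithin A).card := by
      rw [← mul_add]
      gcongr
      rw [hcard]
      have : (0 : ℝ) ≤ (G.edgesAcross B W).card := Nat.cast_nonneg _
      linarith
    push_cast
    rw [hK] at hKle ⊢
    linarith

section Weighted

variable {G : WGraph V E} {F : Finset E} {u v : V} {n : ℕ}

theorem Walk.length_nonneg : ∀ {u v : V} (p : G.Walk u v), 0 ≤ p.length
  | _, _, .nil _ => le_rfl
  | _, _, .cons _ _ _ e _ p =>
    add_nonneg (one_div_nonneg.2 (G.w_pos e).le) (Walk.length_nonneg p)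

theorem dist_nonneg : 0 ≤ G.dist u v := by
  refine Real.sInf_nonneg ?_
  rintro _ ⟨p, rfl⟩
  exact p.length_nonneg

theorem dist_le_length (p : G.Walk u v) : G.dist u v ≤ p.length :=
  csInf_le ⟨0, by rintro _ ⟨p, rfl⟩; exact p.length_nonneg⟩ ⟨p, rfl⟩

theorem radius_le {r : ℝ} (h : ∀ v, G.dist u v ≤ r) : G.radius u ≤ r :=
  csInf_le ⟨0, fun _ hr => dist_nonneg.trans (hr u)⟩ h

theorem dist_le_radius [Fintype V] : G.dist u v ≤ G.radius u := by
  refine le_csInf ⟨∑ v, G.dist u v, fun v => ?_⟩ fun r hr => hr v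
  exact Finset.single_le_sum (f := fun v => G.dist u v) (fun _ _ => dist_nonneg) (Finset.mem_univ v)

theorem exists_walk_of_reach (hw : ∀ e, G.w e = 1) (h : G.Reach F n u v) :
    ∃ p : (G.restrictE (F : Set E)).Walk v u, p.length = n := by
  induction h with
  | nil v => exact ⟨.nil v, by simp [Walk.length]⟩
  | @snoc n u v w e _ he hj ih =>
    obtain ⟨p, hp⟩ := ih
    refine ⟨.cons w v u ⟨e, he⟩ hj.symm p, ?_⟩
    change 1 / G.w e + p.length = _
    rw [hp, hw]
    push_cast
    ring

theorem dist_restrictE_le_of_reach (hw : ∀ e, G.w e = 1) (h : G.Reach F n u v) :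
    (G.restrictE (F : Set E)).dist u v ≤ n := by
  obtain ⟨p, hp⟩ := exists_walk_of_reach hw h.symm
  exact hp ▸ dist_le_length p

theorem Walk.exists_reach [Fintype E] (hw : ∀ e, G.w e = 1) : ∀ {u v : V} (p : G.Walk u v),
    ∃ n : ℕ, p.length = n ∧ G.Reach Finset.univ n u v
  | _, _, .nil v => ⟨0, by simp [Walk.length], .nil v⟩
  | _, _, .cons _ _ _ e h p => by
    obtain ⟨n, hn, hr⟩ := Walk.exists_reach hw p
    refine ⟨1 + n, by simp [Walk.length, hn, len, hw],
      (Reach.single (Finset.mem_univ e) h).trans hr⟩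

theorem IsLevel.le_card_edges [Fintype V] [Fintype E] {d : V → ℕ} {x : V}
    (hd : G.IsLevel Finset.univ x d) (hx : d x = 0) (v : V) : d v ≤ Fintype.card E := by
  have key : ∀ k, ∀ v, d v = k → ∀ j < k, ∃ e, min (d (G.ends e).1) (d (G.ends e).2) = j := by
    intro k
    induction k with
    | zero => exact fun v _ j hj => absurd hj (Nat.not_lt_zero j)
    | succ k ih =>
      intro v hv j hj
      obtain ⟨u, -, e, he, hu⟩ := hd.pred v (Finset.mem_univ v) (by rintro rfl; omega)
      rcases Nat.lt_succ_iff_lt_or_eq.1 hj with hj | rfl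
      · exact ih u (by omega) j hj
      · refine ⟨e, ?_⟩
        rcases he with he | he <;> rw [he] <;> dsimp only <;> omega
  have hsub : Finset.range (d v) ⊆
      Finset.univ.image fun e => min (d (G.ends e).1) (d (G.ends e).2) := by
    intro j hj
    obtain ⟨e, he⟩ := key _ v rfl j (Finset.mem_range.1 hj)
    exact Finset.mem_image.2 ⟨e, Finset.mem_univ e, he⟩
  simpa using (Finset.card_le_card hsub).trans Finset.card_image_le

end Weighted

end WGraph

/-- Low-stretch spanning trees for unweighted connected graphs
(all edge weights 1) with `m ≥ 2` edges: `radius(T,x0) ≤ √e · radius(G,x0)` and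
`avestretch(T,E) ≤ C · (log m)³`. -/
theorem lowStretchTree_unweighted :
    ∃ C : ℝ, ∀ (V E : Type) [Fintype V] [Fintype E] (G : WGraph V E),
      G.Connected → (∀ e : E, G.w e = 1) → 2 ≤ Fintype.card E → ∀ x0 : V,
        ∃ T : Finset E, G.IsSpanningTree T ∧
          (G.restrictE (T : Set E)).radius x0 ≤
            Real.sqrt (Real.exp 1) * G.radius x0 ∧
          G.avestretch T ≤ C * Real.log (Fintype.card E) ^ 3 := by
  refine ⟨16416, fun V E _ _ G hconn hw hm x₀ => ?_⟩
  have : Nonempty E := Fintype.card_pos_iff.1 (by omega)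
  have huniv : G.edgesWithin Finset.univ = Finset.univ := by simp [WGraph.edgesWithin]
  have hreach : ∀ v, ∃ n, G.Reach (G.edgesWithin Finset.univ) n x₀ v := fun v => by
    obtain ⟨p⟩ := hconn x₀ v
    obtain ⟨n, -, hr⟩ := p.exists_reach hw
    exact ⟨n, huniv ▸ hr⟩
  choose N hN using hreach
  obtain ⟨d, hd, -, hdle⟩ := WGraph.exists_isLevel (G := G) (A := Finset.univ) (x := x₀)
    (ρ := ∑ v, N v) fun v _ =>
      ⟨N v, Finset.single_le_sum (fun _ _ => Nat.zero_le _) (Finset.mem_univ v), hN v⟩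
  have hdx : d x₀ = 0 := Nat.le_zero.1 (hdle x₀ 0 (.nil x₀))
  obtain ⟨v₀, -, hv₀⟩ := Finset.exists_max_image Finset.univ d ⟨x₀, Finset.mem_univ x₀⟩
  have hradius : (d v₀ : ℝ) ≤ G.radius x₀ := by
    refine le_trans (le_csInf ?_ ?_) (WGraph.dist_le_radius (v := v₀))
    · obtain ⟨p⟩ := hconn x₀ v₀
      exact ⟨_, p, rfl⟩
    · rintro _ ⟨p, rfl⟩
      obtain ⟨n, hn, hr⟩ := p.exists_reach hw
      rw [hn]
      exact_mod_cast hdle v₀ n (huniv ▸ hr)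
  set m := Fintype.card E with hmdef
  set L := Nat.log 2 m + 1 with hLdef
  have hL : m < 2 ^ L := Nat.lt_pow_succ_log_self (by norm_num) m
  have hρ : (d v₀ : ℝ) ≤ (6 / 5) ^ (4 * L) := by
    calc (d v₀ : ℝ) ≤ m := by exact_mod_cast hd.le_card_edges hdx v₀
      _ ≤ 2 ^ L := by exact_mod_cast hL.le
      _ ≤ ((6 / 5) ^ 4) ^ L := by gcongr; norm_num
      _ = (6 / 5) ^ (4 * L) := (pow_mul _ _ _).symm
  obtain ⟨F, hF⟩ := WGraph.exists_lowStretch_tree (G := G) (L := L) (Nat.succ_pos _) hL le_rfl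
    (Finset.mem_univ x₀) hρ fun v hv => by
      obtain ⟨n, hn, hr⟩ := hd.reach (r := d v₀) Finset.univ (fun v hv hvx _ => by
        obtain ⟨u, hu, e, he, hdu⟩ := hd.pred v hv hvx
        exact ⟨u, hu, e, Finset.mem_univ e, he, hdu⟩) v hv (hv₀ v hv)
      exact ⟨n, hn.trans (hv₀ v hv), huniv ▸ hr⟩
  refine ⟨F, ⟨fun u v => ?_, hF.card⟩, ?_, ?_⟩
  · obtain ⟨n, -, hr⟩ :=
      WGraph.exists_reach_of_height hF.height (Finset.mem_univ v) (Finset.mem_univ u)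
    exact ⟨(WGraph.exists_walk_of_reach hw hr).choose⟩
  · refine WGraph.radius_le fun v => ?_
    obtain ⟨n, hn, hr⟩ := hF.height v (Finset.mem_univ v)
    refine (WGraph.dist_restrictE_le_of_reach hw hr).trans (hn.trans ?_)
    exact mul_le_mul (WGraph.one_add_pow_le_sqrt_exp (Nat.succ_pos _) le_rfl) hradius
      (Nat.cast_nonneg _) (Real.sqrt_nonneg _)
  · have hm₀ : (0 : ℝ) < m := by exact_mod_cast (by omega : 0 < m)
    have hstretch : ∀ e, G.stretch F e ≤ G.hopDist F e := fun e => by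
      obtain ⟨n, -, hr⟩ := WGraph.exists_reach_of_height hF.height
        (Finset.mem_univ (G.ends e).1) (Finset.mem_univ (G.ends e).2)
      rw [WGraph.stretch, WGraph.len, hw, div_one, div_one]
      exact WGraph.dist_restrictE_le_of_reach hw (Nat.sInf_mem
        (s := {n | G.Reach F n (G.ends e).1 (G.ends e).2}) ⟨n, hr⟩)
    have hlog : (L : ℝ) ≤ 3 * Real.log m := by
      have h1 : ((Nat.log 2 m : ℕ) : ℝ) * Real.log 2 ≤ Real.log m := by
        rw [← Real.log_pow]
        refine Real.log_le_log (by positivity) ?_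
        exact_mod_cast Nat.pow_log_le_self 2 (by omega)
      have h2 : Real.log 2 ≤ Real.log m :=
        Real.log_le_log (by norm_num) (by exact_mod_cast hm)
      have h3 := Real.log_two_gt_d9
      have h4 : (0 : ℝ) ≤ (Nat.log 2 m : ℕ) := Nat.cast_nonneg _
      rw [hLdef]
      push_cast
      nlinarith
    have hL₁ : (1 : ℝ) ≤ L := by exact_mod_cast Nat.succ_pos _
    have hsum := hF.stretch
    rw [huniv, Finset.card_univ] at hsum
    rw [WGraph.avestretch, div_le_iff₀ hm₀]
    refine (Finset.sum_le_sum fun e _ => hstretch e).trans (hsum.trans ?_)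
    gcongr
    calc (32 * (L : ℝ) ^ 2 + 144 * L ^ 2 * (4 * L : ℕ)) ≤ 608 * L ^ 3 := by
          push_cast
          nlinarith [sq_nonneg (L : ℝ)]
      _ ≤ 608 * (3 * Real.log m) ^ 3 := by gcongr
      _ = 16416 * Real.log m ^ 3 := by ring
end
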